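/- arXiv:1910.05697 — 8 statements merged into one kernel-verified Lean document; each statement's English description precedes it below -/
import Mathlib

section
/- Let w ∈ ℝ^d be a nonzero vector and for each i ∈ {1,…,d} set p_i = w_i²/(2‖w‖²) + 1/(2d), where ‖·‖ is the Euclidean norm. Define a random vector ŵ ∈ ℝ^d as follows: sample an index i with probability p_i; then with probability w_i/p_i − ⌊w_i/p_i⌋ output (⌊w_i/p_i⌋ + 1)·e_i, and otherwise output ⌊w_i/p_i⌋·e_i, where e_i is the i-th standard basis vector. Then (1) E[ŵ] = w, and (2) for every unit vector u ∈ ℝ^d, E⟨u, ŵ − w⟩² ≤ E⟨u, ŵ⟩² ≤ 1/4 + 2‖w‖². -/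
open scoped RealInnerProductSpace

/-- The second moment of the randomized rounding of `x` is `x ^ 2` plus the variance of a
Bernoulli variable, which is at most `1 / 4`. -/
theorem randomized_rounding_sq_le (x : ℝ) :
    (x - ⌊x⌋) * (⌊x⌋ + 1 : ℝ) ^ 2 + (1 - (x - ⌊x⌋)) * (⌊x⌋ : ℝ) ^ 2 ≤ x ^ 2 + 1 / 4 := by
  nlinarith [sq_nonneg (x - ⌊x⌋ - 1 / 2)]

/-- The random sketch `ŵ` of a nonzero vector `w ∈ ℝ^d`: choose index `i`
with probability `p i = w i ^ 2 / (2‖w‖²) + 1/(2d)`, then output `(⌊w i / p i⌋ + 1) • e_i`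
with probability `w i / p i - ⌊w i / p i⌋` and `⌊w i / p i⌋ • e_i` otherwise.  Then `E ŵ = w`,
and for every unit vector `u`, `E⟪u, ŵ - w⟫² ≤ E⟪u, ŵ⟫² ≤ 1/4 + 2‖w‖²`.  Here the distribution
of `ŵ` is encoded by the finitely many outcomes `v i b` with probabilities `q i b`. -/
theorem random_sketch_estimator
    (d : ℕ) (hd : 0 < d) (w : EuclideanSpace ℝ (Fin d)) (hw : w ≠ 0)
    (p : Fin d → ℝ) (hp : ∀ i, p i = (w i) ^ 2 / (2 * ‖w‖ ^ 2) + 1 / (2 * d))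
    (v : Fin d → Bool → EuclideanSpace ℝ (Fin d))
    (hv : ∀ i b, v i b =
      ((⌊w i / p i⌋ : ℝ) + if b then 1 else 0) • EuclideanSpace.single i (1 : ℝ))
    (q : Fin d → Bool → ℝ)
    (hqt : ∀ i, q i true = p i * (w i / p i - ⌊w i / p i⌋))
    (hqf : ∀ i, q i false = p i * (1 - (w i / p i - ⌊w i / p i⌋))) :
    (∑ i, ∑ b, q i b • v i b) = w ∧
    ∀ u : EuclideanSpace ℝ (Fin d), ‖u‖ = 1 →
      (∑ i, ∑ b, q i b * ⟪u, v i b - w⟫ ^ 2) ≤ (∑ i, ∑ b, q i b * ⟪u, v i b⟫ ^ 2) ∧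
      (∑ i, ∑ b, q i b * ⟪u, v i b⟫ ^ 2) ≤ 1 / 4 + 2 * ‖w‖ ^ 2 := by
  have hd0 : (0 : ℝ) < d := by exact_mod_cast hd
  have hw0 : 0 < ‖w‖ ^ 2 := by positivity
  have hwsum : ‖w‖ ^ 2 = ∑ i, w i ^ 2 := EuclideanSpace.real_norm_sq_eq w
  have hpos : ∀ i, 0 < p i := fun i => by
    rw [hp]
    positivity
  have hsum : ∑ i, p i = 1 := by
    simp only [hp, Finset.sum_add_distrib, ← Finset.sum_div, ← hwsum, Finset.sum_const,
      Finset.card_univ, Fintype.card_fin, nsmul_eq_mul]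
    field_simp
    norm_num
  have hle : ∀ i, p i ≤ 1 := fun i =>
    hsum ▸ Finset.single_le_sum (fun j _ => (hpos j).le) (Finset.mem_univ i)
  have hsq : ∀ i, w i ^ 2 ≤ 2 * ‖w‖ ^ 2 * p i := fun i => by
    have h : 2 * ‖w‖ ^ 2 * p i = w i ^ 2 + ‖w‖ ^ 2 / d := by
      rw [hp]
      field_simp
    have : 0 ≤ ‖w‖ ^ 2 / d := by positivity
    linarith
  have hmean : ∑ i, ∑ b, q i b • v i b = w := by
    have h : ∀ i, ∑ b, q i b • v i b = w i • EuclideanSpace.single i (1 : ℝ) := fun i => by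
      have hx : p i * (w i / p i) = w i := mul_div_cancel₀ _ (hpos i).ne'
      simp only [Fintype.sum_bool, hv, hqt, hqf, smul_smul, ← add_smul]
      congr 1
      simp only [if_true, Bool.false_eq_true, if_false]
      linear_combination hx
    simp only [h]
    ext j
    simp [Finset.sum_apply, Pi.single_apply]
  refine ⟨hmean, fun u hu => ⟨?_, ?_⟩⟩
  · have hm : ∑ i, ∑ b, q i b * ⟪u, v i b⟫ = ⟪u, w⟫ := by
      conv_rhs => rw [← hmean]
      simp only [inner_sum, inner_smul_right]
    have hq : ∑ i, ∑ b, q i b = 1 := by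
      rw [← hsum]
      refine Finset.sum_congr rfl fun i _ => ?_
      rw [Fintype.sum_bool, hqt, hqf]
      ring
    have h : ∑ i, ∑ b, q i b * ⟪u, v i b - w⟫ ^ 2 = (∑ i, ∑ b, q i b * ⟪u, v i b⟫ ^ 2)
        - 2 * ⟪u, w⟫ * (∑ i, ∑ b, q i b * ⟪u, v i b⟫) + ⟪u, w⟫ ^ 2 * ∑ i, ∑ b, q i b := by
      simp only [Finset.mul_sum, ← Finset.sum_sub_distrib, ← Finset.sum_add_distrib]
      refine Finset.sum_congr rfl fun i _ => Finset.sum_congr rfl fun b _ => ?_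
      rw [inner_sub_right]
      ring
    rw [h, hm, hq]
    nlinarith [sq_nonneg ⟪u, w⟫]
  · have husum : ∑ i, u i ^ 2 = 1 := by
      rw [← EuclideanSpace.real_norm_sq_eq, hu, one_pow]
    have hterm : ∀ i, ∑ b, q i b * ⟪u, v i b⟫ ^ 2 ≤ u i ^ 2 * (1 / 4 + 2 * ‖w‖ ^ 2) := fun i => by
      have hin : ⟪u, EuclideanSpace.single i (1 : ℝ)⟫ = u i := by
        simp [EuclideanSpace.inner_single_right]
      have hx : p i * (w i / p i) ^ 2 ≤ 2 * ‖w‖ ^ 2 := by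
        have : p i * (w i / p i) ^ 2 = w i ^ 2 / p i := by
          have := (hpos i).ne'
          field_simp
        rw [this, div_le_iff₀ (hpos i)]
        exact hsq i
      have hround := mul_le_mul_of_nonneg_left
        (randomized_rounding_sq_le (w i / p i)) (hpos i).le
      simp only [Fintype.sum_bool, hv, hqt, hqf, inner_smul_right, hin, if_true,
        Bool.false_eq_true, if_false]
      calc _ = u i ^ 2 * (p i * ((w i / p i - ⌊w i / p i⌋) * (⌊w i / p i⌋ + 1 : ℝ) ^ 2
            + (1 - (w i / p i - ⌊w i / p i⌋)) * (⌊w i / p i⌋ : ℝ) ^ 2)) := by ring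
        _ ≤ _ := mul_le_mul_of_nonneg_left (by linarith [hle i]) (sq_nonneg _)
    calc _ ≤ ∑ i, u i ^ 2 * (1 / 4 + 2 * ‖w‖ ^ 2) := Finset.sum_le_sum fun i _ => hterm i
      _ = _ := by rw [← Finset.sum_mul, husum, one_mul]
end

section
/- There exists a constant B > 0 such that for every integer n ≥ 1 and every x ∈ ℝ, the n-th derivative of the softplus function f(x) = ln(1 + eˣ) satisfies |f⁽ⁿ⁾(x)| ≤ n!·Bⁿ. In other words, the function x ↦ ln(1 + eˣ) is strongly-bounded. -/
/-- The Leibniz rule bounds the derivatives of `f * f` when those of `f` grow at most like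
`k ! * B ^ k`. -/
lemma abs_iteratedDeriv_mul_self_le {f : ℝ → ℝ} {B x : ℝ} {n : ℕ} (hf : ContDiffAt ℝ n f x)
    (h : ∀ k ≤ n, |iteratedDeriv k f x| ≤ k.factorial * B ^ k) :
    |iteratedDeriv n (f * f) x| ≤ (n + 1).factorial * B ^ n := by
  rw [iteratedDeriv_mul hf hf]
  calc _ ≤ ∑ i ∈ Finset.range (n + 1),
        |n.choose i * iteratedDeriv i f x * iteratedDeriv (n - i) f x| :=
        Finset.abs_sum_le_sum_abs _ _
    _ ≤ ∑ _i ∈ Finset.range (n + 1), n.factorial * B ^ n := by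
        refine Finset.sum_le_sum fun i hi ↦ ?_
        have hi : i ≤ n := Nat.lt_succ_iff.mp (Finset.mem_range.mp hi)
        rw [abs_mul, abs_mul, Nat.abs_cast]
        calc _ ≤ n.choose i * (i.factorial * B ^ i) * ((n - i).factorial * B ^ (n - i)) :=
              mul_le_mul (mul_le_mul_of_nonneg_left (h i hi) (Nat.cast_nonneg _))
                (h _ (Nat.sub_le _ _)) (abs_nonneg _)
                (mul_nonneg (Nat.cast_nonneg _) ((abs_nonneg _).trans (h i hi)))
          _ = (n.choose i * i.factorial * (n - i).factorial : ℕ) * (B ^ i * B ^ (n - i)) := by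
              push_cast; ring
          _ = n.factorial * B ^ n := by
              rw [Nat.choose_mul_factorial_mul_factorial hi, ← pow_add, Nat.add_sub_cancel' hi]
    _ = (n + 1).factorial * B ^ n := by
        simp [Nat.factorial_succ, mul_assoc]

/-- The derivatives of the sigmoid are controlled through the logistic equation `s' = s - s * s`. -/
lemma abs_iteratedDeriv_sigmoid_le (n : ℕ) (x : ℝ) :
    |iteratedDeriv n Real.sigmoid x| ≤ n.factorial * 2 ^ n := by
  induction n using Nat.strong_induction_on with
  | _ n ih =>
    cases n with
    | zero =>
      simpa [abs_of_nonneg (Real.sigmoid_nonneg x)] using Real.sigmoid_le_one x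
    | succ n =>
      have hs : ContDiffAt ℝ n Real.sigmoid x := contDiff_sigmoid.contDiffAt.of_le le_top
      have hd : deriv Real.sigmoid = Real.sigmoid - Real.sigmoid * Real.sigmoid := by
        rw [Real.deriv_sigmoid]; ext y; simp; ring
      have h₁ := ih n n.lt_succ_self
      have h₂ := abs_iteratedDeriv_mul_self_le hs fun k hk ↦ ih k (Nat.lt_succ_of_le hk)
      have h₃ : (n.factorial : ℝ) * 2 ^ n ≤ (n + 1).factorial * 2 ^ n := by
        gcongr; exact n.le_succ
      rw [iteratedDeriv_succ', hd, iteratedDeriv_sub (g := Real.sigmoid * Real.sigmoid) hs (hs.mul hs)]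
      refine (abs_sub _ _).trans ?_
      rw [pow_succ]
      linarith

lemma deriv_softplus :
    deriv (fun t : ℝ ↦ Real.log (1 + Real.exp t)) = Real.sigmoid := by
  ext t
  have h : (1 + Real.exp t) ≠ 0 := by positivity
  rw [(((Real.hasDerivAt_exp t).const_add 1).log h).deriv, Real.sigmoid_def, Real.exp_neg]
  field_simp
  ring


/-- The softplus function `x ↦ ln(1 + eˣ)` is strongly-bounded: there is
`B > 0` such that for every `n ≥ 1` and every `x`, its `n`-th derivative is bounded in
absolute value by `n!·Bⁿ`. -/
theorem softplus_strongly_bounded :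
    ∃ B : ℝ, 0 < B ∧ ∀ n : ℕ, 1 ≤ n → ∀ x : ℝ,
      |iteratedDeriv n (fun t => Real.log (1 + Real.exp t)) x| ≤ n.factorial * B ^ n := by
  refine ⟨2, two_pos, fun n hn x ↦ ?_⟩
  obtain ⟨m, rfl⟩ := Nat.exists_eq_succ_of_ne_zero (Nat.one_le_iff_ne_zero.mp hn)
  rw [Nat.succ_eq_add_one, iteratedDeriv_succ', deriv_softplus]
  refine (abs_iteratedDeriv_sigmoid_le m x).trans ?_
  gcongr
  · exact m.le_succ
  · exact one_le_two
  · exact m.le_succ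
end

section
/- There exists a constant B > 0 such that for every integer n ≥ 1 and every x ∈ ℝ, the n-th derivative of the sigmoid function f(x) = eˣ/(1 + eˣ) satisfies |f⁽ⁿ⁾(x)| ≤ n!·Bⁿ. In other words, the function x ↦ eˣ/(1 + eˣ) is strongly-bounded. -/
theorem hasDerivAt_sigmoid_pow_mul_one_sub_pow (a b : ℕ) (x : ℝ) :
    HasDerivAt (fun t => Real.sigmoid t ^ a * (1 - Real.sigmoid t) ^ b)
      (a * (Real.sigmoid x ^ a * (1 - Real.sigmoid x) ^ (b + 1)) -
        b * (Real.sigmoid x ^ (a + 1) * (1 - Real.sigmoid x) ^ b)) x := by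
  have hs := Real.hasDerivAt_sigmoid x
  refine ((hs.fun_pow a).fun_mul ((hs.const_sub 1).fun_pow b)).congr_deriv ?_
  rcases a with _ | a <;> rcases b with _ | b <;> simp <;> ring

theorem contDiff_sigmoid_pow_mul_one_sub_pow (a b n : ℕ) :
    ContDiff ℝ n (fun t => Real.sigmoid t ^ a * (1 - Real.sigmoid t) ^ b) := by
  have hs : ContDiff ℝ n Real.sigmoid := contDiff_sigmoid.of_le le_top
  exact (hs.pow a).mul ((contDiff_const.sub hs).pow b)

/-- Each differentiation of `s ^ a * (1 - s) ^ b`, where `s` is the sigmoid function, yields a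
combination of products of degree `a + b + 1` whose coefficients have total size `a + b`. -/
theorem abs_iteratedDeriv_sigmoid_pow_mul_one_sub_pow_le (n a b : ℕ) (x : ℝ) :
    |iteratedDeriv n (fun t => Real.sigmoid t ^ a * (1 - Real.sigmoid t) ^ b) x| ≤
      (a + b).ascFactorial n := by
  induction n generalizing a b with
  | zero =>
    have h0 := Real.sigmoid_nonneg x
    have h1 := Real.sigmoid_le_one x
    have h2 : 0 ≤ 1 - Real.sigmoid x := by linarith
    rw [iteratedDeriv_zero, abs_of_nonneg (by positivity), Nat.ascFactorial_zero, Nat.cast_one]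
    exact mul_le_one₀ (pow_le_one₀ h0 h1) (by positivity) (pow_le_one₀ h2 (by linarith))
  | succ n ih =>
    have hc (a b : ℕ) := (contDiff_sigmoid_pow_mul_one_sub_pow a b n).contDiffAt (x := x)
    have h1 := ih a (b + 1)
    have h2 := ih (a + 1) b
    rw [← add_assoc] at h1
    rw [add_right_comm] at h2
    rw [iteratedDeriv_succ', funext fun y => (hasDerivAt_sigmoid_pow_mul_one_sub_pow a b y).deriv,
      iteratedDeriv_fun_sub (contDiffAt_const.mul (hc _ _)) (contDiffAt_const.mul (hc _ _)),
      iteratedDeriv_const_mul_field, iteratedDeriv_const_mul_field, Nat.ascFactorial_succ,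
      ← Nat.succ_ascFactorial]
    refine (abs_sub _ _).trans ?_
    rw [abs_mul, abs_mul, Nat.abs_cast, Nat.abs_cast]
    push_cast
    rw [add_mul]
    gcongr


/-- The sigmoid function `x ↦ eˣ/(1 + eˣ)` is strongly-bounded: there is
`B > 0` such that for every `n ≥ 1` and every `x`, its `n`-th derivative is bounded in
absolute value by `n!·Bⁿ`. -/
theorem sigmoid_strongly_bounded :
    ∃ B : ℝ, 0 < B ∧ ∀ n : ℕ, 1 ≤ n → ∀ x : ℝ,
      |iteratedDeriv n (fun t => Real.exp t / (1 + Real.exp t)) x| ≤ n.factorial * B ^ n := by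
  refine ⟨1, one_pos, fun n _ x => ?_⟩
  have hf : (fun t => Real.exp t / (1 + Real.exp t)) =
      fun t => Real.sigmoid t ^ 1 * (1 - Real.sigmoid t) ^ 0 := by
    funext t
    rw [pow_one, pow_zero, mul_one, Real.sigmoid_def, Real.exp_neg]
    have := Real.exp_pos t
    field_simp
    ring
  rw [hf, one_pow, mul_one, ← Nat.one_ascFactorial]
  exact abs_iteratedDeriv_sigmoid_pow_mul_one_sub_pow_le n 1 0 x
end

section
/- There exist a constant C > 0 and a probability measure μ on ℝ × ℝ whose support is contained in [−2, 2] × [−C, C] such that for every x ∈ [−1, 1]: ∫ b·max(0, x − a) dμ(a, b) = x². In other words, the ReLU activation ρ(t) = max(0, t) is a nice activation. -/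
open MeasureTheory

/-- The linear part of `x²`, shifted to start at `-1`, is carried by the two atoms below; the
quadratic part `(x + 1)²` is the mean of the ReLUs with thresholds spread over `[-1, 1]`. -/
noncomputable def reluSquareMeasure : Measure (ℝ × ℝ) :=
  (4 : ENNReal)⁻¹ • (Measure.dirac (-2, 4) + Measure.dirac (-1, -12) +
    (volume.restrict (Set.Ioc (-1 : ℝ) 1)).map (fun a => (a, (8 : ℝ))))

theorem integral_max_zero_sub {x : ℝ} (hx : x ∈ Set.Icc (-1 : ℝ) 1) :
    ∫ a in (-1 : ℝ)..1, max 0 (x - a) = (x + 1) ^ 2 / 2 := by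
  have hi : ∀ u v : ℝ, IntervalIntegrable (fun a => max 0 (x - a)) volume u v :=
    fun u v => (by fun_prop : Continuous fun a : ℝ => max 0 (x - a)).intervalIntegrable u v
  have hleft : ∫ a in (-1 : ℝ)..x, max 0 (x - a) = ∫ a in (-1 : ℝ)..x, (x - a) := by
    refine intervalIntegral.integral_congr fun a ha => ?_
    rw [Set.uIcc_of_le hx.1] at ha
    exact max_eq_right (sub_nonneg.2 ha.2)
  have hright : ∫ a in x..1, max 0 (x - a) = ∫ _ in x..1, (0 : ℝ) := by
    refine intervalIntegral.integral_congr fun a ha => ?_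
    rw [Set.uIcc_of_le hx.2] at ha
    exact max_eq_left (sub_nonpos.2 ha.1)
  rw [← intervalIntegral.integral_add_adjacent_intervals (hi (-1) x) (hi x 1), hleft, hright,
    intervalIntegral.integral_sub (by simp) (by simp)]
  simp
  ring

theorem isProbabilityMeasure_reluSquareMeasure : IsProbabilityMeasure reluSquareMeasure := by
  constructor
  rw [reluSquareMeasure, Measure.smul_apply, Measure.add_apply, Measure.add_apply,
    Measure.map_apply (by fun_prop) MeasurableSet.univ]
  simp only [measure_univ, Set.preimage_univ, Measure.restrict_apply_univ, Real.volume_Ioc,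
    smul_eq_mul]
  have h : (1 : ENNReal) + 1 + ENNReal.ofReal (1 - -1) = 4 := by norm_num
  rw [h]
  exact ENNReal.inv_mul_cancel (by norm_num) (by norm_num)

theorem reluSquareMeasure_compl_eq_zero :
    reluSquareMeasure ((Set.Icc (-2 : ℝ) 2 ×ˢ Set.Icc (-12 : ℝ) 12)ᶜ) = 0 := by
  have hs : MeasurableSet ((Set.Icc (-2 : ℝ) 2 ×ˢ Set.Icc (-12 : ℝ) 12)ᶜ) :=
    (measurableSet_Icc.prod measurableSet_Icc).compl
  have hf : Measurable fun a : ℝ => (a, (8 : ℝ)) := by fun_prop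
  have hmap : (volume.restrict (Set.Ioc (-1 : ℝ) 1)).map (fun a => (a, (8 : ℝ)))
      ((Set.Icc (-2 : ℝ) 2 ×ˢ Set.Icc (-12 : ℝ) 12)ᶜ) = 0 := by
    rw [Measure.map_apply hf hs, Measure.restrict_apply (hf hs)]
    convert measure_empty (μ := (volume : Measure ℝ))
    ext a
    simp only [Set.mem_inter_iff, Set.mem_preimage, Set.mem_compl_iff, Set.mem_prod, Set.mem_Icc,
      Set.mem_Ioc, Set.mem_empty_iff_false, iff_false, not_and]
    intro h ha
    exact fun _ => h ⟨by linarith, by linarith⟩ (by norm_num) (by norm_num)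
  rw [reluSquareMeasure, Measure.smul_apply, Measure.add_apply, Measure.add_apply, hmap,
    Measure.dirac_apply' _ hs, Measure.dirac_apply' _ hs]
  norm_num

theorem integral_reluSquareMeasure {x : ℝ} (hx : x ∈ Set.Icc (-1 : ℝ) 1) :
    ∫ p : ℝ × ℝ, p.2 * max 0 (x - p.1) ∂reluSquareMeasure = x ^ 2 := by
  have hc : Continuous fun p : ℝ × ℝ => p.2 * max 0 (x - p.1) := by fun_prop
  have hf : Measurable fun a : ℝ => (a, (8 : ℝ)) := by fun_prop
  have hdirac : ∀ q : ℝ × ℝ,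
      Integrable (fun p : ℝ × ℝ => p.2 * max 0 (x - p.1)) (Measure.dirac q) :=
    fun q => integrable_dirac enorm_lt_top
  have hmap : Integrable (fun p : ℝ × ℝ => p.2 * max 0 (x - p.1))
      ((volume.restrict (Set.Ioc (-1 : ℝ) 1)).map (fun a => (a, (8 : ℝ)))) := by
    rw [integrable_map_measure hc.aestronglyMeasurable hf.aemeasurable]
    exact (by fun_prop : Continuous fun a : ℝ => 8 * max 0 (x - a)).integrableOn_Ioc
  rw [reluSquareMeasure, integral_smul_measure,
    integral_add_measure ((hdirac _).add_measure (hdirac _)) hmap,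
    integral_add_measure (hdirac _) (hdirac _), integral_dirac, integral_dirac,
    integral_map hf.aemeasurable hc.aestronglyMeasurable, integral_const_mul,
    ← intervalIntegral.integral_of_le (by norm_num), integral_max_zero_sub hx,
    max_eq_right (by linarith [hx.1]), max_eq_right (by linarith [hx.1])]
  simp
  ring

/-- The ReLU activation is "nice": there are `C > 0` and a probability
measure `μ` supported in `[-2,2] × [-C,C]` such that `∫ b·max 0 (x - a) dμ(a,b) = x²`
for every `x ∈ [-1,1]`. -/
theorem relu_is_nice :
    ∃ C : ℝ, 0 < C ∧ ∃ μ : Measure (ℝ × ℝ), IsProbabilityMeasure μ ∧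
      μ ((Set.Icc (-2 : ℝ) 2 ×ˢ Set.Icc (-C) C)ᶜ) = 0 ∧
      ∀ x ∈ Set.Icc (-1 : ℝ) 1, ∫ p : ℝ × ℝ, p.2 * max 0 (x - p.1) ∂μ = x ^ 2 :=
  ⟨12, by norm_num, reluSquareMeasure, isProbabilityMeasure_reluSquareMeasure,
    reluSquareMeasure_compl_eq_zero, fun _ hx => integral_reluSquareMeasure hx⟩
end

section
/- (Steele's generalization of Sauer–Shelah.) Let X and Y be finite sets with |Y| ≥ 2, and let H be a nonempty subset of the set of functions from X to Y. Define dim(H) to be the maximal cardinality of a set A ⊆ X that is shattered by H, i.e., such that {h restricted to A : h ∈ H} equals the set of all functions from A to Y. Then |H| ≤ Σ_{i=0}^{dim(H)} C(|X|, i)·(|Y| − 1)^{|X| − i}, where C(n, i) denotes the binomial coefficient. -/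
/-- `H` shatters `A` if every function agrees on `A` with some member of `H`. -/
def FunShatters {X Y : Type*} (H : Finset (X → Y)) (A : Finset X) : Prop :=
  ∀ g : X → Y, ∃ h ∈ H, ∀ x ∈ A, h x = g x

namespace FunShatters

variable {X Y : Type*} [DecidableEq X]

theorem of_image_update [Fintype X] [DecidableEq Y] {H : Finset (X → Y)} {A : Finset X} {x : X} {y : Y}
    (hx : x ∉ A) (hA : FunShatters (H.image fun h => Function.update h x y) A) :
    FunShatters H A := by
  intro g
  obtain ⟨u, hu, hug⟩ := hA g
  obtain ⟨h, hh, rfl⟩ := Finset.mem_image.1 hu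
  refine ⟨h, hh, fun z hz => ?_⟩
  rw [← hug z hz, Function.update_of_ne (ne_of_mem_of_not_mem hz hx)]

theorem insert_of_update_mem {H I : Finset (X → Y)} {A : Finset X} {x : X}
    (hx : x ∉ A) (hI : ∀ g ∈ I, ∀ y, Function.update g x y ∈ H) (hA : FunShatters I A) :
    FunShatters H (insert x A) := by
  intro g
  obtain ⟨u, hu, hug⟩ := hA g
  refine ⟨Function.update u x (g x), hI u hu _, fun z hz => ?_⟩
  rcases Finset.mem_insert.1 hz with rfl | hz
  · simp
  · rw [Function.update_of_ne (ne_of_mem_of_not_mem hz hx), hug z hz]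

end FunShatters

/-- Splitting off the coordinate `x`: a member of the projection of `H` has at most `|Y| - 1`
preimages, unless all `|Y|` extensions belong to `H`. -/
theorem card_le_mul_card_image_update_add {X Y : Type*} [Fintype X] [Fintype Y] [DecidableEq X]
    [DecidableEq Y] (H : Finset (X → Y)) (x : X) (y₀ : Y) :
    H.card ≤ (Fintype.card Y - 1) * (H.image fun h => Function.update h x y₀).card +
      ((H.image fun h => Function.update h x y₀).filter
        fun g => ∀ y, Function.update g x y ∈ H).card := by
  set U := H.image fun h => Function.update h x y₀ with hU
  have hmaps : ∀ h ∈ H, Function.update h x y₀ ∈ U := fun h hh => Finset.mem_image_of_mem _ hh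
  rw [Finset.card_eq_sum_card_fiberwise hmaps, Finset.card_filter, mul_comm, ← smul_eq_mul,
    ← Finset.sum_const, ← Finset.sum_add_distrib]
  refine Finset.sum_le_sum fun g _ => ?_
  set F := H.filter fun h => Function.update h x y₀ = g
  have hext : ∀ h ∈ F, h = Function.update g x (h x) := by
    intro h hh
    rw [← (Finset.mem_filter.1 hh).2]
    simp
  have hinj : Set.InjOn (fun h : X → Y => h x) F := by
    intro h hh h' hh' e
    rw [hext h hh, hext h' hh']
    exact congrArg _ e
  rw [← Finset.card_image_of_injOn hinj]
  split_ifs with hg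
  · have := Finset.card_le_univ (F.image fun h => h x)
    omega
  · obtain ⟨y, hy⟩ := not_forall.1 hg
    have hne : y ∉ F.image fun h => h x := by
      intro hmem
      obtain ⟨h, hh, rfl⟩ := Finset.mem_image.1 hmem
      exact hy (hext h hh ▸ (Finset.mem_filter.1 hh).1)
    have := Finset.card_lt_univ_of_notMem hne
    omega

open Classical in
/-- A weighted Pajor inequality: a family of functions that are constant outside `S` is bounded by
the weighted number of subsets of `S` it shatters. -/
theorem card_le_sum_funShatters {X Y : Type*} [Fintype X] [Fintype Y] (y₀ : Y) (S : Finset X) :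
    ∀ H : Finset (X → Y), (∀ h ∈ H, ∀ x ∉ S, h x = y₀) →
      H.card ≤ ∑ A ∈ S.powerset,
        if FunShatters H A then (Fintype.card Y - 1) ^ (S.card - A.card) else 0 := by
  induction S using Finset.induction_on with
  | empty =>
    intro H hH
    rcases H.eq_empty_or_nonempty with rfl | ⟨h, hh⟩
    · simp
    · have hsh : FunShatters H ∅ := fun _ => ⟨h, hh, by simp⟩
      have : H.card ≤ 1 := Finset.card_le_one.2 fun a ha b hb => by
        funext z
        rw [hH a ha z (by simp), hH b hb z (by simp)]
      rwa [Finset.powerset_empty, Finset.sum_singleton, if_pos hsh, Nat.sub_self, pow_zero]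
  | insert x S hx ih =>
    intro H hH
    set k := Fintype.card Y - 1
    set U := H.image fun h => Function.update h x y₀
    set I := U.filter fun g => ∀ y, Function.update g x y ∈ H
    have hU : ∀ u ∈ U, ∀ z ∉ S, u z = y₀ := by
      intro u hu z hz
      obtain ⟨h, hh, rfl⟩ := Finset.mem_image.1 hu
      by_cases hzx : z = x
      · simp [hzx]
      · simp only [Function.update_of_ne hzx]
        exact hH h hh z (by simp [hzx, hz])
    have hI : ∀ u ∈ I, ∀ z ∉ S, u z = y₀ := fun u hu => hU u (Finset.mem_filter.1 hu).1
    have hcard : H.card ≤ k * U.card + I.card := card_le_mul_card_image_update_add H x y₀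
    rw [Finset.sum_powerset_insert hx]
    refine hcard.trans (add_le_add ((Nat.mul_le_mul_left k (ih U hU)).trans ?_)
      ((ih I hI).trans ?_))
    · rw [Finset.mul_sum]
      refine Finset.sum_le_sum fun A hA => ?_
      have hAS := Finset.mem_powerset.1 hA
      by_cases hs : FunShatters U A
      · rw [if_pos hs, if_pos (hs.of_image_update fun h => hx (hAS h)),
          Finset.card_insert_of_notMem hx, Nat.sub_add_comm (Finset.card_le_card hAS), pow_succ']
      · simp [hs]
    · refine Finset.sum_le_sum fun A hA => ?_
      have hxA : x ∉ A := fun h => hx (Finset.mem_powerset.1 hA h)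
      by_cases hs : FunShatters I A
      · rw [if_pos hs, if_pos (hs.insert_of_update_mem hxA fun g hg => (Finset.mem_filter.1 hg).2),
          Finset.card_insert_of_notMem hx, Finset.card_insert_of_notMem hxA,
          Nat.add_sub_add_right]
      · simp [hs]


/-- Steele's generalization of Sauer–Shelah.  Let `X`, `Y` be finite sets
with `|Y| ≥ 2` and let `H` be a nonempty family of functions `X → Y`.  If every set
`A ⊆ X` shattered by `H` (i.e. every function `A → Y` is a restriction of some `h ∈ H`)
has cardinality at most `D`, then
`|H| ≤ ∑_{i=0}^{D} C(|X|, i) · (|Y| - 1)^{|X| - i}`. -/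
theorem steele_sauer_shelah
    {X Y : Type*} [Fintype X] [Fintype Y] [DecidableEq X] [DecidableEq Y]
    (hY : 2 ≤ Fintype.card Y) (H : Finset (X → Y)) (hH : H.Nonempty) (D : ℕ)
    (hdim : ∀ A : Finset X, (∀ g : X → Y, ∃ h ∈ H, ∀ x ∈ A, h x = g x) → A.card ≤ D) :
    H.card ≤ ∑ i ∈ Finset.range (D + 1),
      (Fintype.card X).choose i * (Fintype.card Y - 1) ^ (Fintype.card X - i) := by
  classical
  have : Nonempty Y := Fintype.card_pos_iff.1 (by omega)
  obtain ⟨y₀⟩ := this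
  set n := Fintype.card X
  set k := Fintype.card Y - 1
  calc H.card ≤ ∑ A ∈ (Finset.univ : Finset X).powerset,
        if FunShatters H A then k ^ (n - A.card) else 0 :=
        card_le_sum_funShatters y₀ Finset.univ H (by simp)
    _ ≤ ∑ A ∈ (Finset.univ : Finset X).powerset,
        if A.card ≤ D then k ^ (n - A.card) else 0 := by
        refine Finset.sum_le_sum fun A _ => ?_
        by_cases hs : FunShatters H A
        · rw [if_pos hs, if_pos (hdim A hs)]
        · simp [hs]
    _ = ∑ i ∈ Finset.range (n + 1), if i ≤ D then n.choose i * k ^ (n - i) else 0 := by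
        rw [Finset.sum_powerset_apply_card fun i => if i ≤ D then k ^ (n - i) else 0]
        simp [n]
    _ ≤ ∑ i ∈ Finset.range (D + 1), n.choose i * k ^ (n - i) := by
        rw [← Finset.sum_filter]
        refine Finset.sum_le_sum_of_subset fun i hi => ?_
        simp only [Finset.mem_filter, Finset.mem_range] at hi ⊢
        omega
end

section
/- Let d₁, d₂ ≥ 1 be integers, M > 0, and set n = 2·⌈1/4 + 2M²⌉·⌈log₂(2·d₁·d₂·(M + 1))⌉. Then there exists a set F of functions from the closed unit ball of ℝ^{d₁} to ℝ^{d₂} with |F| ≤ 2ⁿ and, for every d₂ × d₁ real matrix W with Frobenius norm ‖W‖_F ≤ M, a finitely-supported probability measure ν_W on F, such that for every x in the closed unit ball of ℝ^{d₁}: (i) E_{g∼ν_W}[g(x)] = Wx, and (ii) for every unit vector u ∈ ℝ^{d₂}, E_{g∼ν_W}⟨u, g(x) − Wx⟩² ≤ 1. In other words, the class L_{d₁,d₂,M} of linear maps x ↦ Wx with ‖W‖_F ≤ M on the unit ball has approximate description length at most n. -/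
open Finset

/-- The zeroth, first and second moments of a sum of `K` independent samples of a centred
function `h` on a finite probability space with weights `q`. -/
lemma moments_sum_iid {S : Type*} [Fintype S] (q h : S → ℝ) (hq : ∑ s, q s = 1)
    (hh : ∑ s, q s * h s = 0) (K : ℕ) :
    (∑ t : Fin K → S, ∏ k, q (t k)) = 1 ∧
    (∑ t : Fin K → S, (∏ k, q (t k)) * ∑ k, h (t k)) = 0 ∧
    (∑ t : Fin K → S, (∏ k, q (t k)) * (∑ k, h (t k)) ^ 2) = K * ∑ s, q s * h s ^ 2 := by
  induction K with
  | zero => simp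
  | succ K ih =>
    obtain ⟨ih0, ih1, ih2⟩ := ih
    have split (φ : (Fin (K + 1) → S) → ℝ) :
        ∑ t, φ t = ∑ s, ∑ t : Fin K → S, φ (Fin.cons s t) := by
      rw [← Fintype.sum_prod_type', ← (Fin.consEquiv fun _ => S).sum_comp]
      rfl
    refine ⟨?_, ?_, ?_⟩
    · rw [split]
      simp only [Fin.prod_univ_succ, Fin.cons_zero, Fin.cons_succ, ← mul_sum, ih0, mul_one, hq]
    · rw [split]
      simp only [Fin.prod_univ_succ, Fin.sum_univ_succ, Fin.cons_zero, Fin.cons_succ]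
      have key (s : S) : ∑ t : Fin K → S, (q s * ∏ k, q (t k)) * (h s + ∑ k, h (t k))
          = q s * h s * (∑ t : Fin K → S, ∏ k, q (t k))
            + q s * ∑ t : Fin K → S, (∏ k, q (t k)) * ∑ k, h (t k) := by
        rw [mul_sum, mul_sum, ← sum_add_distrib]
        exact sum_congr rfl fun t _ => by ring
      simp only [key, ih0, ih1, mul_one, mul_zero, add_zero, hh]
    · rw [split]
      simp only [Fin.prod_univ_succ, Fin.sum_univ_succ, Fin.cons_zero, Fin.cons_succ]
      have key (s : S) : ∑ t : Fin K → S, (q s * ∏ k, q (t k)) * (h s + ∑ k, h (t k)) ^ 2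
          = q s * h s ^ 2 * (∑ t : Fin K → S, ∏ k, q (t k))
            + 2 * q s * h s * (∑ t : Fin K → S, (∏ k, q (t k)) * ∑ k, h (t k))
            + q s * ∑ t : Fin K → S, (∏ k, q (t k)) * (∑ k, h (t k)) ^ 2 := by
        rw [mul_sum, mul_sum, mul_sum, ← sum_add_distrib, ← sum_add_distrib]
        exact sum_congr rfl fun t _ => by ring
      simp only [key, ih0, ih1, ih2, mul_one, mul_zero, add_zero, sum_add_distrib,
        ← sum_mul, hq]
      push_cast
      ring

/-- Pushing forward finitely many weights along a map preserves weighted sums. -/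
lemma sum_pushforward_smul {Ω E V : Type*} [Fintype Ω] [DecidableEq E] [AddCommGroup V]
    [Module ℝ V] (P : Ω → ℝ) (G : Ω → E) (F : Finset E) (hG : ∀ ω, G ω ∈ F) (φ : E → V) :
    ∑ g ∈ F, (∑ ω with G ω = g, P ω) • φ g = ∑ ω, P ω • φ (G ω) := by
  rw [← sum_fiberwise_of_maps_to (fun ω _ => hG ω)]
  refine sum_congr rfl fun g _ => ?_
  rw [sum_smul]
  exact sum_congr rfl fun ω hω => by rw [(mem_filter.1 hω).2]

/-- The average of the one-entry linear maps `x ↦ c x_i e_j` over a tuple of triples `(j, i, c)`. -/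
noncomputable def sparseAverage {d₁ d₂ K : ℕ} (t : Fin K → Fin d₂ × Fin d₁ × ℤ) :
    (Fin d₁ → ℝ) → (Fin d₂ → ℝ) := fun x j =>
  (K : ℝ)⁻¹ * ∑ k, if (t k).1 = j then ((t k).2.2 : ℝ) * x (t k).2.1 else 0

/-- For a matrix of Frobenius norm at most `M`, sampling probabilities on the entries which
dominate both half the uniform distribution and half the squared entries over `M²`. -/
lemma exists_entry_sampling {d₁ d₂ : ℕ} (h₁ : 1 ≤ d₁) (h₂ : 1 ≤ d₂) {M : ℝ} (hM : 0 < M)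
    (W : Matrix (Fin d₂) (Fin d₁) ℝ) (hW : ∑ j, ∑ i, W j i ^ 2 ≤ M ^ 2) :
    ∃ p : Fin d₂ → Fin d₁ → ℝ, (∑ j, ∑ i, p j i = 1) ∧
      ∀ j i, p j i ≤ 1 ∧ 1 ≤ 2 * d₁ * d₂ * p j i ∧ W j i ^ 2 ≤ 2 * M ^ 2 * p j i := by
  have hd₁ : (1 : ℝ) ≤ d₁ := by exact_mod_cast h₁
  have hd₂ : (1 : ℝ) ≤ d₂ := by exact_mod_cast h₂
  set N := ∑ j, ∑ i, W j i ^ 2 with hN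
  set c : ℝ := (M ^ 2 - N) / (d₁ * d₂) with hc
  have hc0 : 0 ≤ c := div_nonneg (by linarith) (by positivity)
  let p : Fin d₂ → Fin d₁ → ℝ := fun j i => (W j i ^ 2 + c) / (2 * M ^ 2) + 1 / (2 * d₁ * d₂)
  have hp0 (j i) : 0 ≤ p j i := by positivity
  have hp : ∑ j, ∑ i, p j i = 1 := by
    simp only [p, sum_add_distrib, ← sum_div, ← hN, sum_const, card_univ, Fintype.card_fin,
      nsmul_eq_mul, hc]
    field_simp
    ring
  refine ⟨p, hp, fun j i => ⟨?_, ?_, ?_⟩⟩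
  · calc p j i ≤ ∑ i, p j i := single_le_sum (f := p j) (fun i _ => hp0 j i) (mem_univ i)
      _ ≤ ∑ j, ∑ i, p j i :=
        single_le_sum (f := fun j => ∑ i, p j i) (fun j _ => sum_nonneg fun i _ => hp0 j i)
          (mem_univ j)
      _ = 1 := hp
  · have : 2 * d₁ * d₂ * p j i = 1 + 2 * d₁ * d₂ * ((W j i ^ 2 + c) / (2 * M ^ 2)) := by
      simp only [p]; field_simp; ring
    rw [this]
    have : 0 ≤ 2 * d₁ * d₂ * ((W j i ^ 2 + c) / (2 * M ^ 2)) := by positivity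
    linarith
  · have : 2 * M ^ 2 * p j i = W j i ^ 2 + (c + M ^ 2 / (d₁ * d₂)) := by
      simp only [p]; field_simp; ring
    rw [this]
    have : 0 ≤ c + M ^ 2 / (d₁ * d₂) := by positivity
    linarith

/-- The random sparse one-entry estimate of a matrix: the sample `(j, i, b)` selects an entry and
whether its importance weight is rounded up or down to an integer. -/
lemma exists_single_sample {d₁ d₂ : ℕ} (h₁ : 1 ≤ d₁) (h₂ : 1 ≤ d₂) {M : ℝ} (hM : 0 < M)
    (W : Matrix (Fin d₂) (Fin d₁) ℝ) (hW : ∑ j, ∑ i, W j i ^ 2 ≤ M ^ 2) :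
    ∃ (q : Fin d₂ × Fin d₁ × Bool → ℝ) (c : Fin d₂ × Fin d₁ × Bool → ℤ),
      (∀ s, 0 ≤ q s) ∧ (∑ s, q s = 1) ∧
      (∀ s, c s ∈ Icc (-⌈2 * d₁ * d₂ * M⌉) (⌈2 * d₁ * d₂ * M⌉ + 1)) ∧
      (∀ φ : Fin d₂ → Fin d₁ → ℝ,
        ∑ s, q s * (c s * φ s.1 s.2.1) = ∑ j, ∑ i, W j i * φ j i) ∧
      (∀ φ : Fin d₂ → Fin d₁ → ℝ,
        ∑ s, q s * (c s * φ s.1 s.2.1) ^ 2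
          ≤ (1 / 4 + 2 * M ^ 2) * ∑ j, ∑ i, φ j i ^ 2) := by
  obtain ⟨p, hp, hpp⟩ := exists_entry_sampling h₁ h₂ hM W hW
  have hd₁ : (1 : ℝ) ≤ d₁ := by exact_mod_cast h₁
  have hd₂ : (1 : ℝ) ≤ d₂ := by exact_mod_cast h₂
  have hp0 (j i) : 0 < p j i := by
    have := (hpp j i).2.1
    by_contra hneg
    have : 2 * d₁ * d₂ * p j i ≤ 0 :=
      mul_nonpos_of_nonneg_of_nonpos (by positivity) (not_lt.1 hneg)
    linarith
  let a : Fin d₂ → Fin d₁ → ℝ := fun j i => W j i / p j i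
  have hpa (j i) : p j i * a j i = W j i := mul_div_cancel₀ _ (hp0 j i).ne'
  have habs (j i) : |a j i| ≤ 2 * d₁ * d₂ * M := by
    have hWM : |W j i| ≤ M := by
      refine abs_le_of_sq_le_sq ?_ hM.le
      calc W j i ^ 2 ≤ ∑ i, W j i ^ 2 :=
            single_le_sum (f := fun i => W j i ^ 2) (fun i _ => sq_nonneg _) (mem_univ i)
        _ ≤ ∑ j, ∑ i, W j i ^ 2 :=
            single_le_sum (f := fun j => ∑ i, W j i ^ 2)
              (fun j _ => sum_nonneg fun i _ => sq_nonneg _) (mem_univ j)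
        _ ≤ M ^ 2 := hW
    rw [abs_div, abs_of_pos (hp0 j i), div_le_iff₀ (hp0 j i)]
    nlinarith [(hpp j i).2.1]
  have hfr (j i) : (a j i : ℝ) = ⌊a j i⌋ + Int.fract (a j i) := (Int.floor_add_fract _).symm
  refine ⟨fun s => p s.1 s.2.1 * (if s.2.2 then Int.fract (a s.1 s.2.1)
      else 1 - Int.fract (a s.1 s.2.1)),
    fun s => ⌊a s.1 s.2.1⌋ + (if s.2.2 then 1 else 0), ?_, ?_, ?_, ?_, ?_⟩
  · rintro ⟨j, i, b⟩
    refine mul_nonneg (hp0 j i).le ?_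
    have hfr0 := Int.fract_nonneg (a j i)
    have hfr1 := (Int.fract_lt_one (a j i)).le
    cases b <;> simp [hfr0, hfr1]
  · refine Eq.trans ?_ hp
    simp only [Fintype.sum_prod_type, Fintype.sum_bool]
    refine sum_congr rfl fun j _ => sum_congr rfl fun i _ => ?_
    simp
    ring
  · rintro ⟨j, i, b⟩
    have h := abs_le.1 (habs j i)
    have hlow : -⌈2 * d₁ * d₂ * M⌉ ≤ ⌊a j i⌋ := by
      rw [Int.le_floor]
      push_cast
      linarith [Int.le_ceil (2 * d₁ * d₂ * M)]
    have hup : ⌊a j i⌋ ≤ ⌈2 * d₁ * d₂ * M⌉ := by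
      have := ((Int.floor_le (a j i)).trans h.2).trans (Int.le_ceil _)
      exact_mod_cast this
    rw [mem_Icc]
    cases b <;> simp <;> omega
  · intro φ
    simp only [Fintype.sum_prod_type, Fintype.sum_bool]
    refine sum_congr rfl fun j _ => sum_congr rfl fun i _ => ?_
    rw [← hpa j i]
    simp
    linear_combination (-(p j i * φ j i)) * hfr j i
  · intro φ
    simp only [Fintype.sum_prod_type, Fintype.sum_bool, mul_sum]
    refine sum_le_sum fun j _ => sum_le_sum fun i _ => ?_
    have hpa2 : p j i * a j i ^ 2 ≤ 2 * M ^ 2 := by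
      refine le_of_mul_le_mul_left ?_ (hp0 j i)
      calc p j i * (p j i * a j i ^ 2) = W j i ^ 2 := by rw [← hpa j i]; ring
        _ ≤ 2 * M ^ 2 * p j i := (hpp j i).2.2
        _ = p j i * (2 * M ^ 2) := by ring
    have h4 : p j i * (Int.fract (a j i) * (1 - Int.fract (a j i))) ≤ 1 / 4 := by
      have h := sq_nonneg (Int.fract (a j i) - 1 / 2)
      nlinarith [(hpp j i).1, hp0 j i]
    have hfl : (⌊a j i⌋ : ℝ) = a j i - Int.fract (a j i) := by linarith [hfr j i]
    calc _ = (p j i * (Int.fract (a j i) * (1 - Int.fract (a j i))) + p j i * a j i ^ 2)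
          * φ j i ^ 2 := by
          simp only [Bool.false_eq_true, if_true, if_false, Int.cast_add, Int.cast_one,
            Int.cast_zero, hfl]
          ring
      _ ≤ _ := by gcongr

/-- The Euclidean norm on `Fin m → ℝ`. -/
noncomputable def euclNorm {m : ℕ} (v : Fin m → ℝ) : ℝ := Real.sqrt (∑ j, v j ^ 2)

/-- The class of linear maps `x ↦ Wx` with `‖W‖_F ≤ M`, on the unit ball
of `ℝ^{d₁}`, has approximate description length `n = 2·⌈1/4 + 2M²⌉·⌈log₂(2d₁d₂(M+1))⌉`:
there is one set `F` of at most `2ⁿ` functions and, for each such `W`, a finitely supported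
probability distribution `ν_W` on `F` whose values are unbiased estimators of `Wx` with
variance at most `1` in every direction, at every point `x` of the unit ball. -/
theorem linear_class_adl
    (d₁ d₂ : ℕ) (h₁ : 1 ≤ d₁) (h₂ : 1 ≤ d₂) (M : ℝ) (hM : 0 < M)
    (n : ℕ)
    (hn : n = 2 * ⌈(1 / 4 : ℝ) + 2 * M ^ 2⌉₊ * ⌈Real.logb 2 (2 * d₁ * d₂ * (M + 1))⌉₊) :
    ∃ F : Finset ((Fin d₁ → ℝ) → (Fin d₂ → ℝ)),
      F.card ≤ 2 ^ n ∧
      ∀ W : Matrix (Fin d₂) (Fin d₁) ℝ, Real.sqrt (∑ j, ∑ i, W j i ^ 2) ≤ M →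
        ∃ ν : ((Fin d₁ → ℝ) → (Fin d₂ → ℝ)) → ℝ,
          (∀ g, 0 ≤ ν g) ∧ (∀ g, ν g ≠ 0 → g ∈ F) ∧ (∑ g ∈ F, ν g) = 1 ∧
          ∀ x : Fin d₁ → ℝ, euclNorm x ≤ 1 →
            (∑ g ∈ F, ν g • g x) = W.mulVec x ∧
            ∀ u : Fin d₂ → ℝ, euclNorm u = 1 →
              (∑ g ∈ F, ν g * (∑ j, u j * (g x j - W.mulVec x j)) ^ 2) ≤ 1 := by
  classical
  set K := ⌈(1 / 4 : ℝ) + 2 * M ^ 2⌉₊ with hK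
  set L := ⌈Real.logb 2 (2 * d₁ * d₂ * (M + 1))⌉₊ with hL
  set B := ⌈2 * d₁ * d₂ * M⌉ with hB
  have hd₁ : (1 : ℝ) ≤ d₁ := by exact_mod_cast h₁
  have hd₂ : (1 : ℝ) ≤ d₂ := by exact_mod_cast h₂
  have hKle : (1 / 4 : ℝ) + 2 * M ^ 2 ≤ K := Nat.le_ceil _
  have hKpos : (0 : ℝ) < K := by nlinarith [sq_nonneg M]
  refine ⟨(Fintype.piFinset fun _ : Fin K => (univ : Finset (Fin d₂)) ×ˢ
    (univ : Finset (Fin d₁)) ×ˢ Icc (-B) (B + 1)).image sparseAverage, ?_, ?_⟩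
  · refine card_image_le.trans ?_
    rw [Fintype.card_piFinset_const, hn, show 2 * K * L = (L + L) * K by ring, pow_mul]
    refine Nat.pow_le_pow_left ?_ _
    simp only [card_product, card_univ, Fintype.card_fin, Int.card_Icc]
    have hB0 : 0 ≤ B := Int.ceil_nonneg (by positivity)
    have hBlt : (B : ℝ) < 2 * d₁ * d₂ * M + 1 := Int.ceil_lt_add_one _
    have hL2 : 2 * d₁ * d₂ * (M + 1) ≤ (2 : ℝ) ^ L := by
      rw [← Real.rpow_natCast, ← Real.logb_le_iff_le_rpow one_lt_two (by positivity)]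
      exact Nat.le_ceil _
    have hcast : (((B + 1 + 1 - -B).toNat : ℕ) : ℝ) = 2 * B + 2 := by
      have : (((B + 1 + 1 - -B).toNat : ℕ) : ℤ) = 2 * B + 2 := by omega
      exact_mod_cast this
    have hD : (1 : ℝ) ≤ d₁ * d₂ := one_le_mul_of_one_le_of_one_le hd₁ hd₂
    have : (d₂ : ℝ) * (d₁ * (2 * B + 2)) ≤ 2 ^ (L + L) := by
      calc (d₂ : ℝ) * (d₁ * (2 * B + 2)) = (d₁ * d₂) * (2 * B + 2) := by ring
        _ ≤ (d₁ * d₂) * (4 * (d₁ * d₂) * (M + 1) ^ 2) := by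
            gcongr
            nlinarith [mul_nonneg (zero_le_one.trans hD) (sq_nonneg M),
              mul_nonneg (zero_le_one.trans hD) hM.le]
        _ = (2 * d₁ * d₂ * (M + 1)) * (2 * d₁ * d₂ * (M + 1)) := by ring
        _ ≤ 2 ^ L * 2 ^ L := by gcongr
        _ = 2 ^ (L + L) := (pow_add _ _ _).symm
    rw [← hcast] at this
    exact_mod_cast this
  · intro W hWM
    have hW : ∑ j, ∑ i, W j i ^ 2 ≤ M ^ 2 := (Real.sqrt_le_left hM.le).1 hWM
    obtain ⟨q, c, hq0, hq1, hc, hmean, hsq⟩ := exists_single_sample h₁ h₂ hM W hW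
    let G : (Fin K → Fin d₂ × Fin d₁ × Bool) → (Fin d₁ → ℝ) → (Fin d₂ → ℝ) :=
      fun t => sparseAverage fun k => ((t k).1, (t k).2.1, c (t k))
    let P : (Fin K → Fin d₂ × Fin d₁ × Bool) → ℝ := fun t => ∏ k, q (t k)
    set F := (Fintype.piFinset fun _ : Fin K => (univ : Finset (Fin d₂)) ×ˢ
      (univ : Finset (Fin d₁)) ×ˢ Icc (-B) (B + 1)).image sparseAverage with hF
    have hGF (t) : G t ∈ F := by
      refine mem_image_of_mem _ (Fintype.mem_piFinset.2 fun k => ?_)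
      simpa using hc (t k)
    have hP1 : ∑ t, P t = 1 := (moments_sum_iid q 0 hq1 (by simp) K).1
    have hadj (u : Fin d₂ → ℝ) (x : Fin d₁ → ℝ) :
        ∑ j, ∑ i, W j i * (u j * x i) = ∑ j, u j * W.mulVec x j := by
      simp only [Matrix.mulVec, dotProduct, mul_sum]
      exact sum_congr rfl fun j _ => sum_congr rfl fun i _ => by ring
    -- The error in direction `u` is an average of independent centred terms.
    have herr (u : Fin d₂ → ℝ) (x : Fin d₁ → ℝ) (t) :
        ∑ j, u j * (G t x j - W.mulVec x j) = (K : ℝ)⁻¹ * ∑ k,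
          (c (t k) * (u (t k).1 * x (t k).2.1) - ∑ j, u j * W.mulVec x j) := by
      simp only [mul_sub, sum_sub_distrib, sum_const, card_univ, Fintype.card_fin, nsmul_eq_mul,
        inv_mul_cancel_left₀ hKpos.ne', G, sparseAverage]
      congr 1
      simp only [mul_sum]
      rw [sum_comm]
      refine sum_congr rfl fun k _ => ?_
      simp only [mul_ite, mul_zero, sum_ite_eq, mem_univ, if_true]
      ring
    have hcent (u : Fin d₂ → ℝ) (x : Fin d₁ → ℝ) :
        ∑ s, q s * (c s * (u s.1 * x s.2.1) - ∑ j, u j * W.mulVec x j) = 0 := by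
      simp only [mul_sub, sum_sub_distrib, ← sum_mul, hq1, one_mul]
      rw [hmean fun j i => u j * x i, hadj, sub_self]
    refine ⟨fun g => ∑ t with G t = g, P t, fun g => sum_nonneg fun t _ =>
      prod_nonneg fun k _ => hq0 _, fun g hg => ?_, ?_, fun x hx => ⟨?_, fun u hu => ?_⟩⟩
    · obtain ⟨t, ht, -⟩ := exists_ne_zero_of_sum_ne_zero hg
      exact (mem_filter.1 ht).2 ▸ hGF t
    · simpa [hP1] using sum_pushforward_smul P G F hGF fun _ => (1 : ℝ)
    · rw [sum_pushforward_smul P G F hGF fun g => g x]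
      ext j
      have h := (moments_sum_iid q _ hq1 (hcent (Pi.single j 1) x) K).2.1
      have hz : ∑ t, P t * (G t x j - W.mulVec x j) = 0 := by
        calc _ = ∑ t, (K : ℝ)⁻¹ * (P t * (K * ∑ j', (Pi.single j 1 : Fin d₂ → ℝ) j' *
                (G t x j' - W.mulVec x j'))) := by
              refine sum_congr rfl fun t _ => ?_
              simp only [Pi.single_apply, ite_mul, one_mul, zero_mul, sum_ite_eq', mem_univ,
                if_true]
              field_simp
          _ = 0 := by
              simp only [herr, mul_inv_cancel_left₀ hKpos.ne', ← mul_sum]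
              rw [h, mul_zero]
      simp only [mul_sub, sum_sub_distrib, ← sum_mul, hP1, one_mul] at hz
      simpa [Finset.sum_apply] using sub_eq_zero.1 hz
    · have hx2 : ∑ i, x i ^ 2 ≤ 1 := by
        simpa using (Real.sqrt_le_left zero_le_one).1 hx
      have hu2 : ∑ j, u j ^ 2 = 1 := Real.sqrt_eq_one.1 hu
      have hux : ∑ j, ∑ i, (u j * x i) ^ 2 ≤ 1 := by
        simp only [mul_pow, ← mul_sum, ← sum_mul, hu2, one_mul]
        exact hx2
      set m := ∑ j, u j * W.mulVec x j with hm
      have hvar : ∑ s, q s * (c s * (u s.1 * x s.2.1) - m) ^ 2 ≤ K := by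
        have hexp : ∑ s, q s * (c s * (u s.1 * x s.2.1) - m) ^ 2
            = ∑ s, q s * (c s * (u s.1 * x s.2.1)) ^ 2 - m ^ 2 := by
          have h1 : ∑ s, q s * (c s * (u s.1 * x s.2.1)) = m := by
            rw [hmean fun j i => u j * x i, hadj]
          calc _ = ∑ s, (q s * (c s * (u s.1 * x s.2.1)) ^ 2
                  - 2 * m * (q s * (c s * (u s.1 * x s.2.1))) + m ^ 2 * q s) :=
                sum_congr rfl fun s _ => by ring
            _ = _ := by
                rw [sum_add_distrib, sum_sub_distrib, ← mul_sum, ← mul_sum, h1, hq1]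
                ring
        have := hsq fun j i => u j * x i
        have := mul_le_mul_of_nonneg_left hux (show 0 ≤ 1 / 4 + 2 * M ^ 2 by positivity)
        nlinarith [sq_nonneg m]
      have h := (moments_sum_iid q _ hq1 (hcent u x) K).2.2
      rw [← hm] at h
      have hpush := sum_pushforward_smul P G F hGF
        fun g => (∑ j, u j * (g x j - W.mulVec x j)) ^ 2
      simp only [smul_eq_mul] at hpush
      rw [hpush]
      calc _ = ((K : ℝ)⁻¹) ^ 2 * ∑ t, P t * (∑ k,
              (c (t k) * (u (t k).1 * x (t k).2.1) - m)) ^ 2 := by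
            rw [mul_sum]
            refine sum_congr rfl fun t _ => ?_
            rw [herr]
            ring
        _ = (K : ℝ)⁻¹ * ∑ s, q s * (c s * (u s.1 * x s.2.1) - m) ^ 2 := by
            rw [h]
            field_simp
        _ ≤ (K : ℝ)⁻¹ * K := by gcongr
        _ = 1 := inv_mul_cancel₀ hKpos.ne'
end

section
/- Let H be a class of functions from a set X to ℝ and n ≥ 1 an integer. Suppose there exist a set F of functions from X to ℝ with |F| ≤ 2ⁿ and, for each h ∈ H, a finitely-supported probability measure ν_h on F, such that for every x ∈ X: E_{g∼ν_h}[g(x)] = h(x) and E_{g∼ν_h}[(g(x) − h(x))²] ≤ 1. Then for every ε ∈ (0, 1] and every nonempty finite set A ⊆ X, there exists a set H̃ of functions from X to ℝ with |H̃| ≤ 2^{n·⌈1/ε²⌉} such that for every h ∈ H there is h̃ ∈ H̃ with (1/|A|)·Σ_{x∈A}(h(x) − h̃(x))² ≤ ε². In particular, log₂ N(H, m, ε) ≤ n·⌈ε⁻²⌉ for every m. -/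
/-- Some point of a finite probability space has value at most the expectation. -/
theorem exists_le_of_weighted_sum_le {ι : Type*} (F : Finset ι) (w φ : ι → ℝ) (c : ℝ)
    (hw0 : ∀ i ∈ F, 0 ≤ w i) (hw1 : ∑ i ∈ F, w i = 1) (hφ : ∑ i ∈ F, w i * φ i ≤ c) :
    ∃ i ∈ F, φ i ≤ c := by
  by_contra! hlt
  obtain ⟨i, hi, hwi⟩ : ∃ i ∈ F, 0 < w i :=
    Finset.exists_lt_of_sum_lt (by simp [hw1])
  have hsum : ∑ i ∈ F, w i * c < ∑ i ∈ F, w i * φ i :=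
    Finset.sum_lt_sum (fun j hj => mul_le_mul_of_nonneg_left (hlt j hj).le (hw0 j hj))
      ⟨i, hi, mul_lt_mul_of_pos_left (hlt i hi) hwi⟩
  rw [← Finset.sum_mul, hw1] at hsum
  linarith

/-- If `w` is an unbiased estimator of `h` with pointwise variance at most `1`, some sample
increases the squared norm of any `s` by at most `|A|`. -/
theorem exists_sum_sq_add_sub_le {X : Type*} (F : Finset (X → ℝ)) (w : (X → ℝ) → ℝ)
    (h : X → ℝ) (hw0 : ∀ g ∈ F, 0 ≤ w g) (hw1 : ∑ g ∈ F, w g = 1)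
    (hmean : ∀ x, ∑ g ∈ F, w g * g x = h x)
    (hvar : ∀ x, ∑ g ∈ F, w g * (g x - h x) ^ 2 ≤ 1) (A : Finset X) (s : X → ℝ) :
    ∃ g ∈ F, ∑ x ∈ A, (s x + (g x - h x)) ^ 2 ≤ ∑ x ∈ A, s x ^ 2 + A.card := by
  refine exists_le_of_weighted_sum_le F w _ _ hw0 hw1 ?_
  have hpoint (x : X) : ∑ g ∈ F, w g * (s x + (g x - h x)) ^ 2 ≤ s x ^ 2 + 1 := by
    have hexpand : ∑ g ∈ F, w g * (s x + (g x - h x)) ^ 2 =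
        (s x ^ 2 - 2 * s x * h x) * ∑ g ∈ F, w g + 2 * s x * ∑ g ∈ F, w g * g x +
          ∑ g ∈ F, w g * (g x - h x) ^ 2 := by
      simp only [Finset.mul_sum, ← Finset.sum_add_distrib]
      exact Finset.sum_congr rfl fun g _ => by ring
    rw [hexpand, hw1, hmean]
    linarith [hvar x]
  simp only [Finset.mul_sum]
  rw [Finset.sum_comm]
  refine (Finset.sum_le_sum fun x _ => hpoint x).trans_eq ?_
  simp [Finset.sum_add_distrib]

/-- Derandomized empirical approximation: `k` samples whose sum deviates from `k • h` by at most
`k * |A|` in squared norm on `A`. -/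
theorem exists_samples_sum_sq_le {X : Type*} (F : Finset (X → ℝ)) (w : (X → ℝ) → ℝ)
    (h : X → ℝ) (hw0 : ∀ g ∈ F, 0 ≤ w g) (hw1 : ∑ g ∈ F, w g = 1)
    (hmean : ∀ x, ∑ g ∈ F, w g * g x = h x)
    (hvar : ∀ x, ∑ g ∈ F, w g * (g x - h x) ^ 2 ≤ 1) (A : Finset X) (k : ℕ) :
    ∃ f : Fin k → X → ℝ, (∀ i, f i ∈ F) ∧
      ∑ x ∈ A, (∑ i, f i x - k * h x) ^ 2 ≤ k * (A.card : ℝ) := by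
  induction k with
  | zero => exact ⟨Fin.elim0, fun i => i.elim0, by simp⟩
  | succ k ih =>
    obtain ⟨f, hfF, hf⟩ := ih
    obtain ⟨g, hgF, hg⟩ := exists_sum_sq_add_sub_le F w h hw0 hw1 hmean hvar A
      fun x => ∑ i, f i x - k * h x
    refine ⟨Fin.cons g f, Fin.cases hgF hfF, ?_⟩
    have hsum : ∑ x ∈ A, (∑ i, (Fin.cons g f : Fin (k + 1) → X → ℝ) i x -
          ((k + 1 : ℕ) : ℝ) * h x) ^ 2 =
        ∑ x ∈ A, (∑ i, f i x - k * h x + (g x - h x)) ^ 2 := by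
      refine Finset.sum_congr rfl fun x _ => ?_
      rw [Fin.sum_univ_succ]
      simp only [Fin.cons_zero, Fin.cons_succ]
      push_cast
      ring
    rw [hsum]
    push_cast
    linarith


/-- If a class `H` of real-valued functions on `X` admits a
`(1, n)`-compressor — a set `F` of at most `2ⁿ` functions together with, for each `h ∈ H`,
a finitely supported probability distribution `ν h` on `F` producing unbiased pointwise
estimators of `h` with variance at most `1` — then for every `ε ∈ (0,1]` and every nonempty
finite `A ⊆ X` there is a set `H̃` of at most `2^{n⌈ε⁻²⌉}` functions such that every `h ∈ H`
is approximated by some `h̃ ∈ H̃` to mean-squared error `ε²` on `A`; i.e.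
`log₂ N(H, m, ε) ≤ n·⌈ε⁻²⌉`. -/
theorem adl_to_covering
    {X : Type*} (H : Set (X → ℝ)) (n : ℕ) (hn : 1 ≤ n)
    (F : Finset (X → ℝ)) (hF : F.card ≤ 2 ^ n)
    (ν : (X → ℝ) → (X → ℝ) → ℝ)
    (hν0 : ∀ h ∈ H, ∀ g, 0 ≤ ν h g)
    (hνsupp : ∀ h ∈ H, ∀ g, ν h g ≠ 0 → g ∈ F)
    (hν1 : ∀ h ∈ H, (∑ g ∈ F, ν h g) = 1)
    (hmean : ∀ h ∈ H, ∀ x : X, (∑ g ∈ F, ν h g * g x) = h x)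
    (hvar : ∀ h ∈ H, ∀ x : X, (∑ g ∈ F, ν h g * (g x - h x) ^ 2) ≤ 1) :
    ∀ ε : ℝ, 0 < ε → ε ≤ 1 → ∀ A : Finset X, A.Nonempty →
      ∃ Ht : Finset (X → ℝ), Ht.card ≤ 2 ^ (n * ⌈ε⁻¹ ^ 2⌉₊) ∧
        ∀ h ∈ H, ∃ ht ∈ Ht, (∑ x ∈ A, (h x - ht x) ^ 2) / (A.card : ℝ) ≤ ε ^ 2 := by
  classical
  intro ε hε _ A hA
  set k := ⌈ε⁻¹ ^ 2⌉₊
  have hk : ε⁻¹ ^ 2 ≤ (k : ℝ) := Nat.le_ceil _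
  have hk0 : (0 : ℝ) < k := lt_of_lt_of_le (by positivity) hk
  have hA0 : (0 : ℝ) < A.card := by exact_mod_cast hA.card_pos
  refine ⟨(Fintype.piFinset fun _ : Fin k => F).image fun f x => (∑ i, f i x) / k, ?_, ?_⟩
  · calc _ ≤ (Fintype.piFinset fun _ : Fin k => F).card := Finset.card_image_le
      _ = F.card ^ k := by simp
      _ ≤ (2 ^ n) ^ k := Nat.pow_le_pow_left hF k
      _ = 2 ^ (n * k) := (pow_mul 2 n k).symm
  · intro h hh
    obtain ⟨f, hfF, hf⟩ := exists_samples_sum_sq_le F (ν h) h (fun g _ => hν0 h hh g)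
      (hν1 h hh) (hmean h hh) (hvar h hh) A k
    refine ⟨_, Finset.mem_image_of_mem _ (Fintype.mem_piFinset.2 hfF), ?_⟩
    have hscale : ∑ x ∈ A, (h x - (∑ i, f i x) / k) ^ 2 =
        (∑ x ∈ A, (∑ i, f i x - k * h x) ^ 2) / (k : ℝ) ^ 2 := by
      rw [Finset.sum_div]
      refine Finset.sum_congr rfl fun x _ => ?_
      field_simp
      ring
    rw [hscale]
    calc _ ≤ k * (A.card : ℝ) / (k : ℝ) ^ 2 / A.card := by gcongr
      _ = (k : ℝ)⁻¹ := by field_simp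
      _ ≤ (ε⁻¹ ^ 2)⁻¹ := inv_anti₀ (by positivity) hk
      _ = ε ^ 2 := by simp
end

section
/- Fix an integer t ≥ 1, a real r > 0, and a strongly-bounded activation ρ : ℝ → ℝ. Then there exist constants C > 0 and p > 0, depending only on t, r, and ρ, with the following property. Let d₀, …, d_t be positive integers with max_i d_i = d ≥ 2, let W_i⁰ be real d_i × d_{i−1} matrices with spectral norm ‖W_i⁰‖ ≤ r for i = 1,…,t, let R ≥ 1, and let H = N^ρ_{r,R}(W₁⁰,…,W_t⁰) be the class of functions x ↦ W_t(ρ(W_{t−1}(ρ(⋯ρ(W₁x)⋯)))) on the closed ball of radius √d in ℝ^{d₀}, where each W_i ranges over d_i × d_{i−1} matrices with ‖W_i − W_i⁰‖ ≤ r (spectral norm) and ‖W_i − W_i⁰‖_F ≤ R (Frobenius norm), and ρ is applied coordinatewise. Let Y be a measurable space and ℓ : ℝ^{d_t} × Y → [0, B] be a loss such that ℓ(·, y) is L-Lipschitz with respect to ‖·‖_∞ for every y. Then for every probability distribution D on X × Y (X the ball of radius √d) and every integer m ≥ 2: E_{S∼D^m} rep_D(S, H) ≤ C·(L + B)·√(d·R²/m)·(log(d·m))^p.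 -/
open MeasureTheory

/-- The sup-norm `‖v‖_∞` on `Fin m → ℝ`. -/
noncomputable def supNorm {m : ℕ} (v : Fin m → ℝ) : ℝ := ⨆ j, |v j|

/-- `ρ ∘ W_s ∘ ρ ∘ ⋯ ∘ ρ ∘ W_1`: the first `s` layers, each followed by the activation. -/
noncomputable def chainAct (dims : ℕ → ℕ) (ρ : ℝ → ℝ)
    (W : ∀ i : ℕ, Matrix (Fin (dims (i + 1))) (Fin (dims i)) ℝ) :
    (s : ℕ) → (Fin (dims 0) → ℝ) → Fin (dims s) → ℝ
  | 0, x => x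
  | s + 1, x => fun j => ρ (((W s).mulVec (chainAct dims ρ W s x)) j)

/-- The depth-`t` network `W_t ∘ ρ ∘ W_{t-1} ∘ ρ ∘ ⋯ ∘ ρ ∘ W_1` (no activation after the
last layer); meaningful for `t ≥ 1`. -/
noncomputable def network (dims : ℕ → ℕ) (ρ : ℝ → ℝ)
    (W : ∀ i : ℕ, Matrix (Fin (dims (i + 1))) (Fin (dims i)) ℝ) :
    (t : ℕ) → (Fin (dims 0) → ℝ) → Fin (dims t) → ℝ
  | 0, x => x
  | s + 1, x => (W s).mulVec (chainAct dims ρ W s x)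

open ProbabilityTheory

/-- The Donsker-Varadhan form of the bound `KL(Q ‖ P) ≤ κ`, tested on bounded functions. -/
def EntropyLE {Ω : Type*} [MeasurableSpace Ω] (Q P : Measure Ω) (κ : ℝ) : Prop :=
  ∀ F : Ω → ℝ, Measurable F → ∀ C : ℝ, (∀ ω, |F ω| ≤ C) →
    ∫ ω, F ω ∂Q ≤ κ + Real.log (∫ ω, Real.exp (F ω) ∂P)

lemma integrable_of_abs_le {Ω : Type*} [MeasurableSpace Ω] {μ : Measure Ω} [IsFiniteMeasure μ]
    {f : Ω → ℝ} (hf : Measurable f) {C : ℝ} (hC : ∀ ω, |f ω| ≤ C) : Integrable f μ :=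
  Integrable.of_bound hf.aestronglyMeasurable C (Filter.Eventually.of_forall hC)

lemma integrable_exp_of_abs_le {Ω : Type*} [MeasurableSpace Ω] {μ : Measure Ω}
    [IsFiniteMeasure μ] {f : Ω → ℝ} (hf : Measurable f) {C : ℝ} (hC : ∀ ω, |f ω| ≤ C) :
    Integrable (fun ω => Real.exp (f ω)) μ :=
  integrable_of_abs_le (C := Real.exp C) hf.exp fun ω => by
    rw [Real.abs_exp]
    exact Real.exp_le_exp.2 ((le_abs_self _).trans (hC ω))

lemma exp_neg_le_integral_exp {Ω : Type*} [MeasurableSpace Ω] {P : Measure Ω}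
    [IsProbabilityMeasure P] {F : Ω → ℝ} (hF : Measurable F) {C : ℝ} (hC : ∀ ω, |F ω| ≤ C) :
    Real.exp (-C) ≤ ∫ ω, Real.exp (F ω) ∂P := by
  have h := integral_mono (μ := P) (integrable_const (Real.exp (-C)))
    (integrable_exp_of_abs_le hF hC) fun ω => Real.exp_le_exp.2 (abs_le.1 (hC ω)).1
  simpa using h

lemma integral_exp_le_exp {Ω : Type*} [MeasurableSpace Ω] {P : Measure Ω}
    [IsProbabilityMeasure P] {F : Ω → ℝ} (hF : Measurable F) {C : ℝ} (hC : ∀ ω, |F ω| ≤ C) :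
    ∫ ω, Real.exp (F ω) ∂P ≤ Real.exp C := by
  have h := integral_mono (μ := P) (integrable_exp_of_abs_le hF hC)
    (integrable_const (Real.exp C)) fun ω => Real.exp_le_exp.2 (abs_le.1 (hC ω)).2
  simpa using h

lemma EntropyLE.mono {Ω : Type*} [MeasurableSpace Ω] {Q P : Measure Ω} {κ κ' : ℝ}
    (h : EntropyLE Q P κ) (hκ : κ ≤ κ') : EntropyLE Q P κ' :=
  fun F hF C hC => (h F hF C hC).trans (by linarith)

lemma EntropyLE.refl {Ω : Type*} [MeasurableSpace Ω] (P : Measure Ω) [IsProbabilityMeasure P] :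
    EntropyLE P P 0 := by
  intro F hF C hC
  have hc := (Real.exp_pos (-C)).trans_le (exp_neg_le_integral_exp (P := P) hF hC)
  set c := ∫ ω, Real.exp (F ω) ∂P
  have h : ∫ ω, (F ω - Real.log c + 1) ∂P ≤ ∫ ω, Real.exp (F ω) / c ∂P := by
    refine integral_mono (((integrable_of_abs_le hF hC).sub (integrable_const _)).add
      (integrable_const _)) ((integrable_exp_of_abs_le hF hC).div_const c) fun ω => ?_
    have := Real.add_one_le_exp (F ω - Real.log c)
    rwa [Real.exp_sub, Real.exp_log hc] at this
  have hFi : Integrable (fun ω => F ω) P := integrable_of_abs_le hF hC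
  have hFc : Integrable (fun ω => F ω - Real.log c) P := hFi.sub (integrable_const _)
  rw [integral_div, div_self hc.ne', integral_add hFc (integrable_const _),
    integral_sub hFi (integrable_const _)] at h
  simp at h
  linarith

lemma EntropyLE.prod {Ω Ω' : Type*} [MeasurableSpace Ω] [MeasurableSpace Ω']
    {Q P : Measure Ω} {Q' P' : Measure Ω'} [IsProbabilityMeasure Q] [IsProbabilityMeasure P]
    [IsProbabilityMeasure Q'] [IsProbabilityMeasure P'] {κ κ' : ℝ}
    (h : EntropyLE Q P κ) (h' : EntropyLE Q' P' κ') :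
    EntropyLE (Q.prod Q') (P.prod P') (κ + κ') := by
  intro F hF C hC
  have hsec : ∀ x, Measurable fun y => F (x, y) := fun x => hF.comp measurable_prodMk_left
  have hGm : Measurable fun x => Real.log (∫ y, Real.exp (F (x, y)) ∂P') :=
    (hF.exp.stronglyMeasurable.integral_prod_right' (ν := P')).measurable.log
  have hpos : ∀ x, 0 < ∫ y, Real.exp (F (x, y)) ∂P' := fun x =>
    (Real.exp_pos (-C)).trans_le (exp_neg_le_integral_exp (hsec x) fun y => hC (x, y))
  have hGC : ∀ x, |Real.log (∫ y, Real.exp (F (x, y)) ∂P')| ≤ C := fun x => by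
    refine abs_le.2 ⟨?_, ?_⟩
    · rw [Real.le_log_iff_exp_le (hpos x)]
      exact exp_neg_le_integral_exp (hsec x) fun y => hC (x, y)
    · rw [Real.log_le_iff_le_exp (hpos x)]
      exact integral_exp_le_exp (hsec x) fun y => hC (x, y)
  have key := h _ hGm C hGC
  rw [integral_prod _ (integrable_of_abs_le hF hC),
    integral_prod _ (integrable_exp_of_abs_le hF hC)]
  simp_rw [Real.exp_log (hpos _)] at key
  have : ∫ x, ∫ y, F (x, y) ∂Q' ∂Q ≤
      ∫ x, (κ' + Real.log (∫ y, Real.exp (F (x, y)) ∂P')) ∂Q :=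
    integral_mono (integrable_of_abs_le hF hC).integral_prod_left
      ((integrable_const _).add (integrable_of_abs_le hGm hGC))
      fun x => h' _ (hsec x) C fun y => hC (x, y)
  rw [integral_add (integrable_const _) (integrable_of_abs_le hGm hGC)] at this
  simp at this
  linarith

lemma EntropyLE.of_measurePreserving {Ω Ω' : Type*} [MeasurableSpace Ω] [MeasurableSpace Ω']
    {Q P : Measure Ω} {Q' P' : Measure Ω'} {κ : ℝ} (h : EntropyLE Q P κ) (e : Ω' ≃ᵐ Ω)
    (hQ : MeasurePreserving e Q' Q) (hP : MeasurePreserving e P' P) : EntropyLE Q' P' κ := by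
  intro F hF C hC
  have := h (F ∘ e.symm) (hF.comp e.symm.measurable) C fun ω => hC _
  rw [← hQ.integral_comp e.measurableEmbedding, ← hP.integral_comp e.measurableEmbedding] at this
  simpa using this

lemma EntropyLE.pi {Ω : Type*} [MeasurableSpace Ω] {n : ℕ} {Q P : Fin n → Measure Ω}
    [∀ i, IsProbabilityMeasure (Q i)] [∀ i, IsProbabilityMeasure (P i)] {κ : Fin n → ℝ}
    (h : ∀ i, EntropyLE (Q i) (P i) (κ i)) :
    EntropyLE (Measure.pi Q) (Measure.pi P) (∑ i, κ i) := by
  induction n with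
  | zero =>
    rw [Fin.sum_univ_zero, Measure.pi_of_empty (μ := Q), Measure.pi_of_empty (μ := P)]
    exact EntropyLE.refl _
  | succ n ih =>
    rw [Fin.sum_univ_succ]
    exact ((h 0).prod (ih fun i => h i.succ)).of_measurePreserving
      (MeasurableEquiv.piFinSuccAbove (fun _ => Ω) 0) (measurePreserving_piFinSuccAbove Q 0)
      (measurePreserving_piFinSuccAbove P 0)

lemma EntropyLE.gaussianReal (μ μ₀ : ℝ) {v : NNReal} (hv : v ≠ 0) :
    EntropyLE (ProbabilityTheory.gaussianReal μ v) (ProbabilityTheory.gaussianReal μ₀ v)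
      ((μ - μ₀) ^ 2 / (2 * v)) := by
  intro F hF C hC
  have hc := (Real.exp_pos (-C)).trans_le
    (exp_neg_le_integral_exp (P := ProbabilityTheory.gaussianReal μ₀ v) hF hC)
  set c := ∫ ω, Real.exp (F ω) ∂(ProbabilityTheory.gaussianReal μ₀ v) with hcdef
  have hv' : (0 : ℝ) < v := by positivity
  set Q := ProbabilityTheory.gaussianReal μ v
  have hid : Integrable (fun x : ℝ => x) Q :=
    (memLp_id_gaussianReal (μ := μ) (v := v) 1).integrable le_rfl
  set G : ℝ → ℝ := fun x =>
    F x - (2 * (x - μ) * (μ - μ₀) + (μ - μ₀) ^ 2) / (2 * v) - Real.log c + 1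
  have hcen : Integrable (fun x => x - μ) Q := hid.sub (integrable_const μ)
  have hmul : Integrable (fun x => 2 * (x - μ) * (μ - μ₀)) Q :=
    (hcen.const_mul 2).mul_const _
  have hlin : Integrable (fun x => (2 * (x - μ) * (μ - μ₀) + (μ - μ₀) ^ 2) / (2 * v)) Q :=
    (hmul.add (integrable_const _)).div_const _
  have hFi : Integrable (fun x => F x) Q := integrable_of_abs_le hF hC
  have hG₁ : Integrable
      (fun x => F x - (2 * (x - μ) * (μ - μ₀) + (μ - μ₀) ^ 2) / (2 * v)) Q := hFi.sub hlin
  have hG₂ : Integrable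
      (fun x => F x - (2 * (x - μ) * (μ - μ₀) + (μ - μ₀) ^ 2) / (2 * v) - Real.log c) Q :=
    hG₁.sub (integrable_const _)
  have hG : Integrable G Q := hG₂.add (integrable_const _)
  have hGint : ∫ x, G x ∂Q = ∫ x, F x ∂Q - (μ - μ₀) ^ 2 / (2 * v) - Real.log c + 1 := by
    simp only [G]
    rw [integral_add hG₂ (integrable_const _), integral_sub hG₁ (integrable_const _),
      integral_sub hFi hlin, integral_div, integral_add hmul (integrable_const _),
      integral_mul_const, integral_const_mul, integral_sub hid (integrable_const μ),
      integral_id_gaussianReal]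
    simp
  have hle : ∫ x, G x ∂Q ≤ ∫ x, Real.exp (F x) / c ∂(ProbabilityTheory.gaussianReal μ₀ v) := by
    have hE : Integrable (fun x => Real.exp (F x) / c) (ProbabilityTheory.gaussianReal μ₀ v) :=
      (integrable_exp_of_abs_le hF hC).div_const c
    rw [ProbabilityTheory.gaussianReal, if_neg hv] at hE
    have hG' := hG
    simp only [Q] at hG' ⊢
    rw [ProbabilityTheory.gaussianReal, if_neg hv] at hG'
    rw [integral_gaussianReal_eq_integral_smul hv, integral_gaussianReal_eq_integral_smul hv]
    rw [integrable_withDensity_iff_integrable_smul' (by fun_prop)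
      (by simp [gaussianPDF])] at hE hG'
    simp only [toReal_gaussianPDF] at hE hG'
    refine integral_mono hG' hE fun x => ?_
    have hq : gaussianPDFReal μ₀ v x = gaussianPDFReal μ v x *
        Real.exp (-((2 * (x - μ) * (μ - μ₀) + (μ - μ₀) ^ 2) / (2 * v))) := by
      simp only [gaussianPDFReal]
      rw [mul_assoc (_⁻¹), ← Real.exp_add]
      congr 2
      field_simp
      ring
    simp only [smul_eq_mul]
    rw [hq, mul_assoc]
    refine mul_le_mul_of_nonneg_left ?_ (gaussianPDFReal_nonneg _ _ _)
    have := Real.add_one_le_exp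
      (-((2 * (x - μ) * (μ - μ₀) + (μ - μ₀) ^ 2) / (2 * v)) + (F x - Real.log c))
    rw [Real.exp_add, Real.exp_sub, Real.exp_log hc] at this
    refine le_trans (le_of_eq ?_) this
    simp only [G]
    ring
  rw [hGint, integral_div, ← hcdef, div_self hc.ne'] at hle
  linarith

lemma integral_exp_centered_le {𝒬 : Type*} [MeasurableSpace 𝒬] {D : Measure 𝒬}
    [IsProbabilityMeasure D] {g : 𝒬 → ℝ} (hg : Measurable g) {β : ℝ} (hβ : ∀ q, |g q| ≤ β)
    (t : ℝ) : ∫ q, Real.exp (t * (∫ q', g q' ∂D - g q)) ∂D ≤ Real.exp (β ^ 2 * t ^ 2 / 2) := by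
  have h := (hasSubgaussianMGF_of_mem_Icc (μ := D) (X := g) (a := -β) (b := β) hg.aemeasurable
    (Filter.Eventually.of_forall fun q => abs_le.1 (hβ q))).mgf_le (-t)
  have e : ((((‖β - -β‖₊ / 2) ^ 2 : NNReal) : ℝ)) = β ^ 2 := by
    push_cast
    rw [Real.norm_eq_abs, div_pow, sq_abs]
    ring
  rw [e] at h
  simp only [mgf, neg_sq] at h
  convert h using 4
  ring

/-- The change-of-measure bound: the generalization gap of a bounded predictor, averaged over the
posterior, is controlled uniformly over all posteriors of relative entropy at most `κ`. -/
lemma exists_integral_gap_le {Ω 𝒬 Θ : Type*} [MeasurableSpace Ω] [MeasurableSpace 𝒬]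
    {P : Measure Ω} [IsProbabilityMeasure P] {Q : Θ → Measure Ω}
    {κ : ℝ} (hκ : 0 < κ) (hQ : ∀ θ, EntropyLE (Q θ) P κ)
    {g : Ω → 𝒬 → ℝ} (hg : Measurable (Function.uncurry g)) {β : ℝ} (hβ : 0 < β)
    (hgβ : ∀ ω q, |g ω q| ≤ β) (D : Measure 𝒬) [IsProbabilityMeasure D] {m : ℕ} (hm : 0 < m) :
    ∃ Z : (Fin m → 𝒬) → ℝ, Integrable Z (Measure.pi fun _ => D) ∧
      ∫ S, Z S ∂(Measure.pi fun _ => D) ≤ 2 * β * Real.sqrt (κ / m) ∧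
      ∀ θ S, ∫ ω, (∫ q, g ω q ∂D - (∑ i, g ω (S i)) / m) ∂(Q θ) ≤ Z S := by
  have hm' : (0 : ℝ) < m := by exact_mod_cast hm
  set l : ℝ := Real.sqrt (κ * m) / β with hl
  have hl0 : 0 < l := by positivity
  set c : ℝ := Real.exp (l ^ 2 * β ^ 2 / (2 * m)) with hc
  have hc0 : 0 < c := Real.exp_pos _
  have hgsec : ∀ ω, Measurable (g ω) := fun ω => hg.comp measurable_prodMk_left
  have hgD : Measurable fun ω => ∫ q, g ω q ∂D :=
    (hg.stronglyMeasurable.integral_prod_right' (ν := D)).measurable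
  set F : Ω × (Fin m → 𝒬) → ℝ := fun p =>
    l * (∫ q, g p.1 q ∂D - (∑ i, g p.1 (p.2 i)) / m) with hF
  have hFm : Measurable F := by
    refine ((hgD.comp measurable_fst).sub (Measurable.div_const ?_ _)).const_mul _
    refine Finset.measurable_sum _ fun i _ => ?_
    exact hg.comp (measurable_fst.prodMk ((measurable_pi_apply i).comp measurable_snd))
  have hFC : ∀ p, |F p| ≤ l * (β + β) := by
    intro p
    have h1 : |∫ q, g p.1 q ∂D| ≤ β := by
      have := norm_integral_le_of_norm_le_const (μ := D) (f := g p.1) (C := β)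
        (Filter.Eventually.of_forall fun q => hgβ p.1 q)
      simpa using this
    have h2 : |(∑ i, g p.1 (p.2 i)) / m| ≤ β := by
      rw [abs_div, Nat.abs_cast, div_le_iff₀ hm']
      calc |∑ i, g p.1 (p.2 i)| ≤ ∑ i, |g p.1 (p.2 i)| := Finset.abs_sum_le_sum_abs _ _
        _ ≤ ∑ _i : Fin m, β := Finset.sum_le_sum fun i _ => hgβ _ _
        _ = β * m := by simp [mul_comm]
    rw [hF]
    simp only
    rw [abs_mul, abs_of_pos hl0]
    exact mul_le_mul_of_nonneg_left ((abs_sub _ _).trans (add_le_add h1 h2)) hl0.le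
  have hFS : ∀ S, Measurable fun ω => F (ω, S) := fun S => hFm.comp measurable_prodMk_right
  have hE : Integrable (fun p => Real.exp (F p)) (P.prod (Measure.pi fun _ => D)) :=
    integrable_exp_of_abs_le hFm hFC
  have hE' : Integrable (fun S => ∫ ω, Real.exp (F (ω, S)) ∂P) (Measure.pi fun _ : Fin m => D) :=
    hE.integral_prod_right
  have hEle : ∫ S, ∫ ω, Real.exp (F (ω, S)) ∂P ∂(Measure.pi fun _ : Fin m => D) ≤ c := by
    rw [← integral_integral_swap (f := fun ω S => Real.exp (F (ω, S))) hE]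
    have hω : ∀ ω, ∫ S, Real.exp (F (ω, S)) ∂(Measure.pi fun _ : Fin m => D) ≤ c := by
      intro ω
      have e : ∀ S : Fin m → 𝒬, Real.exp (F (ω, S)) =
          ∏ i, Real.exp (l / m * (∫ q, g ω q ∂D - g ω (S i))) := by
        intro S
        rw [← Real.exp_sum, ← Finset.mul_sum, Finset.sum_sub_distrib]
        congr 1
        simp only [hF, Finset.sum_const, Finset.card_univ, Fintype.card_fin, nsmul_eq_mul]
        field_simp
      simp_rw [e]
      rw [integral_fintype_prod_eq_prod
        (f := fun _ q => Real.exp (l / m * (∫ q, g ω q ∂D - g ω q)))]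
      calc _ ≤ ∏ _i : Fin m, Real.exp (β ^ 2 * (l / m) ^ 2 / 2) :=
            Finset.prod_le_prod (fun i _ => integral_nonneg fun _ => (Real.exp_pos _).le)
              fun i _ => integral_exp_centered_le (hgsec ω) (hgβ ω) _
        _ = c := by
            rw [Finset.prod_const, Finset.card_univ, Fintype.card_fin, ← Real.exp_nat_mul, hc]
            congr 1
            field_simp
    have := integral_mono (μ := P) hE.integral_prod_left (integrable_const c) hω
    simpa using this
  refine ⟨fun S => (κ + ((∫ ω, Real.exp (F (ω, S)) ∂P) / c - 1 + Real.log c)) / l, ?_, ?_, ?_⟩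
  · exact ((integrable_const _).add (((hE'.div_const c).sub (integrable_const _)).add
      (integrable_const _))).div_const _
  · have i1 : Integrable (fun S => (∫ ω, Real.exp (F (ω, S)) ∂P) / c - 1)
        (Measure.pi fun _ : Fin m => D) := (hE'.div_const c).sub (integrable_const _)
    have i2 : Integrable (fun S => (∫ ω, Real.exp (F (ω, S)) ∂P) / c - 1 + Real.log c)
        (Measure.pi fun _ : Fin m => D) := i1.add (integrable_const _)
    rw [integral_div, integral_add (integrable_const _) i2, integral_add i1 (integrable_const _),
      integral_sub (hE'.div_const c) (integrable_const _), integral_div]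
    have : (∫ S, ∫ ω, Real.exp (F (ω, S)) ∂P ∂(Measure.pi fun _ : Fin m => D)) / c ≤ 1 := by
      rw [div_le_one hc0]
      exact hEle
    simp only [integral_const, probReal_univ, smul_eq_mul, one_mul]
    rw [div_le_iff₀ hl0, hc, Real.log_exp]
    have hk : Real.sqrt (κ * m) = Real.sqrt κ * Real.sqrt m := Real.sqrt_mul hκ.le _
    have hk2 : Real.sqrt (κ / m) = Real.sqrt κ / Real.sqrt m := Real.sqrt_div hκ.le _
    have hs := Real.sq_sqrt hκ.le
    have hsm := Real.sq_sqrt hm'.le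
    have hsm0 : 0 < Real.sqrt m := Real.sqrt_pos.2 hm'
    have e1 : 2 * β * Real.sqrt (κ / m) * l = 2 * κ := by
      rw [hl, hk, hk2]
      field_simp
      rw [hs]
    have e2 : l ^ 2 * β ^ 2 / (2 * m) = κ / 2 := by
      rw [hl, div_pow, Real.sq_sqrt (by positivity)]
      field_simp
    rw [e1, e2]
    rw [hc, e2] at this
    linarith
  · intro θ S
    have h := hQ θ _ (hFS S) _ fun ω => hFC (ω, S)
    have hpos := (Real.exp_pos _).trans_le
      (exp_neg_le_integral_exp (P := P) (hFS S) fun ω => hFC (ω, S))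
    have hlog := Real.log_le_sub_one_of_pos (div_pos hpos hc0)
    rw [Real.log_div hpos.ne' hc0.ne'] at hlog
    rw [le_div_iff₀ hl0, mul_comm, ← integral_const_mul]
    refine h.trans ?_
    linarith

/-- A median of finitely many reals: the least upper bound achieved by a strict majority. -/
noncomputable def majorityMedian {K : ℕ} (v : Fin K → ℝ) : ℝ :=
  ⨅ T : {T : Finset (Fin K) // K < 2 * T.card}, ⨆ i : T.1, v i

lemma measurable_majorityMedian {K : ℕ} : Measurable (majorityMedian (K := K)) :=
  Measurable.iInf fun _ => Measurable.iSup fun i => measurable_pi_apply i.1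

lemma abs_majorityMedian_sub_le {K : ℕ} {v : Fin K → ℝ} {z b : ℝ}
    (h : K < 2 * (Finset.univ.filter fun i => |v i - z| ≤ b).card) :
    |majorityMedian v - z| ≤ b := by
  set G := Finset.univ.filter fun i => |v i - z| ≤ b with hG
  have hne : ∀ T : {T : Finset (Fin K) // K < 2 * T.card}, Nonempty T.1 := fun T => by
    have := T.2
    rw [Finset.nonempty_coe_sort, ← Finset.card_pos]
    omega
  have : Nonempty {T : Finset (Fin K) // K < 2 * T.card} := ⟨⟨G, h⟩⟩
  rw [abs_le]
  constructor
  · have : z - b ≤ majorityMedian v := by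
      refine le_ciInf fun T => ?_
      obtain ⟨i, hi⟩ : (T.1 ∩ G).Nonempty := by
        rw [← Finset.card_pos]
        have h1 := Finset.card_union_add_card_inter T.1 G
        have h2 : (T.1 ∪ G).card ≤ K := by simpa using Finset.card_le_univ (T.1 ∪ G)
        have h3 := T.2
        omega
      rw [Finset.mem_inter] at hi
      have h4 : |v i - z| ≤ b := (Finset.mem_filter.1 hi.2).2
      have h5 := le_ciSup (f := fun i : T.1 => v i) (Set.finite_range _).bddAbove ⟨i, hi.1⟩
      simp only at h5
      linarith [(abs_le.1 h4).1]
    linarith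
  · have : majorityMedian v ≤ z + b := by
      refine (ciInf_le (Set.finite_range _).bddBelow ⟨G, h⟩).trans ?_
      have := hne ⟨G, h⟩
      refine ciSup_le fun i => ?_
      have h4 : |v i - z| ≤ b := (Finset.mem_filter.1 i.2).2
      linarith [(abs_le.1 h4).2]
    linarith

lemma measureReal_pi_exists_le {Ω : Type*} [MeasurableSpace Ω] {Q : Measure Ω}
    [IsProbabilityMeasure Q] {K : ℕ} {s : Set Ω} (hs : MeasurableSet s) :
    (Measure.pi fun _ : Fin K => Q).real {ω | ∃ i, ω i ∈ s} ≤ K * Q.real s := by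
  have e : {ω : Fin K → Ω | ∃ i, ω i ∈ s} = ⋃ i, Function.eval i ⁻¹' s := by
    ext ω
    simp
  rw [e]
  refine (measureReal_iUnion_fintype_le _).trans ?_
  simp_rw [(measurePreserving_eval (fun _ : Fin K => Q) _).measureReal_preimage
    hs.nullMeasurableSet]
  simp

/-- If an event has probability at most `1/16`, it is unlikely to occur in at least half of `K`
independent trials. -/
lemma measureReal_pi_majority_le {Ω : Type*} [MeasurableSpace Ω] {Q : Measure Ω}
    [IsProbabilityMeasure Q] {K : ℕ} {s : Set Ω} (hs : Q.real s ≤ 1 / 16) :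
    (Measure.pi fun _ : Fin K => Q).real
      {ω | ∃ T : Finset (Fin K), K ≤ 2 * T.card ∧ ∀ i ∈ T, ω i ∈ s} ≤ (1 / 2) ^ K := by
  classical
  have e : {ω : Fin K → Ω | ∃ T : Finset (Fin K), K ≤ 2 * T.card ∧ ∀ i ∈ T, ω i ∈ s} ⊆
      ⋃ T : {T : Finset (Fin K) // K ≤ 2 * T.card},
        Set.univ.pi fun i => if i ∈ T.1 then s else Set.univ := by
    rintro ω ⟨T, hT, h⟩
    refine Set.mem_iUnion.2 ⟨⟨T, hT⟩, fun i _ => ?_⟩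
    by_cases hi : i ∈ T
    · simpa [hi] using h i hi
    · simp [hi]
  refine (measureReal_mono e).trans ((measureReal_iUnion_fintype_le _).trans ?_)
  have hT : ∀ T : {T : Finset (Fin K) // K ≤ 2 * T.card},
      (Measure.pi fun _ : Fin K => Q).real
        (Set.univ.pi fun i => if i ∈ T.1 then s else Set.univ) ≤ (1 / 4) ^ K := by
    intro T
    rw [measureReal_def, Measure.pi_pi, ENNReal.toReal_prod]
    have : ∀ i, (Q (if i ∈ T.1 then s else Set.univ)).toReal
        = if i ∈ T.1 then Q.real s else 1 := by
      intro i
      split_ifs <;> simp [measureReal_def]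
    simp_rw [this]
    rw [Finset.prod_ite_mem, Finset.univ_inter, Finset.prod_const]
    calc Q.real s ^ T.1.card ≤ (1 / 16) ^ T.1.card :=
          pow_le_pow_left₀ measureReal_nonneg hs _
      _ = (1 / 4) ^ (2 * T.1.card) := by rw [pow_mul]; norm_num
      _ ≤ (1 / 4) ^ K := pow_le_pow_of_le_one (by norm_num) (by norm_num) T.2
  calc _ ≤ ∑ _T : {T : Finset (Fin K) // K ≤ 2 * T.card}, (1 / 4 : ℝ) ^ K :=
        Finset.sum_le_sum fun T _ => hT T
    _ ≤ 2 ^ K * (1 / 4) ^ K := by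
        rw [Finset.sum_const, nsmul_eq_mul]
        refine mul_le_mul_of_nonneg_right ?_ (by positivity)
        have := Fintype.card_subtype_le (fun T : Finset (Fin K) => K ≤ 2 * T.card)
        rw [Fintype.card_finset, Fintype.card_fin] at this
        exact_mod_cast this
    _ = (1 / 2) ^ K := by rw [← mul_pow]; norm_num

/-- `X` approximates `x` with mean square error at most `v` in every unit direction. -/
def DirectionalMSE {Ω : Type*} [MeasurableSpace Ω] (Q : Measure Ω) {n : ℕ}
    (X : Ω → Fin n → ℝ) (x : Fin n → ℝ) (v : ℝ) : Prop :=
  ∀ u : Fin n → ℝ,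
    ∫⁻ ω, ENNReal.ofReal ((u ⬝ᵥ (X ω - x)) ^ 2) ∂Q ≤ ENNReal.ofReal (v * (u ⬝ᵥ u))

/-- Up to an event of probability `δ`, `Ψ` approximates `x` with mean square error at most `v` in
every unit direction. -/
def RandomApprox {Ω : Type*} [MeasurableSpace Ω] (Q : Measure Ω) {n : ℕ}
    (Ψ : Ω → Fin n → ℝ) (x : Fin n → ℝ) (v δ : ℝ) : Prop :=
  ∃ X : Ω → Fin n → ℝ, Measurable X ∧ DirectionalMSE Q X x v ∧ Q.real {ω | Ψ ω ≠ X ω} ≤ δ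

lemma dotProduct_self_real_nonneg {n : ℕ} (u : Fin n → ℝ) : 0 ≤ u ⬝ᵥ u :=
  Finset.sum_nonneg fun i _ => mul_self_nonneg (u i)

lemma DirectionalMSE.mono {Ω : Type*} [MeasurableSpace Ω] {Q : Measure Ω} {n : ℕ}
    {X : Ω → Fin n → ℝ} {x : Fin n → ℝ} {v v' : ℝ} (h : DirectionalMSE Q X x v) (hv : v ≤ v') :
    DirectionalMSE Q X x v' := fun u => (h u).trans <| ENNReal.ofReal_le_ofReal <|
  mul_le_mul_of_nonneg_right hv (dotProduct_self_real_nonneg u)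

lemma RandomApprox.mono {Ω : Type*} [MeasurableSpace Ω] {Q : Measure Ω} {n : ℕ}
    {Ψ : Ω → Fin n → ℝ} {x : Fin n → ℝ} {v v' δ δ' : ℝ} (h : RandomApprox Q Ψ x v δ)
    (hv : v ≤ v') (hδ : δ ≤ δ') : RandomApprox Q Ψ x v' δ' := by
  obtain ⟨X, hX, hm, hd⟩ := h
  exact ⟨X, hX, hm.mono hv, hd.trans hδ⟩

lemma DirectionalMSE.coord {Ω : Type*} [MeasurableSpace Ω] {Q : Measure Ω} {n : ℕ}
    {X : Ω → Fin n → ℝ} {x : Fin n → ℝ} {v : ℝ} (h : DirectionalMSE Q X x v) (j : Fin n) :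
    ∫⁻ ω, ENNReal.ofReal ((X ω j - x j) ^ 2) ∂Q ≤ ENNReal.ofReal v := by
  simpa using h (Pi.single j 1)

lemma DirectionalMSE.measureReal_lt_le {Ω : Type*} [MeasurableSpace Ω] {Q : Measure Ω} {n : ℕ}
    {X : Ω → Fin n → ℝ} {x : Fin n → ℝ} {v b : ℝ} (h : DirectionalMSE Q X x v)
    (hX : Measurable X) (hb : 0 < b) (hv : 0 ≤ v) (hvb : 16 * v ≤ b ^ 2) (j : Fin n) :
    Q.real {ω | b < |X ω j - x j|} ≤ 1 / 16 := by
  have hb2 : 0 < b ^ 2 := by positivity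
  have hm : Measurable fun ω => ENNReal.ofReal ((X ω j - x j) ^ 2) := by
    have := measurable_pi_apply j |>.comp hX
    exact ((this.sub_const _).pow_const 2).ennreal_ofReal
  have hsub : {ω | b < |X ω j - x j|} ⊆
      {ω | ENNReal.ofReal (b ^ 2) ≤ ENNReal.ofReal ((X ω j - x j) ^ 2)} := by
    intro ω hω
    refine ENNReal.ofReal_le_ofReal ?_
    rw [← sq_abs (X ω j - x j)]
    exact pow_le_pow_left₀ hb.le (le_of_lt hω) 2
  have h1 : Q {ω | b < |X ω j - x j|} ≤ ENNReal.ofReal (v / b ^ 2) := by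
    refine (measure_mono hsub).trans ?_
    refine (meas_ge_le_lintegral_div hm.aemeasurable 
      (by simpa using hb.ne') (by simp)).trans ?_
    rw [ENNReal.ofReal_div_of_pos hb2]
    exact ENNReal.div_le_div_right (h.coord j) _
  refine (ENNReal.toReal_mono ENNReal.ofReal_ne_top h1).trans ?_
  rw [ENNReal.toReal_ofReal (by positivity), div_le_div_iff₀ hb2 (by norm_num)]
  linarith

/-- The coordinatewise median of independent copies is accurate in every coordinate. -/
lemma RandomApprox.measureReal_median_le {Ω : Type*} [MeasurableSpace Ω] {Q : Measure Ω}
    [IsProbabilityMeasure Q] {n : ℕ} {Ψ : Ω → Fin n → ℝ} {x : Fin n → ℝ} {v δ b : ℝ}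
    (h : RandomApprox Q Ψ x v δ) (hΨ : Measurable Ψ) (hb : 0 < b) (hv : 0 ≤ v)
    (hvb : 16 * v ≤ b ^ 2) (K : ℕ) :
    (Measure.pi fun _ : Fin K => Q).real
      {ω | ∃ j, b < |majorityMedian (fun i => Ψ (ω i) j) - x j|} ≤ K * δ + n * (1 / 2) ^ K := by
  obtain ⟨X, hX, hm, hd⟩ := h
  have hsub : {ω : Fin K → Ω | ∃ j, b < |majorityMedian (fun i => Ψ (ω i) j) - x j|} ⊆
      {ω | ∃ i, ω i ∈ {ω | Ψ ω ≠ X ω}} ∪ ⋃ j : Fin n, {ω | ∃ T : Finset (Fin K),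
        K ≤ 2 * T.card ∧ ∀ i ∈ T, ω i ∈ {ω | b < |X ω j - x j|}} := by
    rintro ω ⟨j, hj⟩
    by_contra hcon
    simp only [Set.mem_union, Set.mem_ofPred_eq, Set.mem_iUnion, not_or, not_exists,
      not_not] at hcon
    obtain ⟨hΨX, hT⟩ := hcon
    refine hj.not_ge ?_
    simp_rw [hΨX]
    refine abs_majorityMedian_sub_le ?_
    by_contra hlt
    refine hT j (Finset.univ.filter fun i => ¬ |X (ω i) j - x j| ≤ b) ⟨?_, ?_⟩
    · have := Finset.card_filter_add_card_filter_not (s := (Finset.univ : Finset (Fin K)))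
        (fun i => |X (ω i) j - x j| ≤ b)
      rw [Finset.card_univ, Fintype.card_fin] at this
      omega
    · intro i hi
      simpa using hi
  refine (measureReal_mono hsub).trans ((measureReal_union_le _ _).trans (add_le_add ?_ ?_))
  · refine (measureReal_pi_exists_le ?_).trans
      (mul_le_mul_of_nonneg_left hd (Nat.cast_nonneg K))
    exact (measurableSet_eq_fun hΨ hX).compl
  · refine (measureReal_iUnion_fintype_le _).trans ?_
    refine (Finset.sum_le_sum fun j _ => measureReal_pi_majority_le
      (hm.measureReal_lt_le hX hb hv hvb j)).trans ?_
    simp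

lemma memLp_sum_pi {ι : Type*} [Fintype ι] {E : ι → Type*} [∀ i, MeasurableSpace (E i)]
    {μ : ∀ i, Measure (E i)} [∀ i, IsProbabilityMeasure (μ i)] {Y : ∀ i, E i → ℝ}
    (hY : ∀ i, MemLp (Y i) 2 (μ i)) : MemLp (fun ω => ∑ i, Y i (ω i)) 2 (Measure.pi μ) :=
  memLp_finsetSum _ fun i _ => (hY i).comp_measurePreserving (measurePreserving_eval μ i)

lemma integral_sum_pi_eq_zero {ι : Type*} [Fintype ι] {E : ι → Type*}
    [∀ i, MeasurableSpace (E i)] {μ : ∀ i, Measure (E i)} [∀ i, IsProbabilityMeasure (μ i)]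
    {Y : ∀ i, E i → ℝ} (hY : ∀ i, MemLp (Y i) 2 (μ i)) (h0 : ∀ i, ∫ x, Y i x ∂(μ i) = 0) :
    ∫ ω, ∑ i, Y i (ω i) ∂(Measure.pi μ) = 0 := by
  rw [integral_finsetSum]
  · refine Finset.sum_eq_zero fun i _ => ?_
    rw [integral_comp_eval (μ := μ) (hY i).aestronglyMeasurable, h0 i]
  · exact fun i _ => ((hY i).comp_measurePreserving (measurePreserving_eval μ i)).integrable
      (by norm_num)

lemma integral_sq_sum_pi {ι : Type*} [Fintype ι] {E : ι → Type*}
    [∀ i, MeasurableSpace (E i)] {μ : ∀ i, Measure (E i)} [∀ i, IsProbabilityMeasure (μ i)]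
    {Y : ∀ i, E i → ℝ} (hY : ∀ i, MemLp (Y i) 2 (μ i)) (h0 : ∀ i, ∫ x, Y i x ∂(μ i) = 0) :
    ∫ ω, (∑ i, Y i (ω i)) ^ 2 ∂(Measure.pi μ) = ∑ i, ∫ x, Y i x ^ 2 ∂(μ i) := by
  have h := variance_sum_pi hY
  have e : (∑ i, fun ω : ∀ i, E i => Y i (ω i)) = fun ω => ∑ i, Y i (ω i) := by
    ext ω
    simp
  rw [e, variance_of_integral_eq_zero (memLp_sum_pi hY).aestronglyMeasurable.aemeasurable
    (integral_sum_pi_eq_zero hY h0)] at h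
  rw [h]
  exact Finset.sum_congr rfl fun i _ =>
    variance_of_integral_eq_zero (hY i).aestronglyMeasurable.aemeasurable (h0 i)

/-- The law of a matrix with independent Gaussian entries of mean `W` and variance `τ`. -/
noncomputable def gaussianMatrix {a n : ℕ} (W : Matrix (Fin a) (Fin n) ℝ) (τ : NNReal) :
    Measure (Fin a → Fin n → ℝ) :=
  Measure.pi fun i => Measure.pi fun j => gaussianReal (W i j) τ

instance {a n : ℕ} (W : Matrix (Fin a) (Fin n) ℝ) (τ : NNReal) :
    IsProbabilityMeasure (gaussianMatrix W τ) := by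
  have (i : Fin a) : IsProbabilityMeasure (Measure.pi fun j => gaussianReal (W i j) τ) :=
    Measure.pi.instIsProbabilityMeasure _
  exact Measure.pi.instIsProbabilityMeasure _

lemma EntropyLE.gaussianMatrix {a n : ℕ} (W W₀ : Matrix (Fin a) (Fin n) ℝ) {τ : NNReal}
    (hτ : τ ≠ 0) : EntropyLE (gaussianMatrix W τ) (gaussianMatrix W₀ τ)
      ((∑ i, ∑ j, (W - W₀) i j ^ 2) / (2 * τ)) := by
  have (W : Matrix (Fin a) (Fin n) ℝ) (i : Fin a) :
      IsProbabilityMeasure (Measure.pi fun j => ProbabilityTheory.gaussianReal (W i j) τ) :=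
    Measure.pi.instIsProbabilityMeasure _
  have h := EntropyLE.pi fun i => EntropyLE.pi fun j =>
    EntropyLE.gaussianReal (W i j) (W₀ i j) hτ
  simp_rw [← Finset.sum_div] at h
  exact h

lemma memLp_gaussianReal_centered (c w : ℝ) (τ : NNReal) :
    MemLp (fun x => c * (x - w)) 2 (gaussianReal w τ) :=
  ((memLp_id_gaussianReal 2).sub (memLp_const w)).const_mul c

lemma integral_gaussianReal_centered (c w : ℝ) (τ : NNReal) :
    ∫ x, c * (x - w) ∂(gaussianReal w τ) = 0 := by
  have hid : Integrable (fun x : ℝ => x) (gaussianReal w τ) :=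
    (memLp_id_gaussianReal 1).integrable le_rfl
  rw [integral_const_mul, integral_sub hid (integrable_const _), integral_id_gaussianReal]
  simp

lemma integral_sq_gaussianReal_centered (c w : ℝ) (τ : NNReal) :
    ∫ x, (c * (x - w)) ^ 2 ∂(gaussianReal w τ) = c ^ 2 * τ := by
  have h := variance_id_gaussianReal (μ := w) (v := τ)
  rw [variance_eq_integral measurable_id.aemeasurable] at h
  simp only [id, integral_id_gaussianReal] at h
  simp_rw [mul_pow]
  rw [integral_const_mul, h]

lemma lintegral_sq_gaussianMatrix {a n : ℕ} (W : Matrix (Fin a) (Fin n) ℝ) (τ : NNReal)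
    (u : Fin a → ℝ) (y : Fin n → ℝ) :
    ∫⁻ g, ENNReal.ofReal ((u ⬝ᵥ ((Matrix.of g - W).mulVec y)) ^ 2) ∂(gaussianMatrix W τ) =
      ENNReal.ofReal (τ * (u ⬝ᵥ u) * (y ⬝ᵥ y)) := by
  have e : ∀ g : Fin a → Fin n → ℝ, u ⬝ᵥ ((Matrix.of g - W).mulVec y) =
      ∑ i, ∑ j, (u i * y j) * (g i j - W i j) := by
    intro g
    simp only [dotProduct, Matrix.mulVec, Finset.mul_sum, Matrix.sub_apply, Matrix.of_apply]
    exact Finset.sum_congr rfl fun i _ => Finset.sum_congr rfl fun j _ => by ring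
  have (i : Fin a) : IsProbabilityMeasure (Measure.pi fun j => gaussianReal (W i j) τ) :=
    Measure.pi.instIsProbabilityMeasure _
  have hin := fun i => memLp_sum_pi fun j =>
    memLp_gaussianReal_centered (u i * y j) (W i j) τ
  have hin0 := fun i => integral_sum_pi_eq_zero
    (fun j => memLp_gaussianReal_centered (u i * y j) (W i j) τ)
    (fun j => integral_gaussianReal_centered (u i * y j) (W i j) τ)
  simp_rw [e]
  rw [← ofReal_integral_eq_lintegral_ofReal]
  · congr 1
    unfold gaussianMatrix
    rw [integral_sq_sum_pi hin hin0]
    simp_rw [fun i => integral_sq_sum_pi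
      (fun j => memLp_gaussianReal_centered (u i * y j) (W i j) τ)
      (fun j => integral_gaussianReal_centered (u i * y j) (W i j) τ),
      integral_sq_gaussianReal_centered]
    simp only [dotProduct, Finset.sum_mul, Finset.mul_sum]
    rw [Finset.sum_comm]
    exact Finset.sum_congr rfl fun j _ => Finset.sum_congr rfl fun i _ => by ring
  · exact (memLp_sum_pi hin).integrable_sq
  · exact Filter.Eventually.of_forall fun _ => sq_nonneg _

lemma dotProduct_vecMul_self_le {a n : ℕ} {W : Matrix (Fin a) (Fin n) ℝ} {w : ℝ}
    (hw : 0 ≤ w) (hW : ∀ y, (W.mulVec y) ⬝ᵥ (W.mulVec y) ≤ w * (y ⬝ᵥ y)) (u : Fin a → ℝ) :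
    (Matrix.vecMul u W) ⬝ᵥ (Matrix.vecMul u W) ≤ w * (u ⬝ᵥ u) := by
  set y := Matrix.vecMul u W with hy
  rcases (dotProduct_self_real_nonneg y).eq_or_lt with h0 | h0
  · rw [← h0]
    exact mul_nonneg hw (dotProduct_self_real_nonneg u)
  have e : y ⬝ᵥ y = u ⬝ᵥ W.mulVec y := by rw [Matrix.dotProduct_mulVec, hy]
  have hcs : (u ⬝ᵥ W.mulVec y) ^ 2 ≤ (u ⬝ᵥ u) * (W.mulVec y ⬝ᵥ W.mulVec y) := by
    have := Finset.sum_mul_sq_le_sq_mul_sq Finset.univ u (W.mulVec y)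
    simpa [dotProduct, pow_two] using this
  rw [← e] at hcs
  have := hcs.trans (mul_le_mul_of_nonneg_left (hW y) (dotProduct_self_real_nonneg u))
  nlinarith

lemma measurable_mulVec_of {Ω : Type*} [MeasurableSpace Ω] {a n : ℕ}
    {g : Ω → Fin a → Fin n → ℝ} {X : Ω → Fin n → ℝ} (hg : Measurable g) (hX : Measurable X) :
    Measurable fun ω => (Matrix.of (g ω)).mulVec (X ω) := by
  refine measurable_pi_lambda _ fun i => ?_
  simp only [Matrix.mulVec, dotProduct, Matrix.of_apply]
  fun_prop

lemma measurable_dotProduct {Ω : Type*} [MeasurableSpace Ω] {n : ℕ}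
    {f g : Ω → Fin n → ℝ} (hf : Measurable f) (hg : Measurable g) :
    Measurable fun ω => f ω ⬝ᵥ g ω := by
  simp only [dotProduct]
  fun_prop

lemma DirectionalMSE.lintegral_dotProduct_self_le {Ω : Type*} [MeasurableSpace Ω]
    {Q : Measure Ω} [IsProbabilityMeasure Q] {n : ℕ} {X : Ω → Fin n → ℝ} {x : Fin n → ℝ} {v : ℝ}
    (h : DirectionalMSE Q X x v) (hX : Measurable X) (hv : 0 ≤ v) :
    ∫⁻ ω, ENNReal.ofReal (X ω ⬝ᵥ X ω) ∂Q ≤ ENNReal.ofReal (2 * (x ⬝ᵥ x + n * v)) := by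
  have hXj : ∀ j, Measurable fun ω => X ω j := fun j => (measurable_pi_apply j).comp hX
  have hle : ∀ ω, ENNReal.ofReal (X ω ⬝ᵥ X ω) ≤
      ENNReal.ofReal (2 * (x ⬝ᵥ x)) +
        ENNReal.ofReal 2 * ∑ j, ENNReal.ofReal ((X ω j - x j) ^ 2) := by
    intro ω
    rw [← ENNReal.ofReal_sum_of_nonneg fun _ _ => sq_nonneg _,
      ← ENNReal.ofReal_mul (by norm_num), ← ENNReal.ofReal_add
      (mul_nonneg zero_le_two (dotProduct_self_real_nonneg x))
      (mul_nonneg zero_le_two (Finset.sum_nonneg fun _ _ => sq_nonneg _))]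
    refine ENNReal.ofReal_le_ofReal ?_
    rw [dotProduct, dotProduct, ← mul_add, ← Finset.sum_add_distrib, Finset.mul_sum]
    refine Finset.sum_le_sum fun j _ => ?_
    nlinarith [sq_nonneg (X ω j - 2 * x j)]
  have hms : ∀ j, Measurable fun ω => ENNReal.ofReal ((X ω j - x j) ^ 2) := fun j =>
    (((hXj j).sub_const _).pow_const 2).ennreal_ofReal
  refine (lintegral_mono hle).trans ?_
  rw [lintegral_add_left measurable_const, lintegral_const, measure_univ, mul_one,
    lintegral_const_mul _ (Finset.measurable_fun_sum _ fun j _ => hms j),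
    lintegral_finsetSum _ fun j _ => hms j]
  calc _ ≤ ENNReal.ofReal (2 * (x ⬝ᵥ x)) + ENNReal.ofReal 2 * ∑ _j : Fin n, ENNReal.ofReal v := by
        gcongr with j
        exact h.coord j
    _ = _ := by
        rw [Finset.sum_const, Finset.card_univ, Fintype.card_fin, nsmul_eq_mul,
          ← ENNReal.ofReal_natCast, ← ENNReal.ofReal_mul (by positivity),
          ← ENNReal.ofReal_mul (by norm_num), ← ENNReal.ofReal_add
          (mul_nonneg zero_le_two (dotProduct_self_real_nonneg x)) (by positivity)]
        congr 1
        ring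

lemma ofReal_sq_add_le (p q : ℝ) : ENNReal.ofReal ((p + q) ^ 2) ≤
    ENNReal.ofReal 2 * ENNReal.ofReal (p ^ 2) + ENNReal.ofReal 2 * ENNReal.ofReal (q ^ 2) := by
  rw [← ENNReal.ofReal_mul (by norm_num), ← ENNReal.ofReal_mul (by norm_num),
    ← ENNReal.ofReal_add (by positivity) (by positivity)]
  refine ENNReal.ofReal_le_ofReal ?_
  nlinarith [sq_nonneg (p - q)]

lemma DirectionalMSE.gaussian_mulVec {Ω : Type*} [MeasurableSpace Ω] {Q : Measure Ω}
    [IsProbabilityMeasure Q] {a n : ℕ} {X : Ω → Fin n → ℝ} {x : Fin n → ℝ} {v : ℝ}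
    (h : DirectionalMSE Q X x v) (hX : Measurable X) (hv : 0 ≤ v)
    {W : Matrix (Fin a) (Fin n) ℝ} {w : ℝ} (hw : 0 ≤ w)
    (hW : ∀ y, (W.mulVec y) ⬝ᵥ (W.mulVec y) ≤ w * (y ⬝ᵥ y)) (τ : NNReal) :
    DirectionalMSE (Q.prod (gaussianMatrix W τ)) (fun p => (Matrix.of p.2).mulVec (X p.1))
      (W.mulVec x) (2 * w * v + 4 * τ * (x ⬝ᵥ x + n * v)) := by
  intro u
  have hu := dotProduct_self_real_nonneg u
  have hx := dotProduct_self_real_nonneg x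
  have e : ∀ p : Ω × (Fin a → Fin n → ℝ),
      u ⬝ᵥ ((Matrix.of p.2).mulVec (X p.1) - W.mulVec x) =
        (Matrix.vecMul u W) ⬝ᵥ (X p.1 - x) + u ⬝ᵥ ((Matrix.of p.2 - W).mulVec (X p.1)) := by
    intro p
    rw [← Matrix.dotProduct_mulVec, ← dotProduct_add]
    congr 1
    rw [Matrix.mulVec_sub, Matrix.sub_mulVec]
    abel
  have hm₁ : Measurable fun ω => ENNReal.ofReal (((Matrix.vecMul u W) ⬝ᵥ (X ω - x)) ^ 2) :=
    ((measurable_dotProduct measurable_const (hX.sub_const x)).pow_const 2).ennreal_ofReal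
  have hm₁' : Measurable fun p : Ω × (Fin a → Fin n → ℝ) =>
      ENNReal.ofReal (((Matrix.vecMul u W) ⬝ᵥ (X p.1 - x)) ^ 2) := hm₁.comp measurable_fst
  have hm₂ : Measurable fun p : Ω × (Fin a → Fin n → ℝ) =>
      ENNReal.ofReal ((u ⬝ᵥ ((Matrix.of p.2 - W).mulVec (X p.1))) ^ 2) := by
    refine ((measurable_dotProduct measurable_const ?_).pow_const 2).ennreal_ofReal
    exact measurable_mulVec_of (g := fun p : Ω × (Fin a → Fin n → ℝ) => p.2 - fun i j => W i j)
      (measurable_snd.sub_const _) (hX.comp measurable_fst)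
  calc _ ≤ ∫⁻ p, (ENNReal.ofReal 2 *
          ENNReal.ofReal (((Matrix.vecMul u W) ⬝ᵥ (X p.1 - x)) ^ 2) + ENNReal.ofReal 2 *
          ENNReal.ofReal ((u ⬝ᵥ ((Matrix.of p.2 - W).mulVec (X p.1))) ^ 2))
          ∂(Q.prod (gaussianMatrix W τ)) := by
        refine lintegral_mono fun p => ?_
        rw [e]
        exact ofReal_sq_add_le _ _
    _ = ENNReal.ofReal 2 * ∫⁻ ω, ENNReal.ofReal (((Matrix.vecMul u W) ⬝ᵥ (X ω - x)) ^ 2) ∂Q +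
        ENNReal.ofReal 2 * ∫⁻ ω, ENNReal.ofReal (τ * (u ⬝ᵥ u) * (X ω ⬝ᵥ X ω)) ∂Q := by
        rw [lintegral_add_left (hm₁'.const_mul _),
          lintegral_const_mul _ hm₁', lintegral_const_mul _ hm₂,
          lintegral_prod _ hm₁'.aemeasurable,
          lintegral_prod _ hm₂.aemeasurable]
        simp_rw [lintegral_sq_gaussianMatrix]
        simp
    _ ≤ ENNReal.ofReal 2 * ENNReal.ofReal (v * (w * (u ⬝ᵥ u))) + ENNReal.ofReal 2 *
        (ENNReal.ofReal (τ * (u ⬝ᵥ u)) * ENNReal.ofReal (2 * (x ⬝ᵥ x + n * v))) := by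
        have e2 : ∀ ω, ENNReal.ofReal (τ * (u ⬝ᵥ u) * (X ω ⬝ᵥ X ω)) =
            ENNReal.ofReal (τ * (u ⬝ᵥ u)) * ENNReal.ofReal (X ω ⬝ᵥ X ω) :=
          fun ω => ENNReal.ofReal_mul (by positivity)
        simp_rw [e2]
        rw [lintegral_const_mul _ (measurable_dotProduct hX hX).ennreal_ofReal]
        gcongr
        · exact (h _).trans (ENNReal.ofReal_le_ofReal
            (mul_le_mul_of_nonneg_left (dotProduct_vecMul_self_le hw hW u) hv))
        · exact h.lintegral_dotProduct_self_le hX hv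
    _ = _ := by
        rw [← ENNReal.ofReal_mul (by positivity), ← ENNReal.ofReal_mul (by positivity),
          ← ENNReal.ofReal_mul (by positivity), ← ENNReal.ofReal_add (by positivity)
          (by positivity)]
        congr 1
        ring

lemma RandomApprox.gaussian_mulVec {Ω : Type*} [MeasurableSpace Ω] {Q : Measure Ω}
    [IsProbabilityMeasure Q] {a n : ℕ} {Ψ : Ω → Fin n → ℝ} {x : Fin n → ℝ} {v δ : ℝ}
    (h : RandomApprox Q Ψ x v δ) (hΨ : Measurable Ψ) (hv : 0 ≤ v)
    {W : Matrix (Fin a) (Fin n) ℝ} {w : ℝ} (hw : 0 ≤ w)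
    (hW : ∀ y, (W.mulVec y) ⬝ᵥ (W.mulVec y) ≤ w * (y ⬝ᵥ y)) (τ : NNReal) :
    RandomApprox (Q.prod (gaussianMatrix W τ)) (fun p => (Matrix.of p.2).mulVec (Ψ p.1))
      (W.mulVec x) (2 * w * v + 4 * τ * (x ⬝ᵥ x + n * v)) δ := by
  obtain ⟨X, hX, hm, hd⟩ := h
  refine ⟨fun p => (Matrix.of p.2).mulVec (X p.1),
    measurable_mulVec_of measurable_snd (hX.comp measurable_fst),
    hm.gaussian_mulVec hX hv hw hW τ, ?_⟩
  have hsub : {p : Ω × (Fin a → Fin n → ℝ) | (Matrix.of p.2).mulVec (Ψ p.1) ≠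
      (Matrix.of p.2).mulVec (X p.1)} ⊆ Prod.fst ⁻¹' {ω | Ψ ω ≠ X ω} := by
    intro p hp heq
    exact hp (by rw [heq])
  refine (measureReal_mono hsub).trans (le_trans (le_of_eq ?_) hd)
  exact (measurePreserving_fst (μ := Q) (ν := gaussianMatrix W τ)).measureReal_preimage
    (measurableSet_eq_fun hΨ hX).compl.nullMeasurableSet

lemma lintegral_pi_succ {Ω : Type*} [MeasurableSpace Ω] {Q : Measure Ω} [IsProbabilityMeasure Q]
    {K : ℕ} {f : Ω → (Fin K → Ω) → ENNReal} (hf : Measurable (Function.uncurry f)) :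
    ∫⁻ ω, f (ω 0) (fun i => ω i.succ) ∂(Measure.pi fun _ : Fin (K + 1) => Q) =
      ∫⁻ p, f p.1 p.2 ∂(Q.prod (Measure.pi fun _ : Fin K => Q)) :=
  (measurePreserving_piFinSuccAbove (fun _ : Fin (K + 1) => Q) 0).lintegral_comp hf

/-- The polynomial `∑ k, c k * a ^ k` of degree `K`, evaluated coordinatewise in Horner form with a
separate copy `A i` of the variable `a` at each step. -/
def hornerProd {n : ℕ} : (K : ℕ) → (ℕ → Fin n → ℝ) → (Fin K → Fin n → ℝ) → Fin n → ℝ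
  | 0, c, _ => c 0
  | K + 1, c, A => c 0 + A 0 * hornerProd K (fun k => c (k + 1)) (fun i => A i.succ)

lemma hornerProd_const {n : ℕ} (K : ℕ) (c : ℕ → Fin n → ℝ) (a : Fin n → ℝ) (j : Fin n) :
    hornerProd K c (fun _ => a) j = ∑ k ∈ Finset.range (K + 1), c k j * a j ^ k := by
  induction K generalizing c with
  | zero => simp [hornerProd]
  | succ K ih =>
    rw [Finset.sum_range_succ']
    simp only [hornerProd, Pi.add_apply, Pi.mul_apply, ih, Finset.mul_sum]
    rw [add_comm, pow_zero, mul_one]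
    congr 1
    exact Finset.sum_congr rfl fun k _ => by ring

lemma measurable_hornerProd {S : Type*} [MeasurableSpace S] {n K : ℕ} {c : S → ℕ → Fin n → ℝ}
    {A : S → Fin K → Fin n → ℝ} (hc : ∀ k, Measurable fun s => c s k)
    (hA : ∀ i, Measurable fun s => A s i) :
    Measurable fun s => hornerProd K (c s) (A s) := by
  induction K generalizing c with
  | zero => exact hc 0
  | succ K ih =>
    exact (hc 0).add ((hA 0).mul (ih (fun k => hc (k + 1)) fun i => hA i.succ))

section Horner

variable {Ω : Type*} [MeasurableSpace Ω] {Q : Measure Ω} [IsProbabilityMeasure Q] {n : ℕ}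
  {X : Ω → Fin n → ℝ} {z z₀ : Fin n → ℝ} {v b B : ℝ}

lemma DirectionalMSE.lintegral_sq_sub_le (h : DirectionalMSE Q X z v) (hX : Measurable X)
    (hv : 0 ≤ v) (hvb : v ≤ b ^ 2) {j : Fin n} (ha : |z j - z₀ j| ≤ b) :
    ∫⁻ ω, ENNReal.ofReal ((X ω j - z₀ j) ^ 2) ∂Q ≤ ENNReal.ofReal (4 * b ^ 2) := by
  have hXj : Measurable fun ω => X ω j := (measurable_pi_apply j).comp hX
  have ha2 : (z j - z₀ j) ^ 2 ≤ b ^ 2 := sq_le_sq' (abs_le.1 ha).1 (abs_le.1 ha).2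
  calc _ ≤ ∫⁻ ω, (ENNReal.ofReal 2 * ENNReal.ofReal ((X ω j - z j) ^ 2) +
          ENNReal.ofReal 2 * ENNReal.ofReal ((z j - z₀ j) ^ 2)) ∂Q := by
        refine lintegral_mono fun ω => ?_
        refine le_trans (le_of_eq ?_) (ofReal_sq_add_le _ _)
        congr 1
        ring
    _ ≤ ENNReal.ofReal 2 * ENNReal.ofReal v + ENNReal.ofReal 2 * ENNReal.ofReal (b ^ 2) := by
        rw [lintegral_add_right _ measurable_const, lintegral_const, measure_univ, mul_one,
          lintegral_const_mul _ ((hXj.sub_const _).pow_const 2).ennreal_ofReal]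
        gcongr
        exact h.coord j
    _ ≤ _ := by
        rw [← ENNReal.ofReal_mul (by norm_num), ← ENNReal.ofReal_mul (by norm_num),
          ← ENNReal.ofReal_add (by positivity) (by positivity)]
        exact ENNReal.ofReal_le_ofReal (by linarith)

lemma DirectionalMSE.lintegral_sq_hornerProd_le (h : DirectionalMSE Q X z v) (hX : Measurable X)
    (hv : 0 ≤ v) (hvb : v ≤ b ^ 2) (ha : ∀ j, |z j - z₀ j| ≤ b) (hbB : 16 * b ^ 2 * B ^ 2 ≤ 1)
    {K : ℕ} {c : ℕ → Fin n → ℝ} {β : ℝ} (hc : ∀ k j, |c k j| ≤ β * B ^ k) (j : Fin n) :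
    ∫⁻ ω, ENNReal.ofReal (hornerProd K c (fun i => X (ω i) - z₀) j ^ 2)
      ∂(Measure.pi fun _ => Q) ≤ ENNReal.ofReal (4 * β ^ 2) := by
  induction K generalizing c β with
  | zero =>
    simp only [hornerProd, lintegral_const, measure_univ, mul_one]
    refine ENNReal.ofReal_le_ofReal ?_
    have h0 := hc 0 j
    rw [pow_zero, mul_one] at h0
    nlinarith [sq_le_sq' (abs_le.1 h0).1 (abs_le.1 h0).2, sq_nonneg β]
  | succ K ih =>
    have hXj : Measurable fun ω => X ω j - z₀ j := ((measurable_pi_apply j).comp hX).sub_const _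
    have hH : Measurable fun ω : Fin K → Ω =>
        hornerProd K (fun k => c (k + 1)) (fun i => X (ω i) - z₀) j :=
      (measurable_pi_apply j).comp (measurable_hornerProd (fun _ => measurable_const)
        fun i => (hX.comp (measurable_pi_apply i)).sub_const _)
    have hp := (hXj.pow_const 2).ennreal_ofReal
    have hq := (hH.pow_const 2).ennreal_ofReal
    have hpq : Measurable fun p : Ω × (Fin K → Ω) => ENNReal.ofReal ((X p.1 j - z₀ j) ^ 2) *
        ENNReal.ofReal (hornerProd K (fun k => c (k + 1)) (fun i => X (p.2 i) - z₀) j ^ 2) :=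
      (hp.comp measurable_fst).mul (hq.comp measurable_snd)
    have ih' := ih (c := fun k => c (k + 1)) (β := β * B) fun k j =>
      (hc (k + 1) j).trans (le_of_eq (by ring))
    have h0 := hc 0 j
    rw [pow_zero, mul_one] at h0
    have h02 := sq_le_sq' (abs_le.1 h0).1 (abs_le.1 h0).2
    calc _ ≤ ∫⁻ ω : Fin (K + 1) → Ω, (ENNReal.ofReal 2 * ENNReal.ofReal (c 0 j ^ 2) +
          ENNReal.ofReal 2 * (ENNReal.ofReal ((X (ω 0) j - z₀ j) ^ 2) *
          ENNReal.ofReal (hornerProd K (fun k => c (k + 1)) (fun i => X (ω i.succ) - z₀) j ^ 2)))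
          ∂(Measure.pi fun _ => Q) := by
          refine lintegral_mono fun ω => ?_
          rw [← ENNReal.ofReal_mul (sq_nonneg _), ← mul_pow]
          exact ofReal_sq_add_le _ _
      _ = ENNReal.ofReal 2 * ENNReal.ofReal (c 0 j ^ 2) + ENNReal.ofReal 2 *
          ((∫⁻ ω, ENNReal.ofReal ((X ω j - z₀ j) ^ 2) ∂Q) *
          ∫⁻ ω, ENNReal.ofReal (hornerProd K (fun k => c (k + 1)) (fun i => X (ω i) - z₀) j ^ 2)
          ∂(Measure.pi fun _ => Q)) := by
          rw [lintegral_pi_succ (f := fun ω₀ ω => ENNReal.ofReal 2 * ENNReal.ofReal (c 0 j ^ 2) +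
            ENNReal.ofReal 2 * (ENNReal.ofReal ((X ω₀ j - z₀ j) ^ 2) * ENNReal.ofReal
            (hornerProd K (fun k => c (k + 1)) (fun i => X (ω i) - z₀) j ^ 2)))
            ((hpq.const_mul _).const_add _), lintegral_add_left measurable_const,
            lintegral_const, measure_univ, mul_one, lintegral_const_mul _ hpq,
            lintegral_prod_mul hp.aemeasurable hq.aemeasurable]
      _ ≤ ENNReal.ofReal 2 * ENNReal.ofReal (β ^ 2) + ENNReal.ofReal 2 *
          (ENNReal.ofReal (4 * b ^ 2) * ENNReal.ofReal (4 * (β * B) ^ 2)) := by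
          gcongr
          exact h.lintegral_sq_sub_le hX hv hvb (ha j)
      _ ≤ _ := by
          rw [← ENNReal.ofReal_mul (by positivity), ← ENNReal.ofReal_mul (by positivity),
            ← ENNReal.ofReal_mul (by positivity), ← ENNReal.ofReal_add (by positivity)
            (by positivity)]
          refine ENNReal.ofReal_le_ofReal ?_
          nlinarith [mul_le_mul_of_nonneg_left hbB (sq_nonneg β)]

lemma DirectionalMSE.hornerProd (h : DirectionalMSE Q X z v) (hX : Measurable X)
    (hv : 0 ≤ v) (hvb : v ≤ b ^ 2) (ha : ∀ j, |z j - z₀ j| ≤ b) (hbB : 16 * b ^ 2 * B ^ 2 ≤ 1)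
    {K : ℕ} {c : ℕ → Fin n → ℝ} {β : ℝ} (hc : ∀ k, 1 ≤ k → ∀ j, |c k j| ≤ β * B ^ k) :
    DirectionalMSE (Measure.pi fun _ : Fin K => Q)
      (fun ω => _root_.hornerProd K c (fun i => X (ω i) - z₀))
      (_root_.hornerProd K c (fun _ => z - z₀)) (16 * v * β ^ 2 * B ^ 2) := by
  induction K generalizing c β with
  | zero =>
    intro u
    simp [_root_.hornerProd]
  | succ K ih =>
    intro u
    have hu := dotProduct_self_real_nonneg u
    set c' : ℕ → Fin n → ℝ := fun k => c (k + 1) with hc'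
    set H : (Fin K → Ω) → Fin n → ℝ := fun ω => _root_.hornerProd K c' (fun i => X (ω i) - z₀)
    set η := _root_.hornerProd K c' (fun _ => z - z₀)
    have hcb : ∀ k j, |c' k j| ≤ β * B * B ^ k := fun k j =>
      (hc (k + 1) (by omega) j).trans (le_of_eq (by ring))
    have hH : Measurable H := measurable_hornerProd (fun _ => measurable_const)
        fun i => (hX.comp (measurable_pi_apply i)).sub_const _
    have hHj : ∀ j, Measurable fun ω => ENNReal.ofReal (H ω j ^ 2) := fun j =>
      (((measurable_pi_apply j).comp hH).pow_const 2).ennreal_ofReal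
    have hp : Measurable fun p : Ω × (Fin K → Ω) =>
        ENNReal.ofReal (((u * H p.2) ⬝ᵥ (X p.1 - z)) ^ 2) :=
      ((measurable_dotProduct ((hH.comp measurable_snd).const_mul u)
        ((hX.comp measurable_fst).sub_const z)).pow_const 2).ennreal_ofReal
    have hq : Measurable fun ω : Fin K → Ω =>
        ENNReal.ofReal (((u * (z - z₀)) ⬝ᵥ (H ω - η)) ^ 2) :=
      ((measurable_dotProduct measurable_const (hH.sub_const η)).pow_const 2).ennreal_ofReal
    have hq' : Measurable fun p : Ω × (Fin K → Ω) =>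
        ENNReal.ofReal (((u * (z - z₀)) ⬝ᵥ (H p.2 - η)) ^ 2) := hq.comp measurable_snd
    have e : ∀ (ω₀ : Ω) (ω : Fin K → Ω), u ⬝ᵥ ((c 0 + (X ω₀ - z₀) * H ω) -
        (c 0 + (z - z₀) * η)) =
        (u * H ω) ⬝ᵥ (X ω₀ - z) + (u * (z - z₀)) ⬝ᵥ (H ω - η) := by
      intro ω₀ ω
      simp only [dotProduct, Pi.add_apply, Pi.sub_apply, Pi.mul_apply]
      rw [← Finset.sum_add_distrib]
      exact Finset.sum_congr rfl fun j _ => by ring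
    have huz : (u * (z - z₀)) ⬝ᵥ (u * (z - z₀)) ≤ b ^ 2 * (u ⬝ᵥ u) := by
      simp only [dotProduct, Pi.sub_apply, Pi.mul_apply]
      rw [Finset.mul_sum]
      refine Finset.sum_le_sum fun j _ => ?_
      nlinarith [sq_le_sq' (abs_le.1 (ha j)).1 (abs_le.1 (ha j)).2, mul_self_nonneg (u j)]
    calc _ ≤ ∫⁻ ω : Fin (K + 1) → Ω, (ENNReal.ofReal 2 *
          ENNReal.ofReal (((u * H (fun i => ω i.succ)) ⬝ᵥ (X (ω 0) - z)) ^ 2) +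
          ENNReal.ofReal 2 *
          ENNReal.ofReal (((u * (z - z₀)) ⬝ᵥ (H (fun i => ω i.succ) - η)) ^ 2))
          ∂(Measure.pi fun _ => Q) := by
          refine lintegral_mono fun ω => ?_
          refine le_trans (le_of_eq ?_) (ofReal_sq_add_le _ _)
          rw [← e]
          rfl
      _ = ENNReal.ofReal 2 * (∫⁻ ω, ∫⁻ ω₀, ENNReal.ofReal (((u * H ω) ⬝ᵥ (X ω₀ - z)) ^ 2) ∂Q
            ∂(Measure.pi fun _ => Q)) + ENNReal.ofReal 2 *
          ∫⁻ ω, ENNReal.ofReal (((u * (z - z₀)) ⬝ᵥ (H ω - η)) ^ 2)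
            ∂(Measure.pi fun _ => Q) := by
          rw [lintegral_pi_succ (f := fun ω₀ ω => ENNReal.ofReal 2 *
            ENNReal.ofReal (((u * H ω) ⬝ᵥ (X ω₀ - z)) ^ 2) + ENNReal.ofReal 2 *
            ENNReal.ofReal (((u * (z - z₀)) ⬝ᵥ (H ω - η)) ^ 2))
            ((hp.const_mul _).add (hq'.const_mul _)), lintegral_add_left (hp.const_mul _),
            lintegral_const_mul _ hp, lintegral_const_mul _ hq',
            lintegral_prod_symm' _ hp, lintegral_prod_symm' _ hq']
          simp
      _ ≤ ENNReal.ofReal 2 * ENNReal.ofReal (v * (4 * (β * B) ^ 2 * (u ⬝ᵥ u))) +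
          ENNReal.ofReal 2 * ENNReal.ofReal
            (16 * v * (β * B) ^ 2 * B ^ 2 * (b ^ 2 * (u ⬝ᵥ u))) := by
          gcongr
          · refine (lintegral_mono fun ω => h (u * H ω)).trans ?_
            have e2 : ∀ ω, ENNReal.ofReal (v * ((u * H ω) ⬝ᵥ (u * H ω))) =
                ENNReal.ofReal v * ∑ j, ENNReal.ofReal (u j ^ 2) * ENNReal.ofReal (H ω j ^ 2) := by
              intro ω
              rw [ENNReal.ofReal_mul hv, dotProduct,
                ENNReal.ofReal_sum_of_nonneg fun j _ => mul_self_nonneg _]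
              congr 1
              refine Finset.sum_congr rfl fun j _ => ?_
              rw [← ENNReal.ofReal_mul (sq_nonneg _), Pi.mul_apply]
              congr 1
              ring
            simp_rw [e2]
            rw [lintegral_const_mul _ (Finset.measurable_fun_sum _ fun j _ =>
              (hHj j).const_mul _), lintegral_finsetSum _ fun j _ => (hHj j).const_mul _,
              ENNReal.ofReal_mul hv]
            gcongr
            calc _ ≤ ∑ j, ENNReal.ofReal (u j ^ 2) * ENNReal.ofReal (4 * (β * B) ^ 2) := by
                  refine Finset.sum_le_sum fun j _ => ?_
                  rw [lintegral_const_mul _ (hHj j)]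
                  gcongr
                  exact h.lintegral_sq_hornerProd_le hX hv hvb ha hbB hcb j
              _ = _ := by
                  rw [← Finset.sum_mul, ← ENNReal.ofReal_sum_of_nonneg fun j _ => sq_nonneg _,
                    ← ENNReal.ofReal_mul (Finset.sum_nonneg fun j _ => sq_nonneg _)]
                  congr 1
                  rw [mul_comm, dotProduct]
                  simp_rw [pow_two]
          · refine (ih (c := c') (β := β * B) (fun k _ j => hcb k j) _).trans
              (ENNReal.ofReal_le_ofReal (mul_le_mul_of_nonneg_left huz (by positivity)))
      _ ≤ _ := by
          rw [← ENNReal.ofReal_mul (by positivity), ← ENNReal.ofReal_mul (by positivity),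
            ← ENNReal.ofReal_add (by positivity) (by positivity)]
          refine ENNReal.ofReal_le_ofReal ?_
          have := mul_le_mul_of_nonneg_left hbB
            (show 0 ≤ v * β ^ 2 * B ^ 2 * (u ⬝ᵥ u) by positivity)
          have h3 : 0 ≤ v * β ^ 2 * B ^ 2 * (u ⬝ᵥ u) := by positivity
          nlinarith

end Horner

/-- The derivatives of `ρ` grow at most like those of a function analytic in a strip. -/
def StronglyBounded (ρ : ℝ → ℝ) (B : ℝ) : Prop :=
  ContDiff ℝ (⊤ : ℕ∞) ρ ∧ ∀ n : ℕ, 1 ≤ n → ∀ x : ℝ, |iteratedDeriv n ρ x| ≤ n.factorial * B ^ n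

lemma StronglyBounded.abs_taylor_sub_le {ρ : ℝ → ℝ} {B : ℝ} (h : StronglyBounded ρ B)
    (hB : 0 ≤ B) {b z z₀ : ℝ} (hz : |z - z₀| ≤ b) (K : ℕ) :
    |∑ k ∈ Finset.range (K + 1), iteratedDeriv k ρ z₀ / k.factorial * (z - z₀) ^ k - ρ z| ≤
      (B * b) ^ (K + 1) := by
  have hb : 0 ≤ b := (abs_nonneg _).trans hz
  rcases eq_or_ne z₀ z with rfl | hne
  · rw [Finset.sum_range_succ']
    simp only [sub_self, pow_succ, mul_zero, Finset.sum_const_zero, pow_zero,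
      Nat.factorial_zero, Nat.cast_one, div_one, mul_one, iteratedDeriv_zero, zero_add, abs_zero]
    positivity
  have hu : UniqueDiffOn ℝ (Set.uIcc z₀ z) := uniqueDiffOn_uIcc hne
  obtain ⟨y, -, hy⟩ := taylor_mean_remainder_lagrange_iteratedDeriv (n := K) hne
    (h.1.of_le (by exact_mod_cast le_top)).contDiffOn
  have e : taylorWithinEval ρ K (Set.uIcc z₀ z) z₀ z =
      ∑ k ∈ Finset.range (K + 1), iteratedDeriv k ρ z₀ / k.factorial * (z - z₀) ^ k := by
    rw [taylor_within_apply]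
    refine Finset.sum_congr rfl fun k _ => ?_
    rw [iteratedDerivWithin_eq_iteratedDeriv hu
      (h.1.of_le (by exact_mod_cast le_top)).contDiffAt Set.left_mem_uIcc, smul_eq_mul]
    ring
  rw [← e, abs_sub_comm, hy, abs_div, abs_mul, abs_pow, Nat.abs_cast,
    div_le_iff₀ (by exact_mod_cast Nat.factorial_pos _), mul_pow]
  calc _ ≤ ((K + 1).factorial * B ^ (K + 1)) * b ^ (K + 1) := by
        gcongr
        exact h.2 _ (by omega) y
    _ = _ := by ring

/-- The coordinatewise median. -/
noncomputable def vecMedian {K n : ℕ} (x : Fin K → Fin n → ℝ) : Fin n → ℝ :=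
  fun j => majorityMedian fun i => x i j

lemma measurable_vecMedian {K n : ℕ} : Measurable (vecMedian (K := K) (n := n)) :=
  measurable_pi_lambda _ fun j => measurable_majorityMedian.comp
    (measurable_pi_lambda _ fun i => (measurable_pi_apply j).comp (measurable_pi_apply i))

/-- The Taylor polynomial of `ρ` of degree `K` around `z₀`, in Horner form, with the copies `x i` of
the argument. -/
noncomputable def taylorHorner (ρ : ℝ → ℝ) {K n : ℕ} (z₀ : Fin n → ℝ) (x : Fin K → Fin n → ℝ) :
    Fin n → ℝ :=
  hornerProd K (fun k j => iteratedDeriv k ρ (z₀ j) / k.factorial) (fun i => x i - z₀)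

lemma StronglyBounded.measurable_taylorHorner {ρ : ℝ → ℝ} {B : ℝ} (h : StronglyBounded ρ B)
    {S : Type*} [MeasurableSpace S] {K n : ℕ} {z₀ : S → Fin n → ℝ} {x : S → Fin K → Fin n → ℝ}
    (hz : Measurable z₀) (hx : ∀ i, Measurable fun s => x s i) :
    Measurable fun s => taylorHorner ρ (z₀ s) (x s) := by
  refine measurable_hornerProd (fun k => measurable_pi_lambda _ fun j => ?_)
    fun i => (hx i).sub hz
  exact ((h.1.continuous_iteratedDeriv k (by exact_mod_cast le_top)).measurable.comp
    ((measurable_pi_apply j).comp hz)).div_const _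

lemma StronglyBounded.directionalMSE_taylorHorner {ρ : ℝ → ℝ} {B : ℝ} (h : StronglyBounded ρ B)
    (hB : 0 ≤ B) {Ω : Type*} [MeasurableSpace Ω] {Q : Measure Ω} [IsProbabilityMeasure Q] {n : ℕ}
    {X : Ω → Fin n → ℝ} {z z₀ : Fin n → ℝ} {v b : ℝ} (hX : DirectionalMSE Q X z v)
    (hXm : Measurable X) (hv : 0 ≤ v) (hvb : v ≤ b ^ 2) (ha : ∀ j, |z j - z₀ j| ≤ b)
    (hbB : 16 * b ^ 2 * B ^ 2 ≤ 1) (K : ℕ) :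
    DirectionalMSE (Measure.pi fun _ : Fin K => Q) (fun ω => taylorHorner ρ z₀ fun i => X (ω i))
      (fun j => ρ (z j)) (32 * v * B ^ 2 + 2 * n * (B * b) ^ (2 * (K + 1))) := by
  intro u
  set c : ℕ → Fin n → ℝ := fun k j => iteratedDeriv k ρ (z₀ j) / k.factorial with hc
  have hcb : ∀ k, 1 ≤ k → ∀ j, |c k j| ≤ 1 * B ^ k := by
    intro k hk j
    rw [hc, abs_div, Nat.abs_cast, one_mul,
      div_le_iff₀ (by exact_mod_cast Nat.factorial_pos _), mul_comm]
    exact h.2 k hk _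
  set η := hornerProd K c (fun _ => z - z₀) with hη
  have hd := hX.hornerProd hXm hv hvb ha hbB (K := K) hcb u
  have hT : ∀ j, (η j - ρ (z j)) ^ 2 ≤ (B * b) ^ (2 * (K + 1)) := by
    intro j
    have := h.abs_taylor_sub_le hB (ha j) K
    rw [hη, hornerProd_const, mul_comm 2, pow_mul]
    exact sq_le_sq' (abs_le.1 this).1 (abs_le.1 this).2
  have hbias : (u ⬝ᵥ (η - fun j => ρ (z j))) ^ 2 ≤ n * (B * b) ^ (2 * (K + 1)) * (u ⬝ᵥ u) := by
    have hcs := Finset.sum_mul_sq_le_sq_mul_sq Finset.univ u (η - fun j => ρ (z j))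
    refine hcs.trans ?_
    have e1 : ∑ i, u i ^ 2 = u ⬝ᵥ u := by simp [dotProduct, pow_two]
    rw [e1, mul_comm]
    refine mul_le_mul_of_nonneg_right ?_ (dotProduct_self_real_nonneg u)
    refine (Finset.sum_le_sum fun j _ => hT j).trans ?_
    simp
  have hu := dotProduct_self_real_nonneg u
  have hB2 : 0 ≤ (B * b) ^ (2 * (K + 1)) := by
    rw [pow_mul]
    positivity
  have hm : Measurable fun ω : Fin K → Ω => ENNReal.ofReal
      ((u ⬝ᵥ ((taylorHorner ρ z₀ fun i => X (ω i)) - η)) ^ 2) :=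
    ((measurable_dotProduct measurable_const ((h.measurable_taylorHorner measurable_const
      fun i => hXm.comp (measurable_pi_apply i)).sub_const η)).pow_const 2).ennreal_ofReal
  calc _ ≤ ∫⁻ ω : Fin K → Ω, (ENNReal.ofReal 2 * ENNReal.ofReal
          ((u ⬝ᵥ ((taylorHorner ρ z₀ fun i => X (ω i)) - η)) ^ 2) + ENNReal.ofReal 2 *
          ENNReal.ofReal ((u ⬝ᵥ (η - fun j => ρ (z j))) ^ 2)) ∂(Measure.pi fun _ => Q) := by
        refine lintegral_mono fun ω => ?_
        refine le_trans (le_of_eq ?_) (ofReal_sq_add_le _ _)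
        rw [← dotProduct_add, sub_add_sub_cancel]
    _ ≤ ENNReal.ofReal 2 * ENNReal.ofReal (16 * v * 1 ^ 2 * B ^ 2 * (u ⬝ᵥ u)) +
        ENNReal.ofReal 2 * ENNReal.ofReal (n * (B * b) ^ (2 * (K + 1)) * (u ⬝ᵥ u)) := by
        rw [lintegral_add_right _ measurable_const, lintegral_const, measure_univ, mul_one,
          lintegral_const_mul _ hm]
        gcongr
        exact hd
    _ = _ := by
        rw [← ENNReal.ofReal_mul (by positivity), ← ENNReal.ofReal_mul (by positivity),
          ← ENNReal.ofReal_add (by positivity) (by positivity)]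
        congr 1
        ring

lemma RandomApprox.taylorHorner {ρ : ℝ → ℝ} {B : ℝ} (h : StronglyBounded ρ B)
    (hB : 0 ≤ B) {Ω : Type*} [MeasurableSpace Ω] {Q : Measure Ω} [IsProbabilityMeasure Q] {n : ℕ}
    {Ψ : Ω → Fin n → ℝ} {z : Fin n → ℝ} {v δ b : ℝ} (hΨ : RandomApprox Q Ψ z v δ)
    (hΨm : Measurable Ψ) (hv : 0 ≤ v) (hb : 0 < b) (hvb : 16 * v ≤ b ^ 2)
    (hbB : 16 * b ^ 2 * B ^ 2 ≤ 1) (K : ℕ) :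
    RandomApprox ((Measure.pi fun _ : Fin K => Q).prod (Measure.pi fun _ : Fin K => Q))
      (fun p => _root_.taylorHorner ρ (vecMedian fun i => Ψ (p.1 i)) fun i => Ψ (p.2 i))
      (fun j => ρ (z j)) (32 * v * B ^ 2 + 2 * n * (B * b) ^ (2 * (K + 1)))
      (2 * K * δ + n * (1 / 2) ^ K) := by
  have hmed := hΨ.measureReal_median_le hΨm hb hv hvb K
  obtain ⟨X, hXm, hX, hδ⟩ := hΨ
  set M : (Fin K → Ω) → Fin n → ℝ := fun ω => vecMedian fun i => Ψ (ω i) with hM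
  have hMm : Measurable M := measurable_vecMedian.comp
    (measurable_pi_lambda _ fun i => hΨm.comp (measurable_pi_apply i))
  set z₀ : (Fin K → Ω) → Fin n → ℝ := fun ω j => max (z j - b) (min (z j + b) (M ω j)) with hz₀
  have hz₀m : Measurable z₀ := measurable_pi_lambda _ fun j =>
    measurable_const.max (measurable_const.min ((measurable_pi_apply j).comp hMm))
  have ha : ∀ ω j, |z j - z₀ ω j| ≤ b := by
    intro ω j
    rw [abs_le]
    have h1 : z j - b ≤ z₀ ω j := le_max_left _ _
    have h2 : z₀ ω j ≤ z j + b := max_le (by linarith) (min_le_left _ _)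
    constructor <;> linarith
  have hX'm : Measurable fun p : (Fin K → Ω) × (Fin K → Ω) =>
      _root_.taylorHorner ρ (z₀ p.1) fun i => X (p.2 i) :=
    h.measurable_taylorHorner (hz₀m.comp measurable_fst)
      fun i => hXm.comp ((measurable_pi_apply i).comp measurable_snd)
  refine ⟨_, hX'm, ?_, ?_⟩
  · intro u
    have hm : Measurable fun p : (Fin K → Ω) × (Fin K → Ω) => ENNReal.ofReal ((u ⬝ᵥ
        ((_root_.taylorHorner ρ (z₀ p.1) fun i => X (p.2 i)) - fun j => ρ (z j))) ^ 2) :=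
      ((measurable_dotProduct measurable_const (hX'm.sub_const _)).pow_const 2).ennreal_ofReal
    rw [lintegral_prod _ hm.aemeasurable]
    refine (lintegral_mono fun ω => h.directionalMSE_taylorHorner hB hX hXm hv
      (by linarith) (ha ω) hbB K u).trans ?_
    simp
  · have hs : MeasurableSet {ω | Ψ ω ≠ X ω} := (measurableSet_eq_fun hΨm hXm).compl
    set E₁ : Set (Fin K → Ω) := {ω | ∃ j, b < |majorityMedian (fun i => Ψ (ω i) j) - z j|}
    set E₂ : Set (Fin K → Ω) := {ω | ∃ i, ω i ∈ {ω | Ψ ω ≠ X ω}}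
    have hE₁ : MeasurableSet E₁ := by
      have e : E₁ = ⋃ j, {ω | b < |M ω j - z j|} := by
        ext ω
        simp [E₁, hM, vecMedian]
      rw [e]
      exact MeasurableSet.iUnion fun j => measurableSet_lt measurable_const
        (((measurable_pi_apply j).comp hMm).sub_const _).abs
    have hE₂ : MeasurableSet E₂ := by
      have e : E₂ = ⋃ i, Function.eval i ⁻¹' {ω | Ψ ω ≠ X ω} := by
        ext ω
        simp [E₂]
      rw [e]
      exact MeasurableSet.iUnion fun i => measurable_pi_apply i hs
    have hsub : {p : (Fin K → Ω) × (Fin K → Ω) | (_root_.taylorHorner ρ (M p.1) fun i => Ψ (p.2 i)) ≠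
        _root_.taylorHorner ρ (z₀ p.1) fun i => X (p.2 i)} ⊆
        Prod.fst ⁻¹' E₁ ∪ Prod.snd ⁻¹' E₂ := by
      rintro ⟨ω₁, ω₂⟩ hp
      by_contra hcon
      simp only [Set.mem_union, Set.mem_preimage, not_or, E₁, E₂, Set.mem_ofPred_eq, not_exists,
        not_lt, not_not] at hcon
      obtain ⟨h1, h2⟩ := hcon
      refine hp ?_
      have e1 : z₀ ω₁ = M ω₁ := by
        ext j
        have := abs_le.1 (h1 j)
        have h3 : M ω₁ j = majorityMedian fun i => Ψ (ω₁ i) j := rfl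
        rw [hz₀]
        simp only
        rw [min_eq_right (by linarith), max_eq_right (by linarith)]
      have e2 : (fun i => Ψ (ω₂ i)) = fun i => X (ω₂ i) := funext h2
      simp only [e1, e2]
    refine (measureReal_mono hsub).trans ((measureReal_union_le _ _).trans ?_)
    rw [measurePreserving_fst.measureReal_preimage hE₁.nullMeasurableSet,
      measurePreserving_snd.measureReal_preimage hE₂.nullMeasurableSet]
    have := (measureReal_pi_exists_le (Q := Q) (K := K) hs).trans
      (mul_le_mul_of_nonneg_left hδ (Nat.cast_nonneg K))
    linarith

/-- The family `f` can be estimated by a random function, at relative entropy at most `κ` from a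
reference law, with directional mean square error `v` outside an event of probability `δ`. -/
def HasEstimator {Θ 𝒳 : Type*} [MeasurableSpace 𝒳] {n : ℕ} (f : Θ → 𝒳 → Fin n → ℝ)
    (κ v δ : ℝ) : Prop :=
  ∃ (Ω : Type) (_ : MeasurableSpace Ω) (P : Measure Ω) (Q : Θ → Measure Ω)
    (Ψ : Ω → 𝒳 → Fin n → ℝ), IsProbabilityMeasure P ∧ (∀ θ, IsProbabilityMeasure (Q θ)) ∧
    Measurable (Function.uncurry Ψ) ∧ (∀ θ, EntropyLE (Q θ) P κ) ∧
    ∀ θ x, RandomApprox (Q θ) (fun ω => Ψ ω x) (f θ x) v δ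

/-- The family `f` can be estimated by a random function, at relative entropy at most `κ` from a
reference law, up to `b` in every coordinate outside an event of probability `δ`. -/
def HasUniformEstimator {Θ 𝒳 : Type*} [MeasurableSpace 𝒳] {n : ℕ} (f : Θ → 𝒳 → Fin n → ℝ)
    (κ b δ : ℝ) : Prop :=
  ∃ (Ω : Type) (_ : MeasurableSpace Ω) (P : Measure Ω) (Q : Θ → Measure Ω)
    (Ψ : Ω → 𝒳 → Fin n → ℝ), IsProbabilityMeasure P ∧ (∀ θ, IsProbabilityMeasure (Q θ)) ∧
    Measurable (Function.uncurry Ψ) ∧ (∀ θ, EntropyLE (Q θ) P κ) ∧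
    ∀ θ x, (Q θ).real {ω | ∃ j, b < |Ψ ω x j - f θ x j|} ≤ δ

section Estimators

variable {Θ 𝒳 : Type*} [MeasurableSpace 𝒳] {n : ℕ} {f : Θ → 𝒳 → Fin n → ℝ} {κ v δ : ℝ}

lemma HasEstimator.mono (h : HasEstimator f κ v δ) {κ' v' δ' : ℝ} (hκ : κ ≤ κ') (hv : v ≤ v')
    (hδ : δ ≤ δ') : HasEstimator f κ' v' δ' := by
  obtain ⟨Ω, _, P, Q, Ψ, hP, hQ, hm, hE, hR⟩ := h
  exact ⟨Ω, _, P, Q, Ψ, hP, hQ, hm, fun θ => (hE θ).mono hκ, fun θ x => (hR θ x).mono hv hδ⟩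

lemma HasUniformEstimator.mono {b : ℝ} (h : HasUniformEstimator f κ b δ) {κ' b' δ' : ℝ}
    (hκ : κ ≤ κ') (hb : b ≤ b') (hδ : δ ≤ δ') : HasUniformEstimator f κ' b' δ' := by
  obtain ⟨Ω, _, P, Q, Ψ, hP, hQ, hm, hE, hR⟩ := h
  refine ⟨Ω, _, P, Q, Ψ, hP, hQ, hm, fun θ => (hE θ).mono hκ, fun θ x =>
    (measureReal_mono ?_).trans ((hR θ x).trans hδ)⟩
  rintro ω ⟨j, hj⟩
  exact ⟨j, hb.trans_lt hj⟩

lemma HasEstimator.of_measurable {φ : 𝒳 → Fin n → ℝ} (hφ : Measurable φ) :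
    HasEstimator (fun _ : Θ => φ) 0 0 0 := by
  refine ⟨Unit, inferInstance, Measure.dirac (), fun _ => Measure.dirac (), fun _ => φ,
    inferInstance, fun _ => inferInstance, hφ.comp measurable_snd, fun _ => EntropyLE.refl _,
    fun θ x => ⟨fun _ => φ x, measurable_const, fun u => ?_, ?_⟩⟩
  · simp
  · simp

lemma HasEstimator.gaussian_mulVec (h : HasEstimator f κ v δ) (hv : 0 ≤ v) {a : ℕ}
    (W : Θ → Matrix (Fin a) (Fin n) ℝ) (W₀ : Matrix (Fin a) (Fin n) ℝ) {w V s : ℝ} (hw : 0 ≤ w)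
    (hW : ∀ θ y, ((W θ).mulVec y) ⬝ᵥ ((W θ).mulVec y) ≤ w * (y ⬝ᵥ y))
    (hV : ∀ θ, ∑ i, ∑ j, (W θ - W₀) i j ^ 2 ≤ V) (hs : ∀ θ x, f θ x ⬝ᵥ f θ x ≤ s)
    {τ : NNReal} (hτ : τ ≠ 0) :
    HasEstimator (fun θ x => (W θ).mulVec (f θ x)) (κ + V / (2 * τ))
      (2 * w * v + 4 * τ * (s + n * v)) δ := by
  obtain ⟨Ω, _, P, Q, Ψ, hP, hQ, hm, hE, hR⟩ := h
  refine ⟨Ω × (Fin a → Fin n → ℝ), inferInstance, P.prod (gaussianMatrix W₀ τ),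
    fun θ => (Q θ).prod (gaussianMatrix (W θ) τ), fun p x => (Matrix.of p.2).mulVec (Ψ p.1 x),
    inferInstance, fun θ => inferInstance, ?_, fun θ => ?_, fun θ x => ?_⟩
  · exact measurable_mulVec_of
      (g := fun q : (Ω × (Fin a → Fin n → ℝ)) × 𝒳 => q.1.2)
      (X := fun q : (Ω × (Fin a → Fin n → ℝ)) × 𝒳 => Ψ q.1.1 q.2) (by fun_prop)
      (hm.comp ((measurable_fst.comp measurable_fst).prodMk measurable_snd))
  · refine (hE θ).prod ((EntropyLE.gaussianMatrix (W θ) W₀ hτ).mono ?_)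
    gcongr
    exact hV θ
  · refine ((hR θ x).gaussian_mulVec (hm.comp measurable_prodMk_right) hv hw (hW θ) τ).mono ?_
      le_rfl
    gcongr
    exact hs θ x

lemma HasEstimator.taylorHorner (h : HasEstimator f κ v δ) {ρ : ℝ → ℝ} {B : ℝ}
    (hρ : StronglyBounded ρ B) (hB : 0 ≤ B) (hv : 0 ≤ v) {b : ℝ} (hb : 0 < b)
    (hvb : 16 * v ≤ b ^ 2) (hbB : 16 * b ^ 2 * B ^ 2 ≤ 1) (K : ℕ) :
    HasEstimator (fun θ x j => ρ (f θ x j)) (2 * K * κ)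
      (32 * v * B ^ 2 + 2 * n * (B * b) ^ (2 * (K + 1))) (2 * K * δ + n * (1 / 2) ^ K) := by
  obtain ⟨Ω, _, P, Q, Ψ, hP, hQ, hm, hE, hR⟩ := h
  have hΨ : ∀ i : Fin K, Measurable fun q : ((Fin K → Ω) × (Fin K → Ω)) × 𝒳 => Ψ (q.1.1 i) q.2 :=
    fun i =>
      hm.comp (f := fun q : ((Fin K → Ω) × (Fin K → Ω)) × 𝒳 => (q.1.1 i, q.2)) (by fun_prop)
  have hΨ' : ∀ i : Fin K, Measurable fun q : ((Fin K → Ω) × (Fin K → Ω)) × 𝒳 => Ψ (q.1.2 i) q.2 :=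
    fun i =>
      hm.comp (f := fun q : ((Fin K → Ω) × (Fin K → Ω)) × 𝒳 => (q.1.2 i, q.2)) (by fun_prop)
  refine ⟨(Fin K → Ω) × (Fin K → Ω), inferInstance,
    (Measure.pi fun _ => P).prod (Measure.pi fun _ => P),
    fun θ => (Measure.pi fun _ => Q θ).prod (Measure.pi fun _ => Q θ),
    fun p x => _root_.taylorHorner ρ (vecMedian fun i => Ψ (p.1 i) x) fun i => Ψ (p.2 i) x,
    inferInstance, fun θ => inferInstance, ?_, fun θ => ?_, fun θ x => ?_⟩
  · exact hρ.measurable_taylorHorner (measurable_vecMedian.comp (measurable_pi_lambda _ hΨ)) hΨ'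
  · have hpi := EntropyLE.pi (n := K) fun _ => hE θ
    refine (hpi.prod hpi).mono (le_of_eq ?_)
    simp
    ring
  · exact (hR θ x).taylorHorner hρ hB (hm.comp measurable_prodMk_right) hv hb hvb hbB K

lemma HasEstimator.uniform (h : HasEstimator f κ v δ) (hv : 0 ≤ v) {b : ℝ} (hb : 0 < b)
    (hvb : 16 * v ≤ b ^ 2) (K : ℕ) :
    HasUniformEstimator f (K * κ) b (K * δ + n * (1 / 2) ^ K) := by
  obtain ⟨Ω, _, P, Q, Ψ, hP, hQ, hm, hE, hR⟩ := h
  refine ⟨Fin K → Ω, inferInstance, Measure.pi fun _ => P, fun θ => Measure.pi fun _ => Q θ,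
    fun p x => vecMedian fun i => Ψ (p i) x, inferInstance, fun θ => inferInstance, ?_,
    fun θ => ?_, fun θ x => ?_⟩
  · exact measurable_vecMedian.comp (measurable_pi_lambda _ fun i =>
      hm.comp (f := fun q : (Fin K → Ω) × 𝒳 => (q.1 i, q.2)) (by fun_prop))
  · refine (EntropyLE.pi (n := K) fun _ => hE θ).mono (le_of_eq ?_)
    simp
  · exact (hR θ x).measureReal_median_le (hm.comp measurable_prodMk_right) hb hv hvb K

end Estimators

lemma StronglyBounded.sq_le {ρ : ℝ → ℝ} {β : ℝ} (h : StronglyBounded ρ β) (hβ : 0 ≤ β) (z : ℝ) :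
    ρ z ^ 2 ≤ 2 * ρ 0 ^ 2 + 2 * β ^ 2 * z ^ 2 := by
  have h1 := h.abs_taylor_sub_le hβ (z := z) (z₀ := 0) (b := |z|) (by simp) 0
  simp only [zero_add, Finset.range_one, Finset.sum_singleton, iteratedDeriv_zero,
    Nat.factorial_zero, Nat.cast_one, div_one, pow_zero, mul_one, pow_one] at h1
  have h2 : (ρ 0 - ρ z) ^ 2 ≤ (β * |z|) ^ 2 := sq_le_sq' (abs_le.1 h1).1 (abs_le.1 h1).2
  rw [mul_pow, sq_abs] at h2
  nlinarith [sq_nonneg (2 * ρ 0 - ρ z)]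

lemma StronglyBounded.exists_chainAct_le {ρ : ℝ → ℝ} {β : ℝ} (h : StronglyBounded ρ β)
    (hβ : 0 ≤ β) {w : ℝ} (hw : 0 ≤ w) (i : ℕ) :
    ∃ s : ℝ, 0 < s ∧ ∀ (dims : ℕ → ℕ) (d : ℕ)
      (W : ∀ i : ℕ, Matrix (Fin (dims (i + 1))) (Fin (dims i)) ℝ),
      (∀ j ≤ i, dims j ≤ d) →
      (∀ j < i, ∀ y, ((W j).mulVec y) ⬝ᵥ ((W j).mulVec y) ≤ w * (y ⬝ᵥ y)) →
      ∀ x : Fin (dims 0) → ℝ, x ⬝ᵥ x ≤ d →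
        chainAct dims ρ W i x ⬝ᵥ chainAct dims ρ W i x ≤ s * d := by
  induction i with
  | zero =>
    exact ⟨1, one_pos, fun dims d W _ _ x hx => by simpa [chainAct] using hx⟩
  | succ i ih =>
    obtain ⟨s, hs, H⟩ := ih
    refine ⟨2 * ρ 0 ^ 2 + 2 * β ^ 2 * (w * s) + 1, by positivity, fun dims d W hd hW x hx => ?_⟩
    have h1 := H dims d W (fun j hj => hd j (by omega)) (fun j hj => hW j (by omega)) x hx
    have h2 := hW i (by omega) (chainAct dims ρ W i x)
    have h3 := mul_le_mul_of_nonneg_left h1 hw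
    have h4 : (dims (i + 1) : ℝ) ≤ d := by exact_mod_cast hd (i + 1) le_rfl
    set z := (W i).mulVec (chainAct dims ρ W i x) with hz
    calc chainAct dims ρ W (i + 1) x ⬝ᵥ chainAct dims ρ W (i + 1) x
        = ∑ j, ρ (z j) ^ 2 := by simp [dotProduct, chainAct, pow_two, hz]
      _ ≤ ∑ j, (2 * ρ 0 ^ 2 + 2 * β ^ 2 * z j ^ 2) :=
          Finset.sum_le_sum fun j _ => h.sq_le hβ (z j)
      _ = dims (i + 1) * (2 * ρ 0 ^ 2) + 2 * β ^ 2 * (z ⬝ᵥ z) := by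
          rw [Finset.sum_add_distrib, Finset.sum_const, Finset.card_univ, Fintype.card_fin,
            nsmul_eq_mul, dotProduct, Finset.mul_sum]
          simp only [pow_two]
      _ ≤ d * (2 * ρ 0 ^ 2) + 2 * β ^ 2 * (w * (s * d)) := by
          gcongr
          exact h2.trans h3
      _ ≤ _ := by
          have : (0 : ℝ) ≤ d := Nat.cast_nonneg d
          linarith

lemma HasEstimator.linear_layer {Θ 𝒳 : Type*} [MeasurableSpace 𝒳] {n : ℕ}
    {f : Θ → 𝒳 → Fin n → ℝ} {κ A q δ : ℝ} (h : HasEstimator f κ (A * q) δ) (hA : 0 ≤ A)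
    (hq : 0 < q) (hq1 : q ≤ 1) {a d : ℕ} (hd : 1 ≤ d) (hn : n ≤ d)
    (W : Θ → Matrix (Fin a) (Fin n) ℝ) (W₀ : Matrix (Fin a) (Fin n) ℝ) {w V s : ℝ} (hw : 0 ≤ w)
    (hW : ∀ θ y, ((W θ).mulVec y) ⬝ᵥ ((W θ).mulVec y) ≤ w * (y ⬝ᵥ y))
    (hV : ∀ θ, ∑ i, ∑ j, (W θ - W₀) i j ^ 2 ≤ V)
    (hs : ∀ θ x, f θ x ⬝ᵥ f θ x ≤ s * d) :
    HasEstimator (fun θ x => (W θ).mulVec (f θ x)) (κ + d * V / q)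
      ((2 * w * A + 4 * s + 4 * A) * q) δ := by
  have hd' : (0 : ℝ) < d := by exact_mod_cast hd
  have hn' : (n : ℝ) ≤ d := by exact_mod_cast hn
  rcases isEmpty_or_nonempty Θ with hΘ | ⟨⟨θ⟩⟩
  · exact ⟨Unit, inferInstance, Measure.dirac (), fun θ => hΘ.elim θ, fun _ _ => 0, inferInstance,
      fun θ => hΘ.elim θ, measurable_const, fun θ => hΘ.elim θ, fun θ => hΘ.elim θ⟩
  have hV0 : 0 ≤ V := le_trans
    (Finset.sum_nonneg fun i _ => Finset.sum_nonneg fun j _ => sq_nonneg _) (hV θ)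
  have hτ : (q / d).toNNReal ≠ 0 := by
    rw [Ne, Real.toNNReal_eq_zero, not_le]
    positivity
  refine (h.gaussian_mulVec (by positivity) W W₀ hw hW hV hs hτ).mono ?_ ?_ le_rfl
  · rw [Real.coe_toNNReal _ (by positivity)]
    have : V / (2 * (q / d)) = (d * V / q) / 2 := by
      field_simp
    have h0 : 0 ≤ d * V / q := by positivity
    linarith
  · rw [Real.coe_toNNReal _ (by positivity)]
    have h1 : 4 * (q / d) * (s * d + n * (A * q)) = 4 * s * q + 4 * A * q * (q * (n / d)) := by
      field_simp
    have h2 : q * (n / d) ≤ 1 :=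
      mul_le_one₀ hq1 (by positivity) ((div_le_one hd').2 hn')
    have h3 := mul_le_mul_of_nonneg_left h2 (show 0 ≤ 4 * A * q by positivity)
    rw [h1]
    linarith

lemma StronglyBounded.exists_chainAct_estimator {ρ : ℝ → ℝ} {β : ℝ} (h : StronglyBounded ρ β)
    (hβ : 0 < β) {w : ℝ} (hw : 0 ≤ w) (i : ℕ) :
    ∃ A e : ℝ, 0 < A ∧ 0 < e ∧ e ≤ 1 ∧ ∀ (dims : ℕ → ℕ) (d : ℕ), 1 ≤ d → (∀ j ≤ i, dims j ≤ d) →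
      ∀ {Θ 𝒳 : Type} [MeasurableSpace 𝒳]
        (W : Θ → ∀ i : ℕ, Matrix (Fin (dims (i + 1))) (Fin (dims i)) ℝ)
        (W₀ : ∀ i : ℕ, Matrix (Fin (dims (i + 1))) (Fin (dims i)) ℝ) (V : ℝ), 0 ≤ V →
        (∀ j < i, ∀ θ y, ((W θ j).mulVec y) ⬝ᵥ ((W θ j).mulVec y) ≤ w * (y ⬝ᵥ y)) →
        (∀ j < i, ∀ θ, ∑ k, ∑ l, (W θ j - W₀ j) k l ^ 2 ≤ V) →
      ∀ φ : 𝒳 → Fin (dims 0) → ℝ, Measurable φ → (∀ x, φ x ⬝ᵥ φ x ≤ d) →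
      ∀ K : ℕ, 1 ≤ K → ∀ q : ℝ, 0 < q → q ≤ e → d ≤ q * 16 ^ K →
        HasEstimator (fun θ x => chainAct dims ρ (W θ) i (φ x)) (A * K ^ i * (d * V / q)) (A * q)
          (A * K ^ i * (d * (1 / 2) ^ K)) := by
  induction i with
  | zero =>
    refine ⟨1, 1, one_pos, one_pos, le_rfl, fun dims d hd hdim Θ 𝒳 _ W W₀ V hV _ _ φ hφ hx K hK q
      hq hqe hdq => (HasEstimator.of_measurable hφ).mono ?_ ?_ ?_⟩ <;> positivity
  | succ i ih =>
    obtain ⟨A, e, hA, he, he1, H⟩ := ih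
    obtain ⟨s, hs, hsb⟩ := h.exists_chainAct_le hβ.le hw i
    set A₁ := 2 * w * A + 4 * s + 4 * A with hA₁
    have hA₁0 : 0 < A₁ := by positivity
    refine ⟨32 * A₁ * β ^ 2 + 2 + 2 * (A + 1), min e (1 / (256 * A₁ * β ^ 2)), by positivity,
      lt_min he (by positivity), (min_le_left _ _).trans he1, fun dims d hd hdim Θ 𝒳 _ W W₀ V hV
      hW hWV φ hφ hx K hK q hq hqe hdq => ?_⟩
    have hqe' := hqe.trans (min_le_left _ _)
    have hqβ : 256 * A₁ * β ^ 2 * q ≤ 1 := by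
      have := hqe.trans (min_le_right _ _)
      rw [le_div_iff₀ (by positivity)] at this
      linarith
    have hK' : (1 : ℝ) ≤ K := by exact_mod_cast hK
    have hdn : (dims (i + 1) : ℝ) ≤ d := by exact_mod_cast hdim (i + 1) le_rfl
    have h1 := H dims d hd (fun j hj => hdim j (by omega)) W W₀ V hV (fun j hj => hW j (by omega))
      (fun j hj => hWV j (by omega)) φ hφ hx K hK q hq hqe' hdq
    have h2 := h1.linear_layer hA.le hq (hqe'.trans he1) hd (hdim i (by omega)) (fun θ => W θ i)
      (W₀ i) hw (hW i (by omega)) (hWV i (by omega)) fun θ x =>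
        hsb dims d (W θ) (fun j hj => hdim j (by omega)) (fun j hj => hW j (by omega) θ) (φ x) (hx x)
    have hb2 : (4 * √(A₁ * q)) ^ 2 = 16 * (A₁ * q) := by
      rw [mul_pow, Real.sq_sqrt (by positivity)]
      norm_num
    have h3 := h2.taylorHorner h hβ.le (by positivity) (b := 4 * √(A₁ * q)) (by positivity)
      hb2.ge (by rw [hb2]; linarith) K
    refine h3.mono ?_ ?_ ?_
    · have hKi : (1 : ℝ) ≤ K ^ i := one_le_pow₀ hK'
      have h0 : 0 ≤ d * V / q := by positivity
      have h4 : 0 ≤ (K * (d * V / q)) * (K ^ i - 1) :=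
        mul_nonneg (by positivity) (by linarith)
      have h5 : 0 ≤ (32 * A₁ * β ^ 2 + 2) * (K ^ i * K * (d * V / q)) := by positivity
      rw [pow_succ (K : ℝ) i]
      linarith
    · have h6 : (β * (4 * √(A₁ * q))) ^ (2 * (K + 1)) ≤ (1 / 16) ^ K := by
        rw [pow_mul, mul_pow, hb2]
        calc _ ≤ (1 / 16 : ℝ) ^ (K + 1) := by
              gcongr
              linarith
          _ ≤ (1 / 16 : ℝ) ^ K := pow_le_pow_of_le_one (by norm_num) (by norm_num) (by omega)
      have h7 : (dims (i + 1) : ℝ) * (β * (4 * √(A₁ * q))) ^ (2 * (K + 1)) ≤ q := by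
        calc _ ≤ (d : ℝ) * (1 / 16) ^ K := by gcongr
          _ ≤ q * 16 ^ K * (1 / 16) ^ K := by gcongr
          _ = q := by rw [mul_assoc, ← mul_pow]; norm_num
      have h8 : 0 ≤ 2 * (A + 1) * q := by positivity
      linarith
    · have hKi : (1 : ℝ) ≤ K ^ i * K := by
        rw [← pow_succ]
        exact one_le_pow₀ hK'
      have h0 : (0 : ℝ) ≤ d * (1 / 2) ^ K := by positivity
      have h4 : 0 ≤ (d * (1 / 2) ^ K) * ((K : ℝ) ^ i * K - 1) :=
        mul_nonneg (by positivity) (by linarith)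
      have h5 : 0 ≤ (32 * A₁ * β ^ 2 + 2) * ((K : ℝ) ^ i * K * (d * (1 / 2) ^ K)) := by positivity
      have h6 : (dims (i + 1) : ℝ) * (1 / 2) ^ K ≤ d * (1 / 2) ^ K := by gcongr
      rw [pow_succ (K : ℝ) i]
      linarith

lemma StronglyBounded.exists_network_estimator {ρ : ℝ → ℝ} {β : ℝ} (h : StronglyBounded ρ β)
    (hβ : 0 < β) {w : ℝ} (hw : 0 ≤ w) {t : ℕ} (ht : 1 ≤ t) :
    ∃ A e : ℝ, 0 < A ∧ 0 < e ∧ e ≤ 1 ∧ ∀ (dims : ℕ → ℕ) (d : ℕ), 1 ≤ d → (∀ j ≤ t, dims j ≤ d) →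
      ∀ {Θ 𝒳 : Type} [MeasurableSpace 𝒳]
        (W : Θ → ∀ i : ℕ, Matrix (Fin (dims (i + 1))) (Fin (dims i)) ℝ)
        (W₀ : ∀ i : ℕ, Matrix (Fin (dims (i + 1))) (Fin (dims i)) ℝ) (V : ℝ), 0 ≤ V →
        (∀ j < t, ∀ θ y, ((W θ j).mulVec y) ⬝ᵥ ((W θ j).mulVec y) ≤ w * (y ⬝ᵥ y)) →
        (∀ j < t, ∀ θ, ∑ k, ∑ l, (W θ j - W₀ j) k l ^ 2 ≤ V) →
      ∀ φ : 𝒳 → Fin (dims 0) → ℝ, Measurable φ → (∀ x, φ x ⬝ᵥ φ x ≤ d) →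
      ∀ K : ℕ, 1 ≤ K → ∀ ε : ℝ, 0 < ε → ε ≤ e → d ≤ ε ^ 2 * 16 ^ K →
        HasUniformEstimator (fun θ x => network dims ρ (W θ) t (φ x))
          (A * K ^ t * (d * V / ε ^ 2)) (A * ε) (A * K ^ t * (d * (1 / 2) ^ K)) := by
  obtain ⟨i, rfl⟩ := Nat.exists_eq_add_of_le' ht
  obtain ⟨A, e, hA, he, he1, H⟩ := h.exists_chainAct_estimator hβ hw i
  obtain ⟨s, hs, hsb⟩ := h.exists_chainAct_le hβ.le hw i
  set A₁ := 2 * w * A + 4 * s + 4 * A with hA₁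
  have hA₁0 : 0 < A₁ := by positivity
  refine ⟨A + 1 + 4 * √A₁, e, by positivity, he, he1, fun dims d hd hdim Θ 𝒳 _ W W₀ V hV
      hW hWV φ hφ hx K hK ε hε hεe hdε => ?_⟩
  have hε2 : ε ^ 2 ≤ e := by nlinarith
  have hK' : (1 : ℝ) ≤ K := by exact_mod_cast hK
  have hdn : (dims (i + 1) : ℝ) ≤ d := by exact_mod_cast hdim (i + 1) le_rfl
  have h1 := H dims d hd (fun j hj => hdim j (by omega)) W W₀ V hV (fun j hj => hW j (by omega))
    (fun j hj => hWV j (by omega)) φ hφ hx K hK (ε ^ 2) (by positivity) hε2 hdε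
  have h2 := h1.linear_layer hA.le (by positivity) (hε2.trans he1) hd (hdim i (by omega))
    (fun θ => W θ i)
    (W₀ i) hw (hW i (by omega)) (hWV i (by omega)) fun θ x =>
      hsb dims d (W θ) (fun j hj => hdim j (by omega)) (fun j hj => hW j (by omega) θ) (φ x) (hx x)
  have h3 := h2.uniform (by positivity) (b := 4 * √A₁ * ε) (by positivity)
    (by rw [mul_pow, mul_pow, Real.sq_sqrt hA₁0.le]; linarith) K
  refine h3.mono ?_ ?_ ?_
  · have hKi : (1 : ℝ) ≤ K ^ i := one_le_pow₀ hK'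
    have h0 : 0 ≤ d * V / ε ^ 2 := by positivity
    have h4 : 0 ≤ (K * (d * V / ε ^ 2)) * (K ^ i - 1) :=
      mul_nonneg (by positivity) (by linarith)
    have h5 : 0 ≤ 4 * √A₁ * (K ^ i * K * (d * V / ε ^ 2)) := by positivity
    rw [pow_succ (K : ℝ) i]
    linarith
  · gcongr
    linarith
  · have hKi : (1 : ℝ) ≤ K ^ i * K := by
      rw [← pow_succ]
      exact one_le_pow₀ hK'
    have h0 : (0 : ℝ) ≤ d * (1 / 2) ^ K := by positivity
    have h4 : 0 ≤ (d * (1 / 2) ^ K) * ((K : ℝ) ^ i * K - 1) :=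
      mul_nonneg (by positivity) (by linarith)
    have h5 : 0 ≤ 4 * √A₁ * ((K : ℝ) ^ i * K * (d * (1 / 2) ^ K)) := by positivity
    have h6 : (dims (i + 1) : ℝ) * (1 / 2) ^ K ≤ d * (1 / 2) ^ K := by gcongr
    rw [pow_succ (K : ℝ) i]
    linarith

/-- The class `u` has a measurable envelope for its generalization gaps, of mean at most `c`. -/
def GapBound {Θ 𝒬 : Type*} [MeasurableSpace 𝒬] (D : Measure 𝒬) (m : ℕ) (u : Θ → 𝒬 → ℝ)
    (c : ℝ) : Prop :=
  ∃ Z : (Fin m → 𝒬) → ℝ, Integrable Z (Measure.pi fun _ => D) ∧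
    ∫ S, Z S ∂(Measure.pi fun _ => D) ≤ c ∧
    ∀ θ S, ∫ q, u θ q ∂D - (∑ i, u θ (S i)) / m ≤ Z S

section Gaps

variable {Θ 𝒬 : Type*} [MeasurableSpace 𝒬] {D : Measure 𝒬} {m : ℕ}

lemma GapBound.mono {u : Θ → 𝒬 → ℝ} {c c' : ℝ} (hu : GapBound D m u c) (hc : c ≤ c') :
    GapBound D m u c' := by
  obtain ⟨Z, hZ, hZc, hZu⟩ := hu
  exact ⟨Z, hZ, hZc.trans hc, hZu⟩

lemma GapBound.add {u v : Θ → 𝒬 → ℝ} {c c' : ℝ} (hu : GapBound D m u c) (hv : GapBound D m v c')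
    (hui : ∀ θ, Integrable (u θ) D) (hvi : ∀ θ, Integrable (v θ) D) :
    GapBound D m (fun θ q => u θ q + v θ q) (c + c') := by
  obtain ⟨Z, hZ, hZc, hZu⟩ := hu
  obtain ⟨Z', hZ', hZc', hZv⟩ := hv
  refine ⟨fun S => Z S + Z' S, hZ.add hZ', ?_, fun θ S => ?_⟩
  · rw [integral_add hZ hZ']
    exact add_le_add hZc hZc'
  · rw [integral_add (hui θ) (hvi θ), Finset.sum_add_distrib, add_div]
    linarith [hZu θ S, hZv θ S]

variable [IsProbabilityMeasure D]

lemma GapBound.of_abs_sub_le {u v : Θ → 𝒬 → ℝ} {c η : ℝ} (hu : GapBound D m u c)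
    (hui : ∀ θ, Integrable (u θ) D) (hvi : ∀ θ, Integrable (v θ) D)
    (h : ∀ θ q, |v θ q - u θ q| ≤ η) (hm : 0 < m) : GapBound D m v (c + 2 * η) := by
  obtain ⟨Z, hZ, hZc, hZu⟩ := hu
  have hm' : (0 : ℝ) < m := by exact_mod_cast hm
  refine ⟨fun S => Z S + 2 * η, hZ.add (integrable_const _), ?_, fun θ S => ?_⟩
  · rw [integral_add hZ (integrable_const _)]
    simp
    linarith
  · have h1 : ∫ q, v θ q ∂D ≤ ∫ q, (u θ q + η) ∂D :=
      integral_mono (hvi θ) ((hui θ).add (integrable_const _)) fun q => by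
        linarith [(abs_le.1 (h θ q)).2]
    rw [integral_add (hui θ) (integrable_const _)] at h1
    have h2 : ∑ i, (u θ (S i) - η) ≤ ∑ i, v θ (S i) :=
      Finset.sum_le_sum fun i _ => by linarith [(abs_le.1 (h θ (S i))).1]
    rw [Finset.sum_sub_distrib] at h2
    simp at h1 h2
    have h3 : (∑ i, u θ (S i)) / m - η ≤ (∑ i, v θ (S i)) / m := by
      rw [div_sub' hm'.ne', div_le_div_iff_of_pos_right hm']
      linarith
    linarith [hZu θ S]

lemma GapBound.of_entropyLE {Ω : Type*} [MeasurableSpace Ω] {P : Measure Ω}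
    [IsProbabilityMeasure P] {Q : Θ → Measure Ω} [∀ θ, IsProbabilityMeasure (Q θ)]
    {κ : ℝ} (hκ : 0 < κ) (hQ : ∀ θ, EntropyLE (Q θ) P κ)
    {g : Ω → 𝒬 → ℝ} (hg : Measurable (Function.uncurry g)) {β : ℝ} (hβ : 0 < β)
    (hgβ : ∀ ω q, |g ω q| ≤ β) (hm : 0 < m) :
    GapBound D m (fun θ q => ∫ ω, g ω q ∂(Q θ)) (2 * β * Real.sqrt (κ / m)) := by
  obtain ⟨Z, hZ, hZc, hZQ⟩ := exists_integral_gap_le hκ hQ hg hβ hgβ D hm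
  refine ⟨Z, hZ, hZc, fun θ S => le_trans (le_of_eq ?_) (hZQ θ S)⟩
  have hgi : ∀ q, Integrable (fun ω => g ω q) (Q θ) := fun q =>
    integrable_of_abs_le (hg.comp measurable_prodMk_right) fun ω => hgβ ω q
  have hgp : Integrable (Function.uncurry g) ((Q θ).prod D) :=
    integrable_of_abs_le hg fun p => hgβ p.1 p.2
  have hI : Integrable (fun ω => ∫ q, g ω q ∂D) (Q θ) := hgp.integral_prod_left
  have hs : Integrable (fun ω => (∑ i, g ω (S i)) / m) (Q θ) :=
    (integrable_finsetSum _ fun i _ => hgi (S i)).div_const _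
  rw [integral_sub hI hs, integral_div, integral_finsetSum _ fun i _ => hgi (S i),
    integral_integral_swap hgp]

end Gaps

/-- `Ψ ω` is a randomized approximation of `h θ` when `ω` has law `Q θ`, up to `b` off an event of
probability `δ`, with values in `[0, M]` and entropy cost `κ`. -/
structure IsLossEstimator {Θ Ω 𝒬 : Type*} [MeasurableSpace Ω] [MeasurableSpace 𝒬] (P : Measure Ω)
    (Q : Θ → Measure Ω) (Ψ : Ω → 𝒬 → ℝ) (h : Θ → 𝒬 → ℝ) (M κ b δ : ℝ) : Prop where
  prob : IsProbabilityMeasure P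
  prob' : ∀ θ, IsProbabilityMeasure (Q θ)
  measurable : Measurable (Function.uncurry Ψ)
  mem_Icc : ∀ ω q, Ψ ω q ∈ Set.Icc 0 M
  entropyLE : ∀ θ, EntropyLE (Q θ) P κ
  measureReal_le : ∀ θ q, (Q θ).real {ω | b < |Ψ ω q - h θ q|} ≤ δ

lemma abs_integral_sub_le_of_measureReal_le {Ω : Type*} [MeasurableSpace Ω] {Q : Measure Ω}
    [IsProbabilityMeasure Q] {u : Ω → ℝ} (hu : Measurable u) {M b δ a : ℝ} (hb : 0 ≤ b)
    (hM : ∀ ω, |u ω - a| ≤ M) (hδ : Q.real {ω | b < |u ω - a|} ≤ δ) :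
    |∫ ω, u ω ∂Q - a| ≤ b + M * δ := by
  have hM0 : 0 ≤ M := by
    obtain ⟨ω⟩ : Nonempty Ω := Q.nonempty_of_neZero
    exact (abs_nonneg _).trans (hM ω)
  have hd : Measurable fun ω => u ω - a := hu.sub_const a
  have hE : MeasurableSet {ω | b < |u ω - a|} := measurableSet_lt measurable_const hd.abs
  have hui : Integrable u Q := integrable_of_abs_le (C := M + |a|) hu fun ω => by
    have := abs_add_le (u ω - a) a
    rw [sub_add_cancel] at this
    linarith [hM ω]
  have h1 : ∫ ω, u ω ∂Q - a = ∫ ω, (u ω - a) ∂Q := by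
    rw [integral_sub hui (integrable_const _)]
    simp
  have hind : Integrable (fun ω => {ω | b < |u ω - a|}.indicator (fun _ => M) ω) Q :=
    (integrable_const M).indicator hE
  calc |∫ ω, u ω ∂Q - a| ≤ ∫ ω, |u ω - a| ∂Q := by
        rw [h1]
        exact abs_integral_le_integral_abs
    _ ≤ ∫ ω, (b + {ω | b < |u ω - a|}.indicator (fun _ => M) ω) ∂Q := by
        refine integral_mono (integrable_of_abs_le hd.abs fun ω => by simpa using hM ω)
          ((integrable_const b).add hind) fun ω => ?_
        by_cases hω : b < |u ω - a|
        · simp only [Set.indicator, Set.mem_ofPred_eq, hω, if_true]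
          linarith [hM ω]
        · simp only [Set.indicator, Set.mem_ofPred_eq, hω, if_false]
          linarith
    _ = b + Q.real {ω | b < |u ω - a|} * M := by
        rw [integral_add (integrable_const _) hind, integral_indicator_const _ hE]
        simp
    _ ≤ b + M * δ := by nlinarith

section Chaining

variable {Θ 𝒬 Ω Ω' : Type*} [MeasurableSpace 𝒬] [MeasurableSpace Ω] [MeasurableSpace Ω']
  {D : Measure 𝒬} [IsProbabilityMeasure D] {m : ℕ} {h : Θ → 𝒬 → ℝ} {M κ b δ κ' b' δ' : ℝ}
  {P : Measure Ω} {Q : Θ → Measure Ω} {Ψ : Ω → 𝒬 → ℝ}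
  {P' : Measure Ω'} {Q' : Θ → Measure Ω'} {Ψ' : Ω' → 𝒬 → ℝ}

lemma IsLossEstimator.integrable_integral (H : IsLossEstimator P Q Ψ h M κ b δ) (θ : Θ) :
    Integrable (fun q => ∫ ω, Ψ ω q ∂(Q θ)) D := by
  have := H.prob' θ
  have : Integrable (Function.uncurry Ψ) ((Q θ).prod D) :=
    integrable_of_abs_le (C := M) H.measurable fun p => by
      rw [Function.uncurry, abs_of_nonneg (H.mem_Icc _ _).1]
      exact (H.mem_Icc _ _).2
  exact this.integral_prod_right

lemma IsLossEstimator.gapBound (H : IsLossEstimator P Q Ψ h M κ b δ) (hM : 0 < M) (hκ : 0 < κ)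
    (hm : 0 < m) :
    GapBound D m (fun θ q => ∫ ω, Ψ ω q ∂(Q θ)) (2 * M * Real.sqrt (κ / m)) := by
  have := H.prob
  have := H.prob'
  exact GapBound.of_entropyLE hκ H.entropyLE H.measurable hM (fun ω q => by
    rw [abs_of_nonneg (H.mem_Icc _ _).1]
    exact (H.mem_Icc _ _).2) hm

lemma IsLossEstimator.gapBound_of_gapBound (H : IsLossEstimator P Q Ψ h M κ b δ)
    (H' : IsLossEstimator P' Q' Ψ' h M κ' b' δ') {c β : ℝ}
    (hc : GapBound D m (fun θ q => ∫ ω, Ψ ω q ∂(Q θ)) c) (hκ : 0 < κ + κ') (hβ : 0 < β)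
    (hb : b + b' ≤ β) (hM : 0 ≤ M) (hm : 0 < m) :
    GapBound D m (fun θ q => ∫ ω, Ψ' ω q ∂(Q' θ))
      (c + 2 * β * Real.sqrt ((κ + κ') / m) + 2 * (M * (δ + δ'))) := by
  have := H.prob
  have := H.prob'
  have := H'.prob
  have := H'.prob'
  set F : Ω × Ω' → 𝒬 → ℝ := fun p q => Ψ' p.2 q - Ψ p.1 q with hF
  have hFm : Measurable (Function.uncurry F) :=
    (H'.measurable.comp (f := fun p : (Ω × Ω') × 𝒬 => (p.1.2, p.2)) (by fun_prop)).sub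
      (H.measurable.comp (f := fun p : (Ω × Ω') × 𝒬 => (p.1.1, p.2)) (by fun_prop))
  have hFM : ∀ p q, |F p q| ≤ M := fun p q => by
    have h1 := H.mem_Icc p.1 q
    have h2 := H'.mem_Icc p.2 q
    rw [abs_le]
    constructor <;> simp only [hF] <;> linarith [h1.1, h1.2, h2.1, h2.2]
  set g : Ω × Ω' → 𝒬 → ℝ := fun p q => max (-β) (min β (F p q)) with hg
  have hgm : Measurable (Function.uncurry g) :=
    measurable_const.max (measurable_const.min hFm)
  have hgβ : ∀ p q, |g p q| ≤ β := fun p q => by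
    rw [abs_le]
    exact ⟨le_max_left _ _, max_le (by linarith) (min_le_left _ _)⟩
  have key : GapBound D m (fun θ q => ∫ p, g p q ∂((Q θ).prod (Q' θ)))
      (2 * β * Real.sqrt ((κ + κ') / m)) :=
    GapBound.of_entropyLE hκ (fun θ => (H.entropyLE θ).prod (H'.entropyLE θ)) hgm hβ hgβ hm
  have hgi : ∀ θ, Integrable (fun q => ∫ p, g p q ∂((Q θ).prod (Q' θ))) D := fun θ => by
    have : Integrable (Function.uncurry g) (((Q θ).prod (Q' θ)).prod D) :=
      integrable_of_abs_le hgm fun p => hgβ p.1 p.2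
    exact this.integral_prod_right
  refine (hc.add key H.integrable_integral hgi).of_abs_sub_le
    (fun θ => (H.integrable_integral θ).add (hgi θ)) H'.integrable_integral (fun θ q => ?_) hm
  have hΨi : Integrable (fun ω => Ψ ω q) (Q θ) :=
    integrable_of_abs_le (C := M) (H.measurable.comp measurable_prodMk_right) fun ω => by
      rw [abs_of_nonneg (H.mem_Icc _ _).1]
      exact (H.mem_Icc _ _).2
  have hΨi' : Integrable (fun ω => Ψ' ω q) (Q' θ) :=
    integrable_of_abs_le (C := M) (H'.measurable.comp measurable_prodMk_right) fun ω => by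
      rw [abs_of_nonneg (H'.mem_Icc _ _).1]
      exact (H'.mem_Icc _ _).2
  have hFi : Integrable (fun p => F p q) ((Q θ).prod (Q' θ)) :=
    integrable_of_abs_le (hFm.comp measurable_prodMk_right) fun p => hFM p q
  have hgi' : Integrable (fun p => g p q) ((Q θ).prod (Q' θ)) :=
    integrable_of_abs_le (hgm.comp measurable_prodMk_right) fun p => hgβ p q
  have hFint : ∫ p, F p q ∂((Q θ).prod (Q' θ)) =
      ∫ ω, Ψ' ω q ∂(Q' θ) - ∫ ω, Ψ ω q ∂(Q θ) := by
    have e1 := integral_fun_fst (μ := Q θ) (ν := Q' θ) (f := fun ω => Ψ ω q)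
    have e2 := integral_fun_snd (μ := Q θ) (ν := Q' θ) (f := fun ω => Ψ' ω q)
    simp only [hF]
    rw [integral_sub (hΨi'.comp_snd _) (hΨi.comp_fst _), e1, e2]
    simp
  rw [show ∫ ω, Ψ' ω q ∂(Q' θ) - (∫ ω, Ψ ω q ∂(Q θ) + ∫ p, g p q ∂((Q θ).prod (Q' θ))) =
    ∫ p, (F p q - g p q) ∂((Q θ).prod (Q' θ)) - 0 by rw [integral_sub hFi hgi', hFint]; ring]
  have hsub : ∀ p, F p q - g p q ≠ 0 → β < |F p q| := fun p hp => by
    by_contra! hle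
    have := abs_le.1 hle
    exact hp (by simp only [hg]; rw [min_eq_right this.2, max_eq_right this.1, sub_self])
  have hle : ∀ p, |F p q - g p q - 0| ≤ M := fun p => by
    have h1 := abs_le.1 (hFM p q)
    rw [sub_zero, abs_le]
    simp only [hg]
    rcases le_total β (F p q) with h2 | h2
    · rw [min_eq_left h2, max_eq_right (by linarith)]
      constructor <;> linarith
    · rw [min_eq_right h2]
      rcases le_total (-β) (F p q) with h3 | h3
      · rw [max_eq_right h3]
        constructor <;> linarith
      · rw [max_eq_left h3]
        constructor <;> linarith
  have hδ : ((Q θ).prod (Q' θ)).real {p | 0 < |F p q - g p q - 0|} ≤ δ + δ' := by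
    have hms : MeasurableSet {ω | b < |Ψ ω q - h θ q|} := measurableSet_lt measurable_const
      ((H.measurable.comp measurable_prodMk_right).sub_const _).abs
    have hms' : MeasurableSet {ω | b' < |Ψ' ω q - h θ q|} := measurableSet_lt measurable_const
      ((H'.measurable.comp measurable_prodMk_right).sub_const _).abs
    have hs : {p | 0 < |F p q - g p q - 0|} ⊆
        Prod.fst ⁻¹' {ω | b < |Ψ ω q - h θ q|} ∪
          Prod.snd ⁻¹' {ω | b' < |Ψ' ω q - h θ q|} := fun p hp => by
      rw [Set.mem_ofPred_eq, sub_zero, abs_pos] at hp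
      have h1 := hsub p hp
      by_contra! hn
      simp only [Set.mem_union, Set.mem_preimage, Set.mem_ofPred_eq, not_or, not_lt] at hn
      have h2 : |F p q| ≤ |Ψ' p.2 q - h θ q| + |Ψ p.1 q - h θ q| := by
        have := abs_sub (Ψ' p.2 q - h θ q) (Ψ p.1 q - h θ q)
        rwa [sub_sub_sub_cancel_right] at this
      linarith [hn.1, hn.2]
    refine (measureReal_mono hs).trans ((measureReal_union_le _ _).trans (add_le_add ?_ ?_))
    · rw [measurePreserving_fst.measureReal_preimage hms.nullMeasurableSet]
      exact H.measureReal_le θ q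
    · rw [measurePreserving_snd.measureReal_preimage hms'.nullMeasurableSet]
      exact H'.measureReal_le θ q
  have := abs_integral_sub_le_of_measureReal_le (Q := (Q θ).prod (Q' θ))
    ((hFm.comp measurable_prodMk_right).sub (hgm.comp measurable_prodMk_right)) le_rfl hle hδ
  simpa using this

lemma IsLossEstimator.gapBound_loss (H : IsLossEstimator P Q Ψ h M κ b δ) {c : ℝ}
    (hc : GapBound D m (fun θ q => ∫ ω, Ψ ω q ∂(Q θ)) c) (hb : 0 ≤ b)
    (hh : ∀ θ, Measurable (h θ)) (hhM : ∀ θ q, h θ q ∈ Set.Icc 0 M) (hm : 0 < m) :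
    GapBound D m h (c + 2 * (b + M * δ)) := by
  have := H.prob'
  refine hc.of_abs_sub_le H.integrable_integral (fun θ => integrable_of_abs_le (C := M) (hh θ)
    fun q => ?_) (fun θ q => ?_) hm
  · rw [abs_of_nonneg (hhM _ _).1]
    exact (hhM _ _).2
  · rw [abs_sub_comm]
    refine abs_integral_sub_le_of_measureReal_le (H.measurable.comp measurable_prodMk_right) hb
      (fun ω => ?_) (H.measureReal_le θ q)
    have h1 := H.mem_Icc ω q
    have h2 := hhM θ q
    rw [abs_le]
    constructor <;> simp <;> linarith [h1.1, h1.2, h2.1, h2.2]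

end Chaining

lemma exists_gapBound_chain {Θ 𝒬 : Type*} [MeasurableSpace 𝒬] {D : Measure 𝒬}
    [IsProbabilityMeasure D] {m : ℕ} (hm : 0 < m) {h : Θ → 𝒬 → ℝ} {M v a e δ : ℝ} (hM : 0 < M)
    (hv : 0 < v) (ha : 0 < a) (he : 0 < e) (N : ℕ)
    (H : ∀ k ≤ N, ∃ (Ω : Type) (_ : MeasurableSpace Ω) (P : Measure Ω) (Q : Θ → Measure Ω)
      (Ψ : Ω → 𝒬 → ℝ), IsLossEstimator P Q Ψ h M (v / (e * (1 / 2) ^ k) ^ 2)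
        (a * (e * (1 / 2) ^ k)) δ) :
    ∃ (Ω : Type) (_ : MeasurableSpace Ω) (P : Measure Ω) (Q : Θ → Measure Ω)
      (Ψ : Ω → 𝒬 → ℝ), IsLossEstimator P Q Ψ h M (v / (e * (1 / 2) ^ N) ^ 2)
        (a * (e * (1 / 2) ^ N)) δ ∧
      GapBound D m (fun θ q => ∫ ω, Ψ ω q ∂(Q θ))
        (2 * M * √(v / e ^ 2 / m) + N * (4 * a * √(5 * v / m) + 4 * M * δ)) := by
  induction N with
  | zero =>
    obtain ⟨Ω, _, P, Q, Ψ, hE⟩ := H 0 le_rfl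
    refine ⟨Ω, _, P, Q, Ψ, hE, ?_⟩
    have := hE.gapBound (D := D) hM (by positivity) hm
    simpa using this
  | succ N ih =>
    obtain ⟨Ω, _, P, Q, Ψ, hE, hG⟩ := ih fun k hk => H k (by omega)
    obtain ⟨Ω', _, P', Q', Ψ', hE'⟩ := H (N + 1) le_rfl
    refine ⟨Ω', _, P', Q', Ψ', hE', ?_⟩
    set ε : ℝ := e * (1 / 2) ^ N with hε
    have hε0 : 0 < ε := by positivity
    have hε' : e * (1 / 2) ^ (N + 1) = ε / 2 := by rw [hε, pow_succ (1 / 2 : ℝ) N]; ring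
    rw [hε'] at hE'
    have key := hE.gapBound_of_gapBound hE' (β := 2 * a * ε) hG (by positivity) (by positivity)
      (by nlinarith [mul_pos ha hε0]) hM.le hm
    have hm' : (0 : ℝ) < m := by exact_mod_cast hm
    have hs : √((v / ε ^ 2 + v / (ε / 2) ^ 2) / m) = √(5 * v / m) / ε := by
      rw [show (v / ε ^ 2 + v / (ε / 2) ^ 2) / m = 5 * v / m / ε ^ 2 by field_simp; norm_num,
        Real.sqrt_div (by positivity), Real.sqrt_sq hε0.le]
    rw [hs] at key
    convert key using 1
    push_cast
    field_simp
    ring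

lemma HasUniformEstimator.exists_isLossEstimator {Θ 𝒳 Y : Type*} [MeasurableSpace 𝒳]
    [MeasurableSpace Y] {n : ℕ} {f : Θ → 𝒳 → Fin n → ℝ} {κ b δ : ℝ}
    (h : HasUniformEstimator f κ b δ) {ℓ : (Fin n → ℝ) → Y → ℝ} {M : ℝ} (hM : 0 ≤ M) (hb : 0 ≤ b)
    (hℓ : Measurable fun q : (Fin n → ℝ) × Y => ℓ q.1 q.2) (hℓM : ∀ z y, ℓ z y ∈ Set.Icc 0 M)
    (hLip : ∀ y z z', |ℓ z y - ℓ z' y| ≤ M * supNorm (z - z')) :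
    ∃ (Ω : Type) (_ : MeasurableSpace Ω) (P : Measure Ω) (Q : Θ → Measure Ω)
      (Ψ : Ω → 𝒳 × Y → ℝ), IsLossEstimator P Q Ψ (fun θ q => ℓ (f θ q.1) q.2) M κ (M * b) δ := by
  obtain ⟨Ω, _, P, Q, Ψ, hP, hQ, hm, hE, hR⟩ := h
  refine ⟨Ω, _, P, Q, fun ω q => ℓ (Ψ ω q.1) q.2, hP, hQ, ?_, fun ω q => hℓM _ _, hE,
    fun θ q => (measureReal_mono ?_).trans (hR θ q.1)⟩
  · exact hℓ.comp (f := fun p : Ω × 𝒳 × Y => (Ψ p.1 p.2.1, p.2.2))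
      ((hm.comp (f := fun p : Ω × 𝒳 × Y => (p.1, p.2.1)) (by fun_prop)).prodMk (by fun_prop))
  · intro ω hω
    rw [Set.mem_ofPred_eq] at hω ⊢
    by_contra! hn
    refine (hω.trans_le (hLip _ _ _)).not_ge (mul_le_mul_of_nonneg_left ?_ hM)
    exact Real.iSup_le hn hb

lemma measurable_network {dims : ℕ → ℕ} {ρ : ℝ → ℝ} (hρ : Continuous ρ)
    (W : ∀ i : ℕ, Matrix (Fin (dims (i + 1))) (Fin (dims i)) ℝ) (t : ℕ) :
    Measurable (network dims ρ W t) := by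
  have hc : ∀ s, Continuous (chainAct dims ρ W s) := fun s => by
    induction s with
    | zero => exact continuous_id
    | succ s ih =>
      exact continuous_pi fun j =>
        hρ.comp ((continuous_apply j).comp (continuous_const.matrix_mulVec ih))
  cases t with
  | zero => exact measurable_id
  | succ s => exact (continuous_const.matrix_mulVec (hc s)).measurable

lemma euclNorm_sq {n : ℕ} (v : Fin n → ℝ) : euclNorm v ^ 2 = v ⬝ᵥ v := by
  rw [euclNorm, Real.sq_sqrt (Finset.sum_nonneg fun _ _ => sq_nonneg _)]
  simp [dotProduct, sq]

lemma dotProduct_self_mulVec_le {a n : ℕ} {W W₀ : Matrix (Fin a) (Fin n) ℝ} {r : ℝ}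
    (h₀ : ∀ y, euclNorm (W₀.mulVec y) ≤ r * euclNorm y)
    (h : ∀ y, euclNorm ((W - W₀).mulVec y) ≤ r * euclNorm y) (y : Fin n → ℝ) :
    (W.mulVec y) ⬝ᵥ (W.mulVec y) ≤ 4 * r ^ 2 * (y ⬝ᵥ y) := by
  have hsq : ∀ {u : Fin a → ℝ}, euclNorm u ≤ r * euclNorm y → u ⬝ᵥ u ≤ r ^ 2 * (y ⬝ᵥ y) :=
    fun {u} hu => by
      rw [← euclNorm_sq, ← euclNorm_sq, ← mul_pow]
      exact pow_le_pow_left₀ (Real.sqrt_nonneg _) hu 2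
  have h1 := hsq (h₀ y)
  have h2 := hsq (h y)
  have h3 : W.mulVec y = W₀.mulVec y + (W - W₀).mulVec y := by
    rw [← Matrix.add_mulVec, add_sub_cancel]
  have h4 : ∀ u v : Fin a → ℝ, (u + v) ⬝ᵥ (u + v) ≤ 2 * (u ⬝ᵥ u) + 2 * (v ⬝ᵥ v) := fun u v => by
    simp only [dotProduct, Finset.mul_sum, ← Finset.sum_add_distrib, Pi.add_apply]
    exact Finset.sum_le_sum fun i _ => by nlinarith [sq_nonneg (u i - v i)]
  rw [h3]
  linarith [h4 (W₀.mulVec y) ((W - W₀).mulVec y)]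

lemma integral_sSup_le_of_gapBound {Θ 𝒬 : Type*} [MeasurableSpace 𝒬] {D : Measure 𝒬}
    {m : ℕ} {u : Θ → 𝒬 → ℝ} {c : ℝ} (hu : GapBound D m u c) (hc : 0 ≤ c)
    [Nonempty Θ] :
    ∫ S : Fin m → 𝒬, sSup (Set.range fun θ => ∫ q, u θ q ∂D - (∑ i, u θ (S i)) / (m : ℝ))
      ∂(Measure.pi fun _ => D) ≤ c := by
  obtain ⟨Z, hZ, hZc, hZu⟩ := hu
  by_cases hi : Integrable (fun S : Fin m → 𝒬 =>
      sSup (Set.range fun θ => ∫ q, u θ q ∂D - (∑ i, u θ (S i)) / (m : ℝ)))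
      (Measure.pi fun _ => D)
  · refine (integral_mono hi hZ fun S => ?_).trans hZc
    refine csSup_le (Set.range_nonempty _) ?_
    rintro _ ⟨θ, rfl⟩
    exact hZu θ S
  · rw [integral_undef hi]
    exact hc

/-- The number of dyadic scales used at resolution `1 / x`. -/
lemma exists_dyadic_scale (e : ℝ) :
    ∃ c : ℝ, 0 < c ∧ ∀ n : ℕ, 4 ≤ n → ∃ N : ℕ, 1 ≤ N ∧ (n : ℝ) ≤ 2 ^ N ∧ 1 / e ≤ 2 ^ N ∧
      (N : ℝ) ≤ c * Real.log n := by
  obtain ⟨N₂, hN₂⟩ := pow_unbounded_of_one_lt (1 / e) (one_lt_two (α := ℝ))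
  refine ⟨N₂ + 3, by positivity, fun n hn => ?_⟩
  have hn' : (4 : ℝ) ≤ n := by exact_mod_cast hn
  have hl2 := Real.log_two_gt_d9
  have hlog4 : Real.log 4 = 2 * Real.log 2 := by
    rw [show (4 : ℝ) = 2 ^ 2 by norm_num, Real.log_pow]
    norm_num
  have hlog : 1 ≤ Real.log n := by
    have := Real.log_le_log (by norm_num) hn'
    linarith
  have h1 : n < 2 ^ (Nat.log 2 n + 1) := Nat.lt_pow_succ_log_self (by norm_num) n
  have h1' : (n : ℝ) ≤ 2 ^ (Nat.log 2 n + 1) := by exact_mod_cast h1.le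
  have h2 : 2 ^ Nat.log 2 n ≤ n := Nat.pow_log_le_self 2 (by omega)
  have h2' : (2 : ℝ) ^ Nat.log 2 n ≤ n := by exact_mod_cast h2
  have h3 : (Nat.log 2 n : ℝ) * Real.log 2 ≤ Real.log n := by
    rw [← Real.log_pow]
    exact Real.log_le_log (by positivity) h2'
  have h4 : (Nat.log 2 n : ℝ) ≤ 2 * Real.log n := by
    have : (0 : ℝ) ≤ Nat.log 2 n := Nat.cast_nonneg _
    nlinarith
  refine ⟨Nat.log 2 n + 1 + N₂, by omega, ?_, ?_, ?_⟩
  · exact h1'.trans (pow_le_pow_right₀ (by norm_num) (by omega))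
  · exact hN₂.le.trans (pow_le_pow_right₀ (by norm_num) (by omega))
  · push_cast
    have : (N₂ : ℝ) ≤ N₂ * Real.log n := le_mul_of_one_le_right (Nat.cast_nonneg _) hlog
    linarith

lemma chain_total_le_aux {A e M X u δ : ℝ} {t N : ℕ} (hA : 0 < A) (he : 0 < e) (he1 : e ≤ 1)
    (hM : 0 < M) (hX : 0 ≤ X) (hN : 1 ≤ N) (hu : u ≤ X)
    (hδ : δ ≤ A * (2 * N) ^ t * X) :
    2 * M * (√(A * (2 * N) ^ t) * X / e) +
      N * (4 * (M * A) * (√(5 * (A * (2 * N) ^ t)) * X) + 4 * M * δ) +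
      2 * (M * A * (e * u) + M * δ) ≤
    (2 * √A / e + 4 * A * √(5 * A) + 8 * A) * 2 ^ t * M * X * N ^ (t + 1) := by
  have hN' : (1 : ℝ) ≤ N := by exact_mod_cast hN
  set k : ℝ := (2 * N) ^ t with hk
  have hk1 : 1 ≤ k := one_le_pow₀ (by linarith)
  have hsk : √k ≤ k := by
    rw [Real.sqrt_le_left (by linarith)]
    nlinarith
  have h1 : √(A * k) ≤ √A * k := by
    rw [Real.sqrt_mul hA.le]
    exact mul_le_mul_of_nonneg_left hsk (Real.sqrt_nonneg _)
  have h2 : √(5 * (A * k)) ≤ √(5 * A) * k := by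
    rw [← mul_assoc, Real.sqrt_mul (by positivity)]
    exact mul_le_mul_of_nonneg_left hsk (Real.sqrt_nonneg _)
  have hkN : (2 : ℝ) ^ t * N ^ (t + 1) = N * k := by
    rw [hk, mul_pow, pow_succ (N : ℝ) t]
    ring
  have hkNk : k ≤ N * k := le_mul_of_one_le_left (by linarith) hN'
  have hNk1 : 1 ≤ N * k := hk1.trans hkNk
  have e1 : 2 * M * (√(A * k) * X / e) ≤ 2 * M * (√A * (N * k) * X / e) := by
    gcongr
    exact h1.trans (by gcongr)
  have e2 : N * (4 * (M * A) * (√(5 * (A * k)) * X) + 4 * M * δ) ≤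
      N * (4 * (M * A) * (√(5 * A) * k * X) + 4 * M * (A * k * X)) := by
    gcongr
  have e3 : 2 * (M * A * (e * u) + M * δ) ≤
      2 * (M * A * (N * k * X) + M * (A * (N * k) * X)) := by
    have : e * u ≤ N * k * X := calc
      e * u ≤ e * X := by gcongr
      _ ≤ 1 * X := by gcongr
      _ ≤ N * k * X := by gcongr
    have h4 : δ ≤ A * (N * k) * X := hδ.trans (by gcongr)
    gcongr
  calc _ ≤ 2 * M * (√A * (N * k) * X / e) +
        N * (4 * (M * A) * (√(5 * A) * k * X) + 4 * M * (A * k * X)) +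
        2 * (M * A * (N * k * X) + M * (A * (N * k) * X)) := by linarith
    _ = (2 * √A / e + 4 * A * √(5 * A) + 8 * A) * (N * k) * M * X := by ring
    _ = _ := by rw [← hkN]; ring

lemma le_sq_mul_sixteen_pow {e d : ℝ} {N k : ℕ} (he : 0 < e) (heN : 1 / e ≤ 2 ^ N)
    (h2 : d ≤ 2 ^ N) (hk : k ≤ N) : d ≤ (e * (1 / 2) ^ k) ^ 2 * 16 ^ (2 * N) := by
  have h1 : 1 ≤ e * (1 / 2) ^ k * 2 ^ N * 2 ^ N := calc
    (1 : ℝ) ≤ e * 2 ^ N := by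
      rwa [div_le_iff₀ he, mul_comm] at heN
    _ = e * (1 / 2) ^ N * 2 ^ N * 2 ^ N := by
      rw [mul_assoc e, ← mul_pow]
      norm_num
    _ ≤ e * (1 / 2) ^ k * 2 ^ N * 2 ^ N := by
      gcongr ?_ * _ * _
      exact mul_le_mul_of_nonneg_left
        (pow_le_pow_of_le_one (by norm_num) (by norm_num) hk) he.le
  calc d ≤ 1 ^ 2 * ((2 : ℝ) ^ N) ^ 4 := by
        have h3 : (1 : ℝ) ≤ 2 ^ N := one_le_pow₀ (by norm_num)
        rw [one_pow, one_mul]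
        exact h2.trans (le_self_pow₀ h3 (by norm_num))
    _ ≤ (e * (1 / 2) ^ k * 2 ^ N * 2 ^ N) ^ 2 * ((2 : ℝ) ^ N) ^ 4 := by gcongr
    _ = (e * (1 / 2) ^ k) ^ 2 * 16 ^ (2 * N) := by
        have h4 : (16 : ℝ) ^ (2 * N) = (2 ^ N) ^ 8 := by
          rw [show (16 : ℝ) = 2 ^ 4 by norm_num, ← pow_mul, ← pow_mul]
          congr 1
          ring
        rw [h4]
        ring

lemma chain_total_le {A e M d m R v δ : ℝ} {t N : ℕ} (hA : 0 < A) (he : 0 < e) (he1 : e ≤ 1)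
    (hM : 0 < M) (hd' : 2 ≤ d) (hm' : 2 ≤ m) (hR : 1 ≤ R) (hN : 1 ≤ N) (hdmN : d * m ≤ 2 ^ N)
    (hv : v = A * (2 * N) ^ t * (d * R ^ 2))
    (hδ : δ = A * (2 * N) ^ t * (d * (1 / 2) ^ (2 * N))) :
    2 * M * √(v / e ^ 2 / m) + N * (4 * (M * A) * √(5 * v / m) + 4 * M * δ) +
      2 * (M * A * (e * (1 / 2) ^ N) + M * δ) ≤
    (2 * √A / e + 4 * A * √(5 * A) + 8 * A) * 2 ^ t * M * √(d * R ^ 2 / m) * N ^ (t + 1) := by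
  have hv0 : 0 ≤ v := by rw [hv]; positivity
  set X : ℝ := √(d * R ^ 2 / m) with hX
  have hX0 : 0 ≤ X := Real.sqrt_nonneg _
  have hmX : 1 / (m : ℝ) ≤ X := by
    refine Real.le_sqrt_of_sq_le ?_
    rw [div_pow, one_pow, div_le_div_iff₀ (by positivity) (by positivity)]
    have hR2 : 1 ≤ R ^ 2 := one_le_pow₀ hR
    have h1 : (1 : ℝ) ≤ d * R ^ 2 := by nlinarith
    have h2 : (m : ℝ) ≤ m ^ 2 := by nlinarith
    nlinarith
  have hhalf : (1 / 2 : ℝ) ^ N ≤ 1 / (d * m) := by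
    rw [one_div_pow]
    exact one_div_le_one_div_of_le (by positivity) hdmN
  have hu : (1 / 2 : ℝ) ^ N ≤ X := by
    refine hhalf.trans (le_trans ?_ hmX)
    exact one_div_le_one_div_of_le (by positivity) (by nlinarith)
  have hδX : δ ≤ A * (2 * N) ^ t * X := by
    rw [hδ]
    refine mul_le_mul_of_nonneg_left (le_trans ?_ hu) (by positivity)
    have h1 : d * (1 / 2) ^ N ≤ 1 := by
      refine (mul_le_mul_of_nonneg_left hhalf (by positivity)).trans ?_
      rw [mul_one_div, div_le_one (by positivity)]
      nlinarith
    calc d * (1 / 2) ^ (2 * N) = (d * (1 / 2) ^ N) * (1 / 2) ^ N := by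
          rw [two_mul, pow_add]
          ring
      _ ≤ 1 * (1 / 2) ^ N := by gcongr
      _ = _ := one_mul _
  have hs1 : √(v / e ^ 2 / m) = √(A * (2 * N) ^ t) * X / e := by
    rw [hX, ← Real.sqrt_mul (by positivity), eq_div_iff he.ne']
    nth_rewrite 2 [← Real.sqrt_sq he.le]
    rw [← Real.sqrt_mul (by positivity), hv]
    congr 1
    field_simp
  have hs2 : √(5 * v / m) = √(5 * (A * (2 * N) ^ t)) * X := by
    rw [hX, ← Real.sqrt_mul (by positivity), hv]
    congr 1
    ring
  rw [hs1, hs2]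
  exact chain_total_le_aux hA he he1 hM hX0 hN hu hδX

theorem deep_network_sample_complexity
    (t : ℕ) (ht : 1 ≤ t) (r : ℝ) (hr : 0 < r) (ρ : ℝ → ℝ)
    (hρ : ∃ B : ℝ, 0 < B ∧ ContDiff ℝ (⊤ : ℕ∞) ρ ∧
      ∀ n : ℕ, 1 ≤ n → ∀ x : ℝ, |iteratedDeriv n ρ x| ≤ n.factorial * B ^ n) :
    ∃ C : ℝ, 0 < C ∧ ∃ p : ℝ, 0 < p ∧
    ∀ dims : ℕ → ℕ, (∀ i ≤ t, 1 ≤ dims i) →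
    ∀ d : ℕ, d = (Finset.range (t + 1)).sup dims → 2 ≤ d →
    ∀ W0 : ∀ i : ℕ, Matrix (Fin (dims (i + 1))) (Fin (dims i)) ℝ,
      (∀ i < t, ∀ y : Fin (dims i) → ℝ, euclNorm ((W0 i).mulVec y) ≤ r * euclNorm y) →
    ∀ R : ℝ, 1 ≤ R →
    ∀ (Y : Type) [MeasurableSpace Y],
    ∀ B L : ℝ, 0 ≤ B → 0 ≤ L →
    ∀ ℓ : (Fin (dims t) → ℝ) → Y → ℝ,
      Measurable (fun q : (Fin (dims t) → ℝ) × Y => ℓ q.1 q.2) →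
      (∀ z y, ℓ z y ∈ Set.Icc 0 B) →
      (∀ y z z', |ℓ z y - ℓ z' y| ≤ L * supNorm (z - z')) →
    ∀ D : Measure ({x : Fin (dims 0) → ℝ // euclNorm x ≤ Real.sqrt d} × Y),
      IsProbabilityMeasure D →
    ∀ m : ℕ, 2 ≤ m →
    (∫ S : Fin m → {x : Fin (dims 0) → ℝ // euclNorm x ≤ Real.sqrt d} × Y,
        sSup {z : ℝ |
          ∃ W : ∀ i : ℕ, Matrix (Fin (dims (i + 1))) (Fin (dims i)) ℝ,
            (∀ i < t,
              (∀ y : Fin (dims i) → ℝ,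
                euclNorm ((W i - W0 i).mulVec y) ≤ r * euclNorm y) ∧
              Real.sqrt (∑ a, ∑ b, (W i - W0 i) a b ^ 2) ≤ R) ∧
            z = (∫ q, ℓ (network dims ρ W t q.1.val) q.2 ∂D)
              - (∑ i, ℓ (network dims ρ W t ((S i).1).val) (S i).2) / (m : ℝ)}
        ∂(Measure.pi fun _ => D))
      ≤ C * (L + B) * Real.sqrt (d * R ^ 2 / m) * Real.log (d * m) ^ p := by
  obtain ⟨β, hβ, hρ⟩ := hρ
  have hρ' : StronglyBounded ρ β := hρ
  obtain ⟨A, e, hA, he, he1, hest⟩ :=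
    hρ'.exists_network_estimator hβ (w := 4 * r ^ 2) (by positivity) ht
  obtain ⟨c, hc, hscale⟩ := exists_dyadic_scale e
  set C₀ : ℝ := 2 * √A / e + 4 * A * √(5 * A) + 8 * A with hC₀
  have hC₀' : 0 < C₀ := by positivity
  refine ⟨C₀ * 2 ^ t * c ^ (t + 1), by positivity, ((t + 1 : ℕ) : ℝ), by positivity, ?_⟩
  intro dims hdims d hd hd2 W0 hW0 R hR Y _ B L hB hL ℓ hℓ hℓB hℓL D hD m hm
  have hdm : 4 ≤ d * m := Nat.mul_le_mul hd2 hm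
  have hd' : (2 : ℝ) ≤ d := by exact_mod_cast hd2
  have hm' : (2 : ℝ) ≤ m := by exact_mod_cast hm
  have hlog : 0 ≤ Real.log (d * m) := Real.log_nonneg (by nlinarith)
  rw [Real.rpow_natCast]
  rcases (add_nonneg hL hB).eq_or_lt with hM | hM
  · have hB0 : B = 0 := by linarith
    have hℓ0 : ∀ z y, ℓ z y = 0 := fun z y =>
      le_antisymm ((hℓB z y).2.trans hB0.le) (hℓB z y).1
    rw [← hM, mul_zero, zero_mul, zero_mul]
    refine integral_nonpos fun S => Real.sSup_nonpos ?_
    rintro z ⟨W, -, rfl⟩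
    simp [hℓ0]
  set M := L + B with hMdef
  obtain ⟨N, hN, hdmN, heN, hNc⟩ := hscale (d * m) hdm
  push_cast at hdmN hNc
  let Θ := {W : ∀ i : ℕ, Matrix (Fin (dims (i + 1))) (Fin (dims i)) ℝ // ∀ i < t,
    (∀ y : Fin (dims i) → ℝ, euclNorm ((W i - W0 i).mulVec y) ≤ r * euclNorm y) ∧
      Real.sqrt (∑ a, ∑ b, (W i - W0 i) a b ^ 2) ≤ R}
  have hΘ : Nonempty Θ := ⟨W0, fun i _ => ⟨fun y => by
    simpa [euclNorm] using mul_nonneg hr.le (Real.sqrt_nonneg _), by simp; linarith⟩⟩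
  set h : Θ → {x : Fin (dims 0) → ℝ // euclNorm x ≤ Real.sqrt d} × Y → ℝ :=
    fun θ q => ℓ (network dims ρ θ.1 t q.1.val) q.2 with hh
  set K : ℕ := 2 * N with hK
  set v : ℝ := A * (2 * N) ^ t * (d * R ^ 2) with hv
  set δ : ℝ := A * (2 * N) ^ t * (d * (1 / 2) ^ K) with hδ
  have hN' : (1 : ℝ) ≤ N := by exact_mod_cast hN
  have hℓM : ∀ z y, ℓ z y ∈ Set.Icc 0 M := fun z y =>
    ⟨(hℓB z y).1, (hℓB z y).2.trans (by linarith)⟩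
  have hLip : ∀ y z z', |ℓ z y - ℓ z' y| ≤ M * supNorm (z - z') := fun y z z' =>
    (hℓL y z z').trans (mul_le_mul_of_nonneg_right (by linarith)
      (Real.iSup_nonneg fun _ => abs_nonneg _))
  have hlevel : ∀ k ≤ N, ∃ (Ω : Type) (_ : MeasurableSpace Ω) (P : Measure Ω)
      (Q : Θ → Measure Ω) (Ψ : Ω → _ × Y → ℝ), IsLossEstimator P Q Ψ h M
        (v / (e * (1 / 2) ^ k) ^ 2) (M * A * (e * (1 / 2) ^ k)) δ := by
    intro k hk
    have hε : 0 < e * (1 / 2) ^ k := by positivity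
    have hεe : e * (1 / 2) ^ k ≤ e :=
      mul_le_of_le_one_right he.le (pow_le_one₀ (by norm_num) (by norm_num))
    have hεK : (d : ℝ) ≤ (e * (1 / 2) ^ k) ^ 2 * 16 ^ K :=
      le_sq_mul_sixteen_pow he heN (by nlinarith) hk
    have hφ : ∀ x : {x : Fin (dims 0) → ℝ // euclNorm x ≤ Real.sqrt d},
        x.val ⬝ᵥ x.val ≤ (d : ℝ) := fun x => by
      rw [← euclNorm_sq]
      exact (pow_le_pow_left₀ (Real.sqrt_nonneg _) x.2 2).trans_eq (Real.sq_sqrt (by positivity))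
    have key := hest dims d (by omega)
      (fun j hj => hd ▸ Finset.le_sup (f := dims) (Finset.mem_range.2 (by omega)))
      (fun θ : Θ => θ.1) W0 (R ^ 2) (sq_nonneg R)
      (fun j hj θ y => dotProduct_self_mulVec_le (hW0 j hj) (θ.2 j hj).1 y)
      (fun j hj θ => (Real.sqrt_le_left (by linarith)).1 (θ.2 j hj).2)
      Subtype.val measurable_subtype_coe hφ K (by omega) _ hε hεe hεK
    obtain ⟨Ω, _, P, Q, Ψ, hE⟩ :=
      key.exists_isLossEstimator hM.le (by positivity) hℓ hℓM hLip
    refine ⟨Ω, _, P, Q, Ψ, ?_⟩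
    convert hE using 1
    · rw [hv, hK]
      push_cast
      ring
    · ring
    · rw [hδ, hK]
      push_cast
      ring
  have hm0 : 0 < m := by omega
  have hv0 : 0 < v := by positivity
  obtain ⟨Ω, _, P, Q, Ψ, hE, hG⟩ :=
    exists_gapBound_chain (D := D) hm0 hM hv0 (mul_pos hM hA) he N hlevel
  have hhm : ∀ θ, Measurable (h θ) := fun θ =>
    hℓ.comp (f := fun q : {x : Fin (dims 0) → ℝ // euclNorm x ≤ Real.sqrt d} × Y =>
      (network dims ρ θ.1 t q.1.val, q.2))
      (((measurable_network hρ'.1.continuous θ.1 t).comp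
        (measurable_subtype_coe.comp measurable_fst)).prodMk measurable_snd)
  have hgap := hE.gapBound_loss hG (by positivity) hhm (fun θ q => hℓM _ _) hm0
  have hset : ∀ S : Fin m → {x : Fin (dims 0) → ℝ // euclNorm x ≤ Real.sqrt d} × Y,
      {z : ℝ | ∃ W : ∀ i : ℕ, Matrix (Fin (dims (i + 1))) (Fin (dims i)) ℝ,
        (∀ i < t, (∀ y : Fin (dims i) → ℝ,
          euclNorm ((W i - W0 i).mulVec y) ≤ r * euclNorm y) ∧
          Real.sqrt (∑ a, ∑ b, (W i - W0 i) a b ^ 2) ≤ R) ∧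
        z = (∫ q, ℓ (network dims ρ W t q.1.val) q.2 ∂D)
          - (∑ i, ℓ (network dims ρ W t ((S i).1).val) (S i).2) / (m : ℝ)} =
      Set.range fun θ => ∫ q, h θ q ∂D - (∑ i, h θ (S i)) / (m : ℝ) := fun S => by
    ext z
    constructor
    · rintro ⟨W, hW, rfl⟩
      exact ⟨⟨W, hW⟩, rfl⟩
    · rintro ⟨θ, rfl⟩
      exact ⟨θ.1, θ.2, rfl⟩
  simp_rw [hset]
  have htotal := chain_total_le hA he he1 hM hd' hm' hR hN hdmN hv hδ
  refine (integral_sSup_le_of_gapBound (hgap.mono htotal) (by positivity)).trans ?_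
  have hNp : (N : ℝ) ^ (t + 1) ≤ c ^ (t + 1) * Real.log (d * m) ^ (t + 1) := by
    rw [← mul_pow]
    exact pow_le_pow_left₀ (by positivity) hNc _
  calc C₀ * 2 ^ t * M * √(d * R ^ 2 / m) * N ^ (t + 1) ≤
        C₀ * 2 ^ t * M * √(d * R ^ 2 / m) * (c ^ (t + 1) * Real.log (d * m) ^ (t + 1)) := by gcongr
    _ = _ := by ring
end
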